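/- Let (X,𝓑,μ,T) be an invertible probability measure-preserving system, let ℓ, k ∈ ℕ, and let f : ℕ → ℝ with f ∈ 𝓕_ℓ and lim_{n→∞} n·Δ^ℓ f(n) = ∞ (as holds when f is the restriction of a tempered function). Then for any h_0, h_1,…,h_k ∈ L^∞(X,𝓑,μ), the averages (1/N) Σ_{n=1}^N T^{⌊f(n)⌋} h_0 · T^{⌊f(n+1)⌋} h_1 ⋯ T^{⌊f(n+k)⌋} h_k converge in L²(X,𝓑,μ) as N → ∞. -/

import Mathlib

open Filter Finset MeasureTheory

/-- Discrete derivative: `Δg(n) = g(n) - g(n-1)` for `n ≥ 2`, and `Δg(1) = g(1)`. -/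
noncomputable def dd (g : ℕ → ℝ) (n : ℕ) : ℝ := if n = 1 then g 1 else g n - g (n - 1)

/-- Iterated discrete derivative `Δ^k`. -/
noncomputable def ddIter (f : ℕ → ℝ) : ℕ → ℕ → ℝ
  | 0 => f
  | k + 1 => dd (ddIter f k)

/-- `N`-th `W`-weighted average `𝔼^W_{n ≤ N} x_n`. -/
noncomputable def wavg {Y : Type*} [AddCommGroup Y] [Module ℝ Y]
    (W : ℕ → ℝ) (x : ℕ → Y) (N : ℕ) : Y :=
  (W N)⁻¹ • ∑ n ∈ Finset.Icc 1 N, dd W n • x n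

/-- `W`-weighted average over the interval `[M, N]`. -/
noncomputable def wavgI {Y : Type*} [AddCommGroup Y] [Module ℝ Y]
    (W : ℕ → ℝ) (x : ℕ → Y) (M N : ℕ) : Y :=
  (W N - W M)⁻¹ • ∑ n ∈ Finset.Icc M N, dd W n • x n

/-- Cesàro average over the interval `[M, N]`. -/
noncomputable def cesaroI {Y : Type*} [AddCommGroup Y] [Module ℝ Y]
    (x : ℕ → Y) (M N : ℕ) : Y :=
  ((N : ℝ) - (M : ℝ))⁻¹ • ∑ n ∈ Finset.Icc M N, x n

/-- Iterated `W`-weighted averages: `iterAvg W x k N = 𝔼(k)^W_{n ≤ N} x_n`,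
with the convention `iterAvg W x 0 = x`. -/
noncomputable def iterAvg {Y : Type*} [AddCommGroup Y] [Module ℝ Y]
    (W : ℕ → ℝ) (x : ℕ → Y) : ℕ → ℕ → Y
  | 0, N => x N
  | k + 1, N => (W N)⁻¹ • ∑ n ∈ Finset.Icc 1 N, dd W n • iterAvg W x k n

/-- The uniform `W`-weighted average of `x` equals `L`: `𝔼^W_unif x_n = L`. -/
def unifAvg {Y : Type*} [NormedAddCommGroup Y] [NormedSpace ℝ Y]
    (W : ℕ → ℝ) (x : ℕ → Y) (L : Y) : Prop :=
  ∀ ε > (0 : ℝ), ∃ K > (0 : ℝ), ∀ M N : ℕ, 1 ≤ M → M ≤ N → K ≤ W N - W M →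
    ‖wavgI W x M N - L‖ < ε

/-- `𝔼(∞)^W x_n = L`: `lim_{k → ∞} limsup_{N → ∞} ‖𝔼(k)^W_{n ≤ N}(x_n - L)‖ = 0`. -/
def iterInfty {Y : Type*} [NormedAddCommGroup Y] [NormedSpace ℝ Y]
    (W : ℕ → ℝ) (x : ℕ → Y) (L : Y) : Prop :=
  Tendsto (fun k => Filter.limsup (fun N => ‖iterAvg W (fun n => x n - L) (k + 1) N‖) atTop)
    atTop (nhds 0)

/-- Membership in the class `𝓕₁`. -/
def inF1 (f : ℕ → ℝ) : Prop :=
  Tendsto f atTop atTop ∧ Tendsto (fun n => dd f n) atTop (nhds 0) ∧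
    ∃ n₀ : ℕ, ∀ m n : ℕ, n₀ ≤ m → m ≤ n → dd f n ≤ dd f m

/-- `memF ℓ f` means `f ∈ 𝓕_{ℓ+1}`. -/
def memF : ℕ → (ℕ → ℝ) → Prop
  | 0, f => inF1 f
  | ℓ + 1, f => memF ℓ (dd f)

/-- Integer powers `T^m` of an invertible map `T` with inverse `e`. -/
def zpowIter {X : Type*} (T e : X → X) (m : ℤ) : X → X :=
  if 0 ≤ m then T^[m.toNat] else e^[(-m).toNat]

/-- `p(Δ)f(n)` for an integer polynomial `p`. -/
noncomputable def polyDD (p : Polynomial ℤ) (f : ℕ → ℝ) (n : ℕ) : ℝ :=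
  ∑ j ∈ Finset.range (p.natDegree + 1), (p.coeff j : ℝ) * ddIter f j n

/-- `E ⊆ ℕ = {1, 2, ...}` has positive upper Banach density. -/
def posUBD (E : Set ℕ) : Prop :=
  ∃ δ : ℝ, 0 < δ ∧ ∃ M N : ℕ → ℕ, (∀ j, 1 ≤ M j ∧ M j ≤ N j) ∧
    Tendsto (fun j => N j - M j) atTop atTop ∧
    ∀ j, δ * ((N j : ℝ) - (M j : ℝ)) ≤ (Nat.card ↥(E ∩ Set.Icc (M j) (N j)) : ℝ)

namespace WE
universe u

/-- A real flow on a set. -/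
structure Flow (Y : Type u) where
  S : ℝ → Y → Y
  zero : ∀ y, S 0 y = y
  add : ∀ a b y, S (a + b) y = S a (S b y)

/-- Bounded functions that are uniformly Lipschitz along the flow. -/
def Flow.alg {Y : Type u} (F : Flow Y) : Subalgebra ℝ (Y → ℝ) where
  carrier := {f | (∃ C, ∀ y, |f y| ≤ C) ∧ ∃ K, ∀ t y, |f (F.S t y) - f y| ≤ K * |t|}
  mul_mem' := by
    rintro f g ⟨⟨C, hC⟩, K, hK⟩ ⟨⟨C', hC'⟩, K', hK'⟩
    refine ⟨⟨C * C', fun y => ?_⟩, C' * K + C * K', fun t y => ?_⟩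
    · have hC0 : 0 ≤ C := (abs_nonneg _).trans (hC y)
      simp only [Pi.mul_apply, abs_mul]
      exact mul_le_mul (hC y) (hC' y) (abs_nonneg _) hC0
    · have h0 : f (F.S t y) * g (F.S t y) - f y * g y
        = (f (F.S t y) - f y) * g (F.S t y) + f y * (g (F.S t y) - g y) := by ring
      simp only [Pi.mul_apply]
      rw [h0]
      refine (abs_add_le _ _).trans ?_
      rw [abs_mul, abs_mul]
      have hC0 : 0 ≤ C := (abs_nonneg _).trans (hC y)
      have h1 := mul_le_mul (hK t y) (hC' (F.S t y)) (abs_nonneg _)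
        ((abs_nonneg _).trans (hK t y))
      have h2 := mul_le_mul (hC y) (hK' t y) (abs_nonneg _) hC0
      nlinarith
  add_mem' := by
    rintro f g ⟨⟨C, hC⟩, K, hK⟩ ⟨⟨C', hC'⟩, K', hK'⟩
    refine ⟨⟨C + C', fun y => (abs_add_le _ _).trans (add_le_add (hC y) (hC' y))⟩,
      K + K', fun t y => ?_⟩
    have h0 : f (F.S t y) + g (F.S t y) - (f y + g y)
        = (f (F.S t y) - f y) + (g (F.S t y) - g y) := by ring
    simp only [Pi.add_apply]
    rw [h0]
    refine (abs_add_le _ _).trans ?_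
    nlinarith [hK t y, hK' t y]
  algebraMap_mem' := by
    intro r
    exact ⟨⟨|r|, fun y => by simp [Pi.algebraMap_apply]⟩, 0, fun t y => by
      simp [Pi.algebraMap_apply]⟩

variable {Y : Type u}

lemma Flow.S_neg (F : Flow Y) (t : ℝ) (y : Y) : F.S (-t) (F.S t y) = y := by
  rw [← F.add]; simp [F.zero]

/-- Pullback of functions along a map of flows. -/
def Flow.pull {Y Z : Type u} (F : Flow Y) (G : Flow Z) (θ : Z → Y)
    (hθ : ∀ t z, θ (G.S t z) = F.S t (θ z)) : F.alg →ₐ[ℝ] G.alg where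
  toFun a := ⟨fun z => a.1 (θ z), by
    obtain ⟨⟨C, hC⟩, K, hK⟩ := a.2
    exact ⟨⟨C, fun y => hC _⟩, K, fun t y => by simpa only [hθ] using hK t (θ y)⟩⟩
  map_one' := rfl
  map_mul' _ _ := rfl
  map_zero' := rfl
  map_add' _ _ := rfl
  commutes' _ := rfl

set_option linter.unusedSectionVars false

/-- The action of the flow on functions. -/
def Flow.act (F : Flow Y) (t : ℝ) : F.alg →ₐ[ℝ] F.alg :=
  F.pull F (F.S t) (fun s y => by rw [← F.add, ← F.add, add_comm])

@[simp] lemma Flow.act_apply (F : Flow Y) (t : ℝ) (a : F.alg) (y : Y) :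
    (F.act t a).1 y = a.1 (F.S t y) := rfl

@[simp] lemma Flow.act_zero (F : Flow Y) (a : F.alg) : F.act 0 a = a := by
  apply Subtype.ext; funext y; simp [F.zero]

lemma Flow.act_act (F : Flow Y) (t t' : ℝ) (a : F.alg) :
    F.act t (F.act t' a) = F.act (t + t') a := by
  apply Subtype.ext; funext y
  simp only [Flow.act_apply]; rw [← F.add, add_comm]

/-- A flow with an invariant state. -/
structure Sys (Y : Type u) extends Flow Y where
  φ : toFlow.alg →ₗ[ℝ] ℝ
  φ_one : φ 1 = 1
  φ_nonneg : ∀ a : toFlow.alg, (∀ y, 0 ≤ a.1 y) → 0 ≤ φ a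
  φ_inv : ∀ t a, φ (toFlow.act t a) = φ a

/-- The algebra of a system. -/
abbrev Sys.A (s : Sys Y) := ↥(s.toFlow.alg)

abbrev Sys.act (s : Sys Y) (t : ℝ) : s.A →ₐ[ℝ] s.A := s.toFlow.act t

lemma Sys.φ_mono (s : Sys Y) {a b : s.A} (h : ∀ y, a.1 y ≤ b.1 y) : s.φ a ≤ s.φ b := by
  have := s.φ_nonneg (b - a) (fun y => by simpa using h y)
  rw [map_sub] at this; linarith

/-- Type synonym carrying the pre-Hilbert structure. -/
def Sys.Pre (s : Sys Y) : Type u := s.A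

instance (s : Sys Y) : AddCommGroup s.Pre := inferInstanceAs (AddCommGroup s.A)
instance (s : Sys Y) : Module ℝ s.Pre := inferInstanceAs (Module ℝ s.A)

def Sys.toPre (s : Sys Y) : s.A →ₗ[ℝ] s.Pre := LinearMap.id

@[reducible] def Sys.core (s : Sys Y) : PreInnerProductSpace.Core ℝ s.Pre where
  inner a b := s.φ ((show s.A from a) * (show s.A from b))
  conj_inner_symm a b := by
    simp only [conj_trivial]
    exact congrArg s.φ (mul_comm (show s.A from b) (show s.A from a))
  re_inner_nonneg a := by
    simp only [RCLike.re_to_real]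
    exact s.φ_nonneg _ (fun y => mul_self_nonneg _)
  add_left a b c := by
    show s.φ (((show s.A from a) + (show s.A from b)) * (show s.A from c)) = _
    rw [add_mul, map_add]
  smul_left a b r := by
    show s.φ ((r • (show s.A from a)) * (show s.A from b)) = _
    rw [smul_mul_assoc, map_smul]; rfl

noncomputable instance (s : Sys Y) : SeminormedAddCommGroup s.Pre :=
  @InnerProductSpace.Core.toSeminormedAddCommGroup ℝ s.Pre _ _ _ s.core

noncomputable instance (s : Sys Y) : InnerProductSpace ℝ s.Pre :=
  InnerProductSpace.ofCore s.core

/-- The Hilbert space of a system. -/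
abbrev Sys.H (s : Sys Y) : Type u := UniformSpace.Completion s.Pre

noncomputable def Sys.ι (s : Sys Y) : s.A →ₗ[ℝ] s.H :=
  (UniformSpace.Completion.toComplL (𝕜 := ℝ) (E := s.Pre)).toLinearMap ∘ₗ s.toPre

lemma Sys.inner_ι (s : Sys Y) (a b : s.A) : inner ℝ (s.ι a) (s.ι b) = s.φ (a * b) := by
  show inner ℝ ((s.toPre a : s.Pre) : s.H) ((s.toPre b : s.Pre) : s.H) = _
  rw [UniformSpace.Completion.inner_coe]; rfl

lemma Sys.ι_dense (s : Sys Y) : DenseRange s.ι :=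
  UniformSpace.Completion.denseRange_coe (α := s.Pre)

lemma Sys.norm_ι_sq (s : Sys Y) (a : s.A) : ‖s.ι a‖ ^ 2 = s.φ (a * a) := by
  rw [← s.inner_ι, real_inner_self_eq_norm_sq]

lemma Sys.norm_ι_le (s : Sys Y) {a : s.A} {C : ℝ} (h0 : 0 ≤ C) (h : ∀ y, |a.1 y| ≤ C) :
    ‖s.ι a‖ ≤ C := by
  refine abs_le_of_sq_le_sq' ?_ h0 |>.2
  rw [s.norm_ι_sq]
  have : s.φ (a * a) ≤ s.φ ((C ^ 2) • (1 : s.A)) := s.φ_mono (fun y => by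
    have := sq_le_sq' (abs_le.1 (h y)).1 (abs_le.1 (h y)).2
    simpa [sq] using this)
  simpa [s.φ_one] using this

end WE

namespace WE
universe u
variable {Y Z : Type u}

lemma Sys.exists_bd (s : Sys Y) (a : s.A) : ∃ C, 0 ≤ C ∧ ∀ y, |a.1 y| ≤ C := by
  obtain ⟨⟨C, hC⟩, -⟩ := a.2
  exact ⟨|C|, abs_nonneg _, fun y => (hC y).trans (le_abs_self _)⟩

lemma Sys.norm_ι_mul_le (s : Sys Y) {a : s.A} {C : ℝ} (h0 : 0 ≤ C) (h : ∀ y, |a.1 y| ≤ C)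
    (b : s.A) : ‖s.ι (a * b)‖ ≤ C * ‖s.ι b‖ := by
  refine abs_le_of_sq_le_sq' ?_ (by positivity) |>.2
  rw [mul_pow, s.norm_ι_sq, s.norm_ι_sq]
  have : s.φ (a * b * (a * b)) ≤ s.φ ((C ^ 2) • (b * b)) := s.φ_mono (fun y => by
    have h1 := sq_le_sq' (abs_le.1 (h y)).1 (abs_le.1 (h y)).2
    have h2 := mul_le_mul_of_nonneg_right h1 (mul_self_nonneg (b.1 y))
    have h3 : (a * b * (a * b)).1 y = a.1 y ^ 2 * (b.1 y * b.1 y) := by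
      show a.1 y * b.1 y * (a.1 y * b.1 y) = _
      ring
    have h4 : ((C ^ 2) • (b * b)).1 y = C ^ 2 * (b.1 y * b.1 y) := rfl
    rw [h3, h4]; exact h2)
  simpa using this

/-- Multiplication operators. -/
noncomputable def Sys.M (s : Sys Y) (a : s.A) : s.H →L[ℝ] s.H :=
  (s.ι ∘ₗ LinearMap.mulLeft ℝ a).extendOfNorm s.ι

lemma Sys.M_ι (s : Sys Y) (a b : s.A) : s.M a (s.ι b) = s.ι (a * b) := by
  obtain ⟨C, h0, hC⟩ := s.exists_bd a
  exact LinearMap.extendOfNorm_eq s.ι_dense ⟨C, fun b => s.norm_ι_mul_le h0 hC b⟩ b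

lemma Sys.norm_M_le (s : Sys Y) {a : s.A} {C : ℝ} (h0 : 0 ≤ C) (h : ∀ y, |a.1 y| ≤ C)
    (x : s.H) : ‖s.M a x‖ ≤ C * ‖x‖ :=
  LinearMap.norm_extendOfNorm_apply_le s.ι_dense C (fun b => s.norm_ι_mul_le h0 h b) x

/-- Koopman operators. -/
noncomputable def Sys.koop (s : Sys Y) (s' : Sys Z) (T : s.A →ₐ[ℝ] s'.A) : s.H →L[ℝ] s'.H :=
  (s'.ι ∘ₗ T.toLinearMap).extendOfNorm s.ι

lemma Sys.norm_ι_map (s : Sys Y) (s' : Sys Z) {T : s.A →ₐ[ℝ] s'.A}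
    (hT : ∀ a, s'.φ (T a) = s.φ a) (a : s.A) : ‖s'.ι (T a)‖ = ‖s.ι a‖ := by
  rw [← sq_eq_sq₀ (norm_nonneg _) (norm_nonneg _), s.norm_ι_sq, s'.norm_ι_sq, ← map_mul, hT]

lemma Sys.koop_ι (s : Sys Y) (s' : Sys Z) {T : s.A →ₐ[ℝ] s'.A}
    (hT : ∀ a, s'.φ (T a) = s.φ a) (a : s.A) : s.koop s' T (s.ι a) = s'.ι (T a) :=
  LinearMap.extendOfNorm_eq s.ι_dense ⟨1, fun b => by
    rw [one_mul]; exact (s.norm_ι_map s' hT b).le⟩ a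

lemma Sys.norm_koop (s : Sys Y) (s' : Sys Z) {T : s.A →ₐ[ℝ] s'.A}
    (hT : ∀ a, s'.φ (T a) = s.φ a) (x : s.H) : ‖s.koop s' T x‖ = ‖x‖ := by
  refine s.ι_dense.induction_on (p := fun x => ‖s.koop s' T x‖ = ‖x‖) x
    (isClosed_eq (by fun_prop) (by fun_prop)) (fun a => ?_)
  rw [s.koop_ι s' hT, s.norm_ι_map s' hT]

set_option linter.unusedSectionVars false

/-- The unitary flow. -/
noncomputable def Sys.V (s : Sys Y) (t : ℝ) : s.H →L[ℝ] s.H := s.koop s (s.act t)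

lemma Sys.V_ι (s : Sys Y) (t : ℝ) (a : s.A) : s.V t (s.ι a) = s.ι (s.act t a) :=
  s.koop_ι s (s.φ_inv t) a

lemma Sys.norm_V (s : Sys Y) (t : ℝ) (x : s.H) : ‖s.V t x‖ = ‖x‖ := s.norm_koop s (s.φ_inv t) x

/-- A finitely additive probability (mean), totally defined and linear, positive on bounded
functions. -/
structure Mean (J : Type*) where
  m : (J → ℝ) →ₗ[ℝ] ℝ
  one : m (fun _ => 1) = 1
  nonneg : ∀ g : J → ℝ, (∃ C, ∀ j, |g j| ≤ C) → (∀ j, 0 ≤ g j) → 0 ≤ m g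

lemma Mean.mono {J : Type*} (m : Mean J) {g h : J → ℝ} (hg : ∃ C, ∀ j, |g j| ≤ C)
    (hh : ∃ C, ∀ j, |h j| ≤ C) (hle : ∀ j, g j ≤ h j) : m.m g ≤ m.m h := by
  obtain ⟨C, hC⟩ := hg
  obtain ⟨D, hD⟩ := hh
  have := m.nonneg (h - g) ⟨D + C, fun j => (abs_sub _ _).trans (add_le_add (hD j) (hC j))⟩
    (fun j => by simpa using hle j)
  rw [map_sub] at this; linarith

lemma Mean.const {J : Type*} (m : Mean J) (c : ℝ) : m.m (fun _ => c) = c := by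
  have : (fun _ : J => c) = c • (fun _ : J => (1 : ℝ)) := by funext j; simp
  rw [this, map_smul, m.one]; simp

variable {J : Type}

/-- Product flow: the flow acts on the second coordinate only. -/
def Flow.prod (J : Type) (F : Flow Y) : Flow (J × Y) where
  S t p := (p.1, F.S t p.2)
  zero p := by simp [F.zero]
  add a b p := by simp [F.add]

/-- Evaluation of the first coordinate. -/
def Flow.ev (F : Flow Y) (j : J) : (F.prod J).alg →ₐ[ℝ] F.alg :=
  (F.prod J).pull F (fun y => (j, y)) (fun _ _ => rfl)

/-- The function `(j, y) ↦ a (S^{θ j} y)`. -/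
def Flow.fam (F : Flow Y) (θ : J → ℝ) : F.alg →ₐ[ℝ] (F.prod J).alg :=
  F.pull (F.prod J) (fun p => F.S (θ p.1) p.2) (fun t p => by
    show F.S (θ p.1) (F.S t p.2) = _
    rw [← F.add, ← F.add, add_comm])

@[simp] lemma Flow.ev_fam (F : Flow Y) (θ : J → ℝ) (j : J) (a : F.alg) :
    F.ev j (F.fam θ a) = F.act (θ j) a := rfl

@[simp] lemma Flow.ev_act (F : Flow Y) (j : J) (t : ℝ) (a : (F.prod J).alg) :
    F.ev j ((F.prod J).act t a) = F.act t (F.ev j a) := rfl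

lemma Flow.ev_ext (F : Flow Y) {a b : (F.prod J).alg} (h : ∀ j : J, F.ev j a = F.ev j b) :
    a = b := by
  apply Subtype.ext; funext p
  exact congrFun (congrArg Subtype.val (h p.1)) p.2

lemma Sys.ev_bdd (s : Sys Y) (a : (s.toFlow.prod J).alg) :
    ∃ C, ∀ j, |s.φ (s.toFlow.ev j a)| ≤ C := by
  obtain ⟨⟨C, hC⟩, -⟩ := a.2
  refine ⟨C, fun j => abs_le.2 ⟨?_, ?_⟩⟩
  · have := s.φ_mono (a := (-C) • (1 : s.A)) (b := s.toFlow.ev j a)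
      (fun y => by
        have h2 : ((-C) • (1 : s.A)).1 y = -C * 1 := rfl
        rw [h2, mul_one]; exact (abs_le.1 (hC (j, y))).1)
    simpa [s.φ_one] using this
  · have := s.φ_mono (b := C • (1 : s.A)) (a := s.toFlow.ev j a)
      (fun y => by
        have h2 : (C • (1 : s.A)).1 y = C * 1 := rfl
        rw [h2, mul_one]; exact (abs_le.1 (hC (j, y))).2)
    simpa [s.φ_one] using this

/-- The extension of a system by a mean. -/
def Sys.ext (s : Sys Y) (m : Mean J) : Sys (J × Y) where
  toFlow := s.toFlow.prod J
  φ := m.m ∘ₗ LinearMap.pi (fun j => s.φ ∘ₗ (s.toFlow.ev j).toLinearMap)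
  φ_one := by
    show m.m (fun j => s.φ (s.toFlow.ev j 1)) = 1
    simp only [map_one, s.φ_one, m.one]
  φ_nonneg a ha := m.nonneg _ (s.ev_bdd a) (fun j => s.φ_nonneg _ (fun y => ha _))
  φ_inv t a := by
    show m.m (fun j => s.φ (s.toFlow.ev j _)) = m.m (fun j => s.φ (s.toFlow.ev j _))
    simp only [Flow.ev_act, s.φ_inv]

/-- Evaluation in an extension. -/
def Sys.evm (s : Sys Y) (m : Mean J) (j : J) : (s.ext m).A →ₐ[ℝ] s.A := s.toFlow.ev j

/-- Families in an extension. -/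
def Sys.famm (s : Sys Y) (m : Mean J) (θ : J → ℝ) : s.A →ₐ[ℝ] (s.ext m).A := s.toFlow.fam θ

@[simp] lemma Sys.evm_famm (s : Sys Y) (m : Mean J) (θ : J → ℝ) (j : J) (a : s.A) :
    s.evm m j (s.famm m θ a) = s.act (θ j) a := rfl

@[simp] lemma Sys.evm_act (s : Sys Y) (m : Mean J) (j : J) (t : ℝ) (a : (s.ext m).A) :
    s.evm m j ((s.ext m).act t a) = s.act t (s.evm m j a) := rfl

lemma Sys.evm_ext (s : Sys Y) (m : Mean J) {a b : (s.ext m).A}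
    (h : ∀ j : J, s.evm m j a = s.evm m j b) : a = b := Flow.ev_ext _ h

lemma Sys.evm_bdd (s : Sys Y) (m : Mean J) (a : (s.ext m).A) :
    ∃ C, ∀ j, |s.φ (s.evm m j a)| ≤ C := s.ev_bdd a

lemma Sys.evm_apply (s : Sys Y) (m : Mean J) (j : J) (a : (s.ext m).A) (y : Y) :
    (s.evm m j a).1 y = a.1 (j, y) := rfl

lemma Sys.ext_φ (s : Sys Y) (m : Mean J) (a : (s.ext m).A) :
    (s.ext m).φ a = m.m (fun j => s.φ (s.evm m j a)) := rfl

/-- Constant families. -/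
def Sys.pr (s : Sys Y) (m : Mean J) : s.A →ₐ[ℝ] (s.ext m).A := s.famm m (fun _ => 0)

@[simp] lemma Sys.evm_pr (s : Sys Y) (m : Mean J) (j : J) (a : s.A) :
    s.evm m j (s.pr m a) = a := Flow.act_zero _ a

lemma Sys.pr_φ (s : Sys Y) (m : Mean J) (a : s.A) : (s.ext m).φ (s.pr m a) = s.φ a := by
  rw [s.ext_φ]
  simp only [Sys.evm_pr, m.const]

/-- Conditional expectation onto the base. -/
noncomputable def Sys.Pi (s : Sys Y) (m : Mean J) : (s.ext m).H →L[ℝ] s.H :=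
  ContinuousLinearMap.adjoint (s.koop (s.ext m) (s.pr m))

lemma Sys.inner_Pi (s : Sys Y) (m : Mean J) (x : (s.ext m).H) (a : s.A) :
    inner ℝ (s.Pi m x) (s.ι a) = inner ℝ x ((s.ext m).ι (s.pr m a)) := by
  rw [Sys.Pi, ContinuousLinearMap.adjoint_inner_left, s.koop_ι _ (s.pr_φ m)]

lemma Sys.norm_Pi_le (s : Sys Y) (m : Mean J) (x : (s.ext m).H) : ‖s.Pi m x‖ ≤ ‖x‖ := by
  have h1 : ‖s.Pi m‖ ≤ 1 := by
    rw [Sys.Pi, LinearIsometryEquiv.norm_map]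
    exact ContinuousLinearMap.opNorm_le_bound _ zero_le_one (fun x => by
      rw [s.norm_koop _ (s.pr_φ m), one_mul])
  simpa using (s.Pi m).le_of_opNorm_le h1 x

lemma Sys.ext_inner_ι (s : Sys Y) {x y : s.H} (h : ∀ a, inner ℝ x (s.ι a) = inner ℝ y (s.ι a)) :
    x = y := by
  exact s.ι_dense.eq_of_inner_left (𝕜 := ℝ) (fun {a} => h a)

end WE

namespace WE
universe u

/-- Finite averages of translations. -/
structure Avg (E : Type) where
  I : Type
  fin : Fintype I
  ne : Nonempty I
  p : I → E

attribute [instance] Avg.fin Avg.ne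

section Avg
variable {E : Type} [AddCommGroup E]
variable {H : Type*} [NormedAddCommGroup H] [NormedSpace ℝ H]
variable {H' : Type*} [NormedAddCommGroup H'] [NormedSpace ℝ H']

set_option linter.unusedSectionVars false

/-- Average of `F` over translates. -/
noncomputable def Avg.ap (P : Avg E) (F : E → H) (u : E) : H :=
  (Fintype.card P.I : ℝ)⁻¹ • ∑ i, F (u + P.p i)

lemma Avg.card_pos {E : Type} (P : Avg E) : (0 : ℝ) < Fintype.card P.I := by
  exact_mod_cast Fintype.card_pos

lemma Avg.ap_add (P : Avg E) (F G : E → H) (u : E) :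
    P.ap (fun u => F u + G u) u = P.ap F u + P.ap G u := by
  simp [Avg.ap, Finset.sum_add_distrib]

lemma Avg.ap_sub (P : Avg E) (F G : E → H) (u : E) :
    P.ap (fun u => F u - G u) u = P.ap F u - P.ap G u := by
  simp [Avg.ap, Finset.sum_sub_distrib, smul_sub]

lemma Avg.ap_smul (P : Avg E) (c : ℝ) (F : E → H) (u : E) :
    P.ap (fun u => c • F u) u = c • P.ap F u := by
  simp only [Avg.ap, ← Finset.smul_sum]; rw [smul_comm]

lemma Avg.ap_const (P : Avg E) (c : H) (u : E) : P.ap (fun _ => c) u = c := by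
  simp only [Avg.ap, Finset.sum_const, Finset.card_univ]
  rw [← Nat.cast_smul_eq_nsmul ℝ, smul_smul, inv_mul_cancel₀ P.card_pos.ne', one_smul]

lemma Avg.ap_clm (P : Avg E) (A : H →L[ℝ] H') (F : E → H) (u : E) :
    P.ap (fun u => A (F u)) u = A (P.ap F u) := by
  simp [Avg.ap, map_sum]

lemma Avg.ap_mono (P : Avg E) {F G : E → ℝ} (u : E) (h : ∀ i, F (u + P.p i) ≤ G (u + P.p i)) :
    P.ap F u ≤ P.ap G u := by
  simp only [Avg.ap]
  exact smul_le_smul_of_nonneg_left (Finset.sum_le_sum fun i _ => h i)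
    (inv_nonneg.2 P.card_pos.le)

lemma Avg.ap_le (P : Avg E) {F : E → ℝ} {B : ℝ} (u : E) (h : ∀ u, F u ≤ B) :
    P.ap F u ≤ B :=
  (P.ap_mono (G := fun _ => B) u fun _ => h _).trans_eq (P.ap_const _ _)

lemma Avg.le_ap (P : Avg E) {F : E → ℝ} {B : ℝ} (u : E) (h : ∀ u, B ≤ F u) :
    B ≤ P.ap F u :=
  (P.ap_const B u).symm.trans_le (P.ap_mono (F := fun _ => B) u fun _ => h _)

lemma Avg.norm_ap_le_ap (P : Avg E) (F : E → H) (u : E) :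
    ‖P.ap F u‖ ≤ P.ap (fun u => ‖F u‖) u := by
  simp only [Avg.ap, norm_smul, norm_inv, RCLike.norm_natCast, smul_eq_mul]
  exact mul_le_mul_of_nonneg_left (norm_sum_le _ _) (inv_nonneg.2 P.card_pos.le)

lemma Avg.norm_ap_le (P : Avg E) {F : E → H} {B : ℝ} (u : E) (h : ∀ u, ‖F u‖ ≤ B) :
    ‖P.ap F u‖ ≤ B := (P.norm_ap_le_ap F u).trans (P.ap_le u h)

lemma Avg.norm_ap_sq_le (P : Avg E) (F : E → H) (u : E) :
    ‖P.ap F u‖ ^ 2 ≤ P.ap (fun u => ‖F u‖ ^ 2) u := by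
  have h1 := P.norm_ap_le_ap F u
  have h2 : (P.ap (fun u => ‖F u‖) u) ^ 2 ≤ P.ap (fun u => ‖F u‖ ^ 2) u := by
    simp only [Avg.ap, smul_eq_mul]
    have h3 := sq_sum_le_card_mul_sum_sq (s := (Finset.univ : Finset P.I))
      (f := fun i => ‖F (u + P.p i)‖)
    rw [Finset.card_univ] at h3
    have hc := P.card_pos
    rw [mul_pow, inv_pow, inv_mul_le_iff₀ (by positivity)]
    refine h3.trans (le_of_eq ?_)
    field_simp
  exact (pow_le_pow_left₀ (norm_nonneg _) h1 2).trans h2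

/-- Convolution of averages. -/
def Avg.conv (P Q : Avg E) : Avg E :=
  ⟨P.I × Q.I, inferInstance, inferInstance, fun x => P.p x.1 + Q.p x.2⟩

lemma Avg.conv_ap (P Q : Avg E) (F : E → H) (u : E) : (P.conv Q).ap F u = P.ap (Q.ap F) u := by
  have hc : (Fintype.card (P.conv Q).I : ℝ) = Fintype.card P.I * Fintype.card Q.I := by
    exact_mod_cast Fintype.card_prod P.I Q.I
  simp only [Avg.ap]
  rw [hc, mul_inv, ← smul_smul, ← Finset.smul_sum]
  congr 2
  show ∑ x : P.I × Q.I, F (u + (P.p x.1 + Q.p x.2)) = _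
  rw [Fintype.sum_prod_type]
  simp only [add_assoc]

lemma Avg.ap_comm (P Q : Avg E) (F : E → H) (u : E) : P.ap (Q.ap F) u = Q.ap (P.ap F) u := by
  simp only [Avg.ap, ← Finset.smul_sum]
  rw [smul_comm, Finset.sum_comm]
  congr 2
  refine Finset.sum_congr rfl fun i _ => Finset.sum_congr rfl fun j _ => ?_
  rw [add_right_comm]

/-- The trivial average. -/
def Avg.dirac (q : E) : Avg E := ⟨Unit, inferInstance, inferInstance, fun _ => q⟩

lemma Avg.dirac_ap (q : E) (F : E → H) (u : E) : (Avg.dirac q).ap F u = F (u + q) := by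
  have h1 : (Fintype.card (Avg.dirac q).I : ℝ) = 1 := by
    exact_mod_cast Fintype.card_unit
  simp only [Avg.ap, h1]
  show (1 : ℝ)⁻¹ • ∑ i : Unit, F (u + q) = _
  simp

/-- Average over `0, q, …, R q`. -/
def Avg.prog (q : E) (R : ℕ) : Avg E :=
  ⟨Fin (R + 1), inferInstance, inferInstance, fun r => (r : ℕ) • q⟩

lemma Avg.prog_ap (q : E) (R : ℕ) (F : E → H) (u : E) :
    (Avg.prog q R).ap F u = ((R : ℝ) + 1)⁻¹ • ∑ r ∈ Finset.range (R + 1), F (u + r • q) := by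
  have h1 : (Fintype.card (Avg.prog q R).I : ℝ) = R + 1 := by
    exact_mod_cast Fintype.card_fin (R + 1)
  simp only [Avg.ap, h1]
  congr 1
  exact Fin.sum_univ_eq_sum_range (fun r => F (u + r • q)) (R + 1)

/-- Telescoping: long progressions kill `F (· + q) - F`. -/
lemma Avg.prog_tele (q : E) (R : ℕ) {F : E → H} {C : ℝ} (hC : ∀ u, ‖F u‖ ≤ C) (u : E) :
    ‖(Avg.prog q R).ap (fun u => F (u + q) - F u) u‖ ≤ 2 * C / (R + 1) := by
  rw [Avg.prog_ap]
  have : ∑ r ∈ Finset.range (R + 1), (F (u + r • q + q) - F (u + r • q))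
      = F (u + (R + 1) • q) - F (u + 0 • q) := by
    rw [← Finset.sum_range_sub (fun r => F (u + r • q))]
    refine Finset.sum_congr rfl fun r _ => ?_
    rw [succ_nsmul, add_assoc]
  rw [this, norm_smul, norm_inv]
  have h1 : ‖(R : ℝ) + 1‖ = R + 1 := by
    rw [Real.norm_of_nonneg]; positivity
  rw [h1, div_eq_inv_mul]
  gcongr
  refine (norm_sub_le _ _).trans ?_
  linarith [hC (u + (R + 1) • q), hC (u + 0 • q)]

end Avg

/-- Bounded real functions. -/
def Bdd {J : Type*} (g : J → ℝ) : Prop := ∃ C, ∀ j, |g j| ≤ C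

lemma Bdd.add {J : Type*} {g h : J → ℝ} (hg : Bdd g) (hh : Bdd h) : Bdd (g + h) := by
  obtain ⟨C, hC⟩ := hg
  obtain ⟨D, hD⟩ := hh
  exact ⟨C + D, fun j => (abs_add_le _ _).trans (add_le_add (hC j) (hD j))⟩

lemma Bdd.smul {J : Type*} {g : J → ℝ} (hg : Bdd g) (c : ℝ) : Bdd (c • g) := by
  obtain ⟨C, hC⟩ := hg
  exact ⟨|c| * C, fun j => by
    simp only [Pi.smul_apply, smul_eq_mul, abs_mul]
    exact mul_le_mul_of_nonneg_left (hC j) (abs_nonneg _)⟩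

lemma Bdd.neg {J : Type*} {g : J → ℝ} (hg : Bdd g) : Bdd (-g) := by
  have := hg.smul (-1); simpa using this

lemma Bdd.sub {J : Type*} {g h : J → ℝ} (hg : Bdd g) (hh : Bdd h) : Bdd (g - h) := by
  rw [sub_eq_add_neg]; exact hg.add hh.neg

/-- The space of bounded functions. -/
def bddSub (J : Type*) : Submodule ℝ (J → ℝ) where
  carrier := {g | Bdd g}
  add_mem' := fun h1 h2 => Bdd.add h1 h2
  zero_mem' := ⟨0, fun j => by simp⟩
  smul_mem' c _ h := Bdd.smul h c

theorem exists_linear_of_sublinear {V : Type*} [AddCommGroup V] [Module ℝ V] (p : V → ℝ)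
    (hom : ∀ c : ℝ, 0 < c → ∀ g, p (c • g) = c * p g)
    (add : ∀ g h, p (g + h) ≤ p g + p h) (Φ : V) :
    ∃ m : V →ₗ[ℝ] ℝ, m Φ = p Φ ∧ ∀ g, m g ≤ p g := by
  have p0 : p 0 = 0 := by
    have := hom 2 (by norm_num) 0
    rw [smul_zero] at this; linarith
  have hH : ∀ c : ℝ, c • Φ = 0 → c • p Φ = 0 := by
    intro c hc
    rcases smul_eq_zero.1 hc with h | h
    · simp [h]
    · rw [h, p0, smul_zero]
  let f : V →ₗ.[ℝ] ℝ := LinearPMap.mkSpanSingleton' Φ (p Φ) hH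
  obtain ⟨g, hg1, hg2⟩ := exists_extension_of_le_sublinear f p hom add (by
    rintro ⟨x, hx⟩
    obtain ⟨c, rfl⟩ := Submodule.mem_span_singleton.1 hx
    show f ⟨c • Φ, hx⟩ ≤ p (c • Φ)
    have : f ⟨c • Φ, hx⟩ = c • p Φ := LinearPMap.mkSpanSingleton'_apply _ _ hH c hx
    rw [this, smul_eq_mul]
    rcases lt_trichotomy c 0 with h | h | h
    · have h1 := hom (-c) (by linarith) Φ
      have h2 := add (c • Φ) ((-c) • Φ)
      rw [← add_smul, add_neg_cancel, zero_smul, p0] at h2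
      linarith
    · simp [h, p0]
    · rw [hom c h])
  refine ⟨g, ?_, hg2⟩
  have hx : (1 : ℝ) • Φ ∈ f.domain := Submodule.mem_span_singleton.2 ⟨1, rfl⟩
  have h1 := hg1 ⟨(1 : ℝ) • Φ, hx⟩
  have h2 : f ⟨(1 : ℝ) • Φ, hx⟩ = (1 : ℝ) • p Φ := LinearPMap.mkSpanSingleton'_apply _ _ hH 1 hx
  simpa using h1.trans h2

theorem exists_mean {J : Type*} (p : (J → ℝ) → ℝ)
    (hom : ∀ c : ℝ, 0 < c → ∀ g, Bdd g → p (c • g) = c * p g)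
    (add : ∀ g h, Bdd g → Bdd h → p (g + h) ≤ p g + p h)
    (sup : ∀ g, Bdd g → ∀ B, (∀ j, g j ≤ B) → p g ≤ B)
    (Φ : J → ℝ) (hΦ : Bdd Φ) :
    ∃ m : Mean J, m.m Φ = p Φ ∧ ∀ g, Bdd g → m.m g ≤ p g := by
  obtain ⟨m, hm1, hm2⟩ := exists_linear_of_sublinear (V := bddSub J) (fun g => p g.1)
    (fun c hc g => hom c hc g.1 g.2) (fun g h => add g.1 h.1 g.2 h.2) ⟨Φ, hΦ⟩
  obtain ⟨m', hm'⟩ := m.exists_extend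
  have key : ∀ g (hg : Bdd g), m' g = m ⟨g, hg⟩ := fun g hg => by
    rw [← hm']; rfl
  have le : ∀ g, Bdd g → m' g ≤ p g := fun g hg => by rw [key g hg]; exact hm2 _
  refine ⟨⟨m', ?_, ?_⟩, ?_, le⟩
  · have b1 : Bdd (fun _ : J => (1 : ℝ)) := ⟨1, fun j => by simp⟩
    have h1 := (le _ b1).trans (sup _ b1 1 fun _ => le_rfl)
    have h2 := (le _ b1.neg).trans (sup _ b1.neg (-1) fun _ => le_rfl)
    rw [map_neg] at h2
    linarith
  · intro g hg h0
    have h2 := (le _ (Bdd.neg hg)).trans (sup _ (Bdd.neg hg) 0 fun j => by simpa using h0 j)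
    rw [map_neg] at h2
    linarith
  · show m' Φ = _
    rw [key Φ hΦ, hm1]

theorem inv_mean {J : Type} [AddCommGroup J] (C : Avg J → Prop) (hne : ∃ Q, C Q)
    (hconv : ∀ P Q, C P → C Q → C (P.conv Q)) (Φ : J → ℝ) (hΦ : Bdd Φ) :
    ∃ m : Mean J, (∀ ε > 0, ∃ Q, C Q ∧ ∀ x, Q.ap Φ x ≤ m.m Φ + ε) ∧
      ∀ G, Bdd G → ∀ Q, C Q → ∀ B, (∀ x, Q.ap G x ≤ B) → m.m G ≤ B := by
  let S : (J → ℝ) → Set ℝ := fun G => {B | ∃ Q, C Q ∧ ∀ x, Q.ap G x ≤ B}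
  have hbb : ∀ G, Bdd G → BddBelow (S G) := by
    rintro G ⟨D, hD⟩
    refine ⟨-D, ?_⟩
    rintro B ⟨Q, -, hB⟩
    exact (Q.le_ap 0 fun u => (abs_le.1 (hD u)).1).trans (hB 0)
  obtain ⟨Q0, hQ0⟩ := hne
  have hn : ∀ G, Bdd G → (S G).Nonempty := by
    rintro G ⟨D, hD⟩
    exact ⟨D, Q0, hQ0, fun x => Q0.ap_le x fun u => (abs_le.1 (hD u)).2⟩
  have hlt : ∀ G, Bdd G → ∀ ε > 0, ∃ Q, C Q ∧ ∀ x, Q.ap G x ≤ sInf (S G) + ε := by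
    intro G hG ε hε
    obtain ⟨B, ⟨Q, hQ, hB⟩, hlt⟩ := exists_lt_of_csInf_lt (hn G hG)
      (show sInf (S G) < sInf (S G) + ε by linarith)
    exact ⟨Q, hQ, fun x => (hB x).trans hlt.le⟩
  have hle : ∀ G, Bdd G → ∀ Q, C Q → ∀ B, (∀ x, Q.ap G x ≤ B) → sInf (S G) ≤ B :=
    fun G hG Q hQ B hB => csInf_le (hbb G hG) ⟨Q, hQ, hB⟩
  have hom1 : ∀ c : ℝ, 0 < c → ∀ g, Bdd g → sInf (S (c • g)) ≤ c * sInf (S g) := by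
    intro c hc g hg
    refine le_of_forall_pos_le_add fun ε hε => ?_
    obtain ⟨Q, hQ, h⟩ := hlt g hg (ε / c) (by positivity)
    refine hle _ (hg.smul c) Q hQ _ fun x => ?_
    have h1 : Q.ap (c • g) x = c • Q.ap g x := Q.ap_smul c g x
    rw [h1, smul_eq_mul]
    calc c * Q.ap g x ≤ c * (sInf (S g) + ε / c) := by gcongr; exact h x
      _ = _ := by field_simp
  obtain ⟨m, hm1, hm2⟩ := exists_mean (fun G => sInf (S G))
    (fun c hc g hg => by
      refine le_antisymm (hom1 c hc g hg) ?_
      have := hom1 c⁻¹ (inv_pos.2 hc) (c • g) (hg.smul c)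
      rw [smul_smul, inv_mul_cancel₀ hc.ne', one_smul] at this
      calc c * sInf (S g) ≤ c * (c⁻¹ * sInf (S (c • g))) := by gcongr
        _ = _ := by field_simp)
    (fun g h hg hh => by
      refine le_of_forall_pos_le_add fun ε hε => ?_
      obtain ⟨Q, hQ, hQ'⟩ := hlt g hg (ε / 2) (by positivity)
      obtain ⟨P, hP, hP'⟩ := hlt h hh (ε / 2) (by positivity)
      refine hle _ (hg.add hh) (P.conv Q) (hconv _ _ hP hQ) _ fun x => ?_
      have h1 : (P.conv Q).ap (g + h) x = (P.conv Q).ap g x + (P.conv Q).ap h x :=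
        (P.conv Q).ap_add g h x
      rw [h1, Avg.conv_ap, Avg.conv_ap, P.ap_comm Q h]
      have h2 := P.ap_le x hQ'
      have h3 := Q.ap_le x hP'
      linarith)
    (fun g hg B hB => hle g hg Q0 hQ0 B fun x => Q0.ap_le x hB) Φ hΦ
  refine ⟨m, fun ε hε => ?_, fun G hG Q hQ B hB => (hm2 G hG).trans (hle G hG Q hQ B hB)⟩
  rw [hm1]
  exact hlt Φ hΦ ε hε

end WE

namespace WE
universe u
variable {Y : Type u} {E : Type} [AddCommGroup E] [Module ℝ E]

/-- Products along a list of linear forms. -/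
noncomputable def Sys.F (s : Sys Y) (L : List ((E →ₗ[ℝ] ℝ) × s.A)) (u : E) : s.A :=
  (L.map fun p => s.act (p.1 u) p.2).prod

@[simp] lemma Sys.F_nil (s : Sys Y) (u : E) : s.F [] u = 1 := rfl

lemma Sys.F_cons (s : Sys Y) (p : (E →ₗ[ℝ] ℝ) × s.A) (L : List ((E →ₗ[ℝ] ℝ) × s.A)) (u : E) :
    s.F (p :: L) u = s.act (p.1 u) p.2 * s.F L u := by
  simp [Sys.F]

lemma Sys.F_append (s : Sys Y) (L L' : List ((E →ₗ[ℝ] ℝ) × s.A)) (u : E) :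
    s.F (L ++ L') u = s.F L u * s.F L' u := by
  simp [Sys.F]

lemma Sys.F_perm (s : Sys Y) {L L' : List ((E →ₗ[ℝ] ℝ) × s.A)} (h : L.Perm L') (u : E) :
    s.F L u = s.F L' u := (h.map _).prod_eq

lemma Sys.F_bdd (s : Sys Y) (L : List ((E →ₗ[ℝ] ℝ) × s.A)) :
    ∃ C, 0 ≤ C ∧ ∀ u y, |(s.F L u).1 y| ≤ C := by
  induction L with
  | nil => exact ⟨1, zero_le_one, fun u y => by simp⟩
  | cons p L ih =>
    obtain ⟨C, h0, hC⟩ := ih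
    obtain ⟨D, h1, hD⟩ := s.exists_bd p.2
    refine ⟨D * C, by positivity, fun u y => ?_⟩
    rw [s.F_cons]
    have : (s.act (p.1 u) p.2 * s.F L u).1 y = p.2.1 (s.S (p.1 u) y) * (s.F L u).1 y := rfl
    rw [this, abs_mul]
    exact mul_le_mul (hD _) (hC u y) (abs_nonneg _) h1

lemma Sys.F_norm_bdd (s : Sys Y) (L : List ((E →ₗ[ℝ] ℝ) × s.A)) :
    ∃ C, 0 ≤ C ∧ ∀ u, ‖s.ι (s.F L u)‖ ≤ C := by
  obtain ⟨C, h0, hC⟩ := s.F_bdd L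
  exact ⟨C, h0, fun u => s.norm_ι_le h0 (hC u)⟩

lemma Sys.F_lip' (s : Sys Y) (L : List ((E →ₗ[ℝ] ℝ) × s.A)) :
    ∃ K, 0 ≤ K ∧ ∀ u v y, |(s.F L u).1 y - (s.F L v).1 y|
      ≤ K * (L.map fun p => |p.1 (u - v)|).sum := by
  induction L with
  | nil => exact ⟨0, le_rfl, fun u v y => by simp⟩
  | cons p L ih =>
    obtain ⟨K, hK0, hK⟩ := ih
    obtain ⟨C, h0, hC⟩ := s.F_bdd L
    obtain ⟨D, h1, hD⟩ := s.exists_bd p.2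
    obtain ⟨-, K', hK'⟩ := p.2.2
    refine ⟨C * |K'| + D * K, by positivity, fun u v y => ?_⟩
    rw [s.F_cons, s.F_cons]
    have e1 : ∀ w, (s.act (p.1 w) p.2 * s.F L w).1 y = p.2.1 (s.S (p.1 w) y) * (s.F L w).1 y :=
      fun _ => rfl
    rw [e1, e1, List.map_cons, List.sum_cons]
    set A := p.2.1 (s.S (p.1 u) y)
    set B := p.2.1 (s.S (p.1 v) y) with hB
    set a := (s.F L u).1 y
    set b := (s.F L v).1 y
    have hAB : |A - B| ≤ |K'| * |p.1 (u - v)| := by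
      have := hK' (p.1 (u - v)) (s.S (p.1 v) y)
      rw [← s.add, ← map_add, sub_add_cancel] at this
      refine this.trans ?_
      gcongr
      exact le_abs_self _
    have hab := hK u v y
    have hs : 0 ≤ (L.map fun p => |p.1 (u - v)|).sum :=
      List.sum_nonneg (by
        intro x hx
        obtain ⟨q, -, rfl⟩ := List.mem_map.1 hx
        exact abs_nonneg _)
    have e2 : A * a - B * b = (A - B) * a + B * (a - b) := by ring
    rw [e2]
    refine (abs_add_le _ _).trans ?_
    rw [abs_mul, abs_mul]
    have t1 := mul_le_mul hAB (hC u y) (abs_nonneg _) (by positivity)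
    have t2 := mul_le_mul (hD (s.S (p.1 v) y)) hab (abs_nonneg _) h1
    set q := |p.1 (u - v)|
    have hq : 0 ≤ q := abs_nonneg _
    set σ := (L.map fun p => |p.1 (u - v)|).sum
    have n1 : 0 ≤ C * |K'| * σ := by positivity
    have n2 : 0 ≤ D * K * q := by positivity
    nlinarith

lemma Sys.F_lip (s : Sys Y) (L : List ((E →ₗ[ℝ] ℝ) × s.A)) :
    ∃ K, 0 ≤ K ∧ ∀ u v, ‖s.ι (s.F L u) - s.ι (s.F L v)‖
      ≤ K * (L.map fun p => |p.1 (u - v)|).sum := by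
  obtain ⟨K, h0, hK⟩ := s.F_lip' L
  refine ⟨K, h0, fun u v => ?_⟩
  rw [← map_sub]
  refine s.norm_ι_le (mul_nonneg h0 (List.sum_nonneg (by
        intro x hx
        obtain ⟨q, -, rfl⟩ := List.mem_map.1 hx
        exact abs_nonneg _))) (hK u v)

lemma Sys.F_tendsto (s : Sys Y) (L : List ((E →ₗ[ℝ] ℝ) × s.A)) {α : Type*} {l : Filter α}
    (u v : α → E) (h : ∀ p ∈ L, Tendsto (fun n => p.1 (u n - v n)) l (nhds 0)) :
    Tendsto (fun n => s.ι (s.F L (u n)) - s.ι (s.F L (v n))) l (nhds 0) := by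
  obtain ⟨K, h0, hK⟩ := s.F_lip L
  refine squeeze_zero_norm (fun n => hK (u n) (v n)) ?_
  have : Tendsto (fun n => (L.map fun p => |p.1 (u n - v n)|).sum) l (nhds 0) := by
    clear hK
    induction L with
    | nil => simpa using tendsto_const_nhds
    | cons p L ih =>
      simp only [List.map_cons, List.sum_cons]
      have h1 := (h p (by simp)).abs
      have h2 := ih (fun q hq => h q (by simp [hq]))
      simpa using h1.add h2
  simpa using this.const_mul K

/-- Translating a list. -/
def Sys.tr (s : Sys Y) (t : E) (L : List ((E →ₗ[ℝ] ℝ) × s.A)) : List ((E →ₗ[ℝ] ℝ) × s.A) :=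
  L.map fun p => (p.1, s.act (p.1 t) p.2)

lemma Sys.F_tr (s : Sys Y) (t : E) (L : List ((E →ₗ[ℝ] ℝ) × s.A)) (u : E) :
    s.F (s.tr t L) u = s.F L (u + t) := by
  simp only [Sys.F, Sys.tr, List.map_map]
  congr 1
  refine List.map_congr_left fun p _ => ?_
  simp only [Function.comp]
  rw [Flow.act_act, map_add]

lemma Sys.inner_M (s : Sys Y) (a : s.A) (x : s.H) (b : s.A) :
    inner ℝ (s.M a x) (s.ι b) = inner ℝ x (s.ι (a * b)) := by
  refine s.ι_dense.induction_on
    (p := fun x => inner ℝ (s.M a x) (s.ι b) = inner ℝ x (s.ι (a * b))) x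
    (isClosed_eq (by fun_prop) (by fun_prop)) (fun c => ?_)
  rw [s.M_ι, s.inner_ι, s.inner_ι]
  congr 1; ring

lemma Sys.inner_V (s : Sys Y) (t : ℝ) (x : s.H) (b : s.A) :
    inner ℝ (s.V t x) (s.ι b) = inner ℝ x (s.ι (s.act (-t) b)) := by
  refine s.ι_dense.induction_on
    (p := fun x => inner ℝ (s.V t x) (s.ι b) = inner ℝ x (s.ι (s.act (-t) b))) x
    (isClosed_eq (by fun_prop) (by fun_prop)) (fun c => ?_)
  rw [s.V_ι, s.inner_ι, s.inner_ι, ← s.φ_inv t (c * _)]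
  simp [Flow.act_act]

/-- A class of good vector-valued functions. -/
structure GP (E : Type) where
  good : ∀ {H : Type u} [NormedAddCommGroup H] [NormedSpace ℝ H], (E → H) → Prop
  add : ∀ {H : Type u} [NormedAddCommGroup H] [NormedSpace ℝ H] (F G : E → H),
    good F → good G → good (fun u => F u + G u)
  smul : ∀ {H : Type u} [NormedAddCommGroup H] [NormedSpace ℝ H] (c : ℝ) (F : E → H),
    good F → good (fun u => c • F u)
  lim : ∀ {H : Type u} [NormedAddCommGroup H] [NormedSpace ℝ H] (F : E → H),
    (∀ ε > 0, ∃ G, good G ∧ ∀ u, ‖F u - G u‖ ≤ ε) → good F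
  clm : ∀ {H H' : Type u} [NormedAddCommGroup H] [NormedSpace ℝ H]
    [NormedAddCommGroup H'] [NormedSpace ℝ H'] (A : H →L[ℝ] H') (F : E → H),
    good F → good (fun u => A (F u))

/-- Pushforward of an average. -/
def Avg.map {E E' : Type} (f : E → E') (P : Avg E) : Avg E' := ⟨P.I, P.fin, P.ne, fun i => f (P.p i)⟩

/-- Twisted families along `κ`. -/
noncomputable def Sys.famF (s : Sys Y) {J : Type} (m : Mean J) (L : List ((E →ₗ[ℝ] ℝ) × s.A))
    (κ : J → E) (τ : J → ℝ) : (s.ext m).A :=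
  (L.map fun p => s.famm m (fun j => p.1 (κ j) + τ j) p.2).prod

lemma Sys.evm_famF (s : Sys Y) {J : Type} (m : Mean J) (L : List ((E →ₗ[ℝ] ℝ) × s.A)) (κ : J → E)
    (τ : J → ℝ) (j : J) : s.evm m j (s.famF m L κ τ) = s.act (τ j) (s.F L (κ j)) := by
  simp only [Sys.famF, Sys.F, map_list_prod, List.map_map]
  congr 1
  refine List.map_congr_left fun p _ => ?_
  simp only [Function.comp, Sys.evm_famm, Flow.act_act]
  rw [add_comm]

lemma Sys.Pi_intertwine (s : Sys Y) {J : Type} (m : Mean J) (d : s.A) (t : ℝ)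
    (c : (s.ext m).A) :
    s.M d (s.V t (s.Pi m ((s.ext m).ι c)))
      = s.Pi m ((s.ext m).ι (s.pr m d * (s.ext m).act t c)) := by
  refine s.ext_inner_ι fun b => ?_
  rw [s.inner_M, s.inner_V, s.inner_Pi, s.inner_Pi, Sys.inner_ι, Sys.inner_ι, s.ext_φ, s.ext_φ]
  congr 1
  funext j
  rw [← s.φ_inv t]
  simp only [map_mul, Sys.evm_act, Sys.evm_pr, Flow.act_act, add_neg_cancel, Flow.act_zero]
  congr 1
  ring

lemma Sys.ext_ι_eq (s : Sys Y) {J : Type} (m : Mean J) (c c' : (s.ext m).A)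
    (h : ∀ b : s.A, m.m (fun j => s.φ (s.evm m j c * b))
      = m.m (fun j => s.φ (s.evm m j c' * b))) :
    s.Pi m ((s.ext m).ι c) = s.Pi m ((s.ext m).ι c') := by
  refine s.ext_inner_ι fun b => ?_
  rw [s.inner_Pi, s.inner_Pi, Sys.inner_ι, Sys.inner_ι, s.ext_φ, s.ext_φ]
  have := h b
  simp only [map_mul, Sys.evm_pr]
  exact this

end WE

namespace WE
universe u
variable {E : Type} [AddCommGroup E]

lemma Avg.ap_comm' {H : Type*} [NormedAddCommGroup H] [NormedSpace ℝ H] (P Q : Avg E)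
    (F : E → H) : P.ap (Q.ap F) = Q.ap (P.ap F) := funext fun u => P.ap_comm Q F u

lemma Avg.conv_ap' {H : Type*} [NormedAddCommGroup H] [NormedSpace ℝ H] (P Q : Avg E)
    (F : E → H) : (P.conv Q).ap F = P.ap (Q.ap F) := funext fun u => P.conv_ap Q F u

lemma Avg.map_conv_ap {E' : Type} [AddCommGroup E'] (f : E →+ E') (P Q : Avg E) (F : E' → ℝ) :
    ((P.conv Q).map f).ap F = (P.map f).ap ((Q.map f).ap F) := by
  rw [← Avg.conv_ap']
  funext u
  simp only [Avg.ap]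
  congr 1
  show ∑ x : P.I × Q.I, F (u + f (P.p x.1 + Q.p x.2)) = ∑ x : P.I × Q.I, F (u + (f (P.p x.1) + f (Q.p x.2)))
  simp only [map_add]

lemma Avg.map_dirac_ap {E' : Type} [AddCommGroup E'] (f : E →+ E') (F : E' → ℝ) :
    ((Avg.dirac (0 : E)).map f).ap F = F := by
  funext u
  have : ((Avg.dirac (0 : E)).map f).ap F u = (Avg.dirac (f 0)).ap F u := rfl
  rw [this, Avg.dirac_ap]; simp

lemma Avg.map_prog_ap {E' : Type} [AddCommGroup E'] (f : E →+ E') (q : E) (R : ℕ) (F : E' → ℝ) :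
    ((Avg.prog q R).map f).ap F = (Avg.prog (f q) R).ap F := by
  funext u
  simp only [Avg.ap]
  congr 1
  show ∑ x : Fin (R + 1), F (u + f ((x : ℕ) • q)) = ∑ x : Fin (R + 1), F (u + (x : ℕ) • f q)
  simp only [map_nsmul]

lemma mean_inv_of {J : Type} [AddCommGroup J] (C : Avg J → Prop) (m : Mean J)
    (hm : ∀ G, Bdd G → ∀ Q, C Q → ∀ B, (∀ x, Q.ap G x ≤ B) → m.m G ≤ B) (q : J)
    (hq : ∀ G : J → ℝ, Bdd G → ∀ ε > 0, ∃ Q, C Q ∧ ∀ x, Q.ap (fun x => G (x + q) - G x) x ≤ ε)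
    (G : J → ℝ) (hG : Bdd G) : m.m (fun x => G (x + q)) = m.m G := by
  have key : ∀ G, Bdd G → m.m (fun x => G (x + q)) - m.m G ≤ 0 := by
    intro G hG
    refine le_of_forall_pos_le_add fun ε hε => ?_
    obtain ⟨Q, hQ, h⟩ := hq G hG ε hε
    have hb : Bdd (fun x => G (x + q) - G x) := by
      obtain ⟨D, hD⟩ := hG
      exact ⟨D + D, fun j => (abs_sub _ _).trans (add_le_add (hD _) (hD _))⟩
    have := hm _ hb Q hQ ε h
    have e : (fun x => G (x + q) - G x) = (fun x => G (x + q)) - G := rfl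
    rw [e, map_sub] at this
    linarith
  have h1 := key G hG
  have h2 := key (-G) hG.neg
  have e : (fun x => (-G) (x + q)) = -(fun x => G (x + q)) := rfl
  rw [e, map_neg, map_neg] at h2
  linarith

lemma prog_small (q : E) {G : E → ℝ} (hG : Bdd G) {ε : ℝ} (hε : 0 < ε) :
    ∃ R, ∀ x, (Avg.prog q R).ap (fun x => G (x + q) - G x) x ≤ ε := by
  obtain ⟨D, hD⟩ := hG
  obtain ⟨R, hR⟩ := exists_nat_gt (2 * D / ε)
  refine ⟨R, fun x => ?_⟩
  refine (le_abs_self _).trans ((Avg.prog_tele (H := ℝ) (F := G) q R hD x).trans ?_)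
  have h1 : (0 : ℝ) < R + 1 := by positivity
  rw [div_le_iff₀ h1]
  rw [div_lt_iff₀ hε] at hR
  nlinarith

/-- The invariant mean on one copy of `E`. -/
theorem single_mean (Φ : E → ℝ) (hΦ : Bdd Φ) : ∃ m : Mean E,
    (∀ ε > 0, ∃ P : Avg E, ∀ u, P.ap Φ u ≤ m.m Φ + ε) ∧
    ∀ q G, Bdd G → m.m (fun x => G (x + q)) = m.m G := by
  obtain ⟨m, h1, h2⟩ := inv_mean (J := E) (fun _ => True) ⟨Avg.dirac 0, trivial⟩
    (fun _ _ _ _ => trivial) Φ hΦ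
  refine ⟨m, fun ε hε => ?_, fun q G hG => ?_⟩
  · obtain ⟨Q, -, h⟩ := h1 ε hε
    exact ⟨Q, h⟩
  · refine mean_inv_of _ m h2 q (fun G hG ε hε => ?_) G hG
    obtain ⟨R, hR⟩ := prog_small q hG hε
    exact ⟨_, trivial, hR⟩

theorem triple_mean (Φ : E × E × E → ℝ) (hΦ : Bdd Φ) : ∃ m : Mean (E × E × E),
    (∀ ε > 0, ∃ P P' : Avg E, ∀ u, P.ap (fun v => P'.ap (fun l => P'.ap
      (fun l' => Φ (v, l, l')) 0) 0) u ≤ m.m Φ + ε) ∧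
    (∀ q G, Bdd G → m.m (fun x => G (x + (q, 0, 0))) = m.m G) ∧
    (∀ q G, Bdd G → m.m (fun x => G (x + (0, q, 0))) = m.m G) := by
  let i1 : E →+ E × E × E := AddMonoidHom.inl E (E × E)
  let i2 : E →+ E × E × E := (AddMonoidHom.inr E (E × E)).comp (AddMonoidHom.inl E E)
  let i3 : E →+ E × E × E := (AddMonoidHom.inr E (E × E)).comp (AddMonoidHom.inr E E)
  let C : Avg (E × E × E) → Prop := fun Q => ∃ P P' : Avg E, ∀ F : E × E × E → ℝ,
    Q.ap F = (P.map i1).ap ((P'.map i2).ap ((P'.map i3).ap F))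
  obtain ⟨m, h1, h2⟩ := inv_mean C ⟨Avg.dirac 0, Avg.dirac 0, Avg.dirac 0, fun F => by
      rw [Avg.map_dirac_ap, Avg.map_dirac_ap, Avg.map_dirac_ap]
      funext u; rw [Avg.dirac_ap]; simp⟩ (by
    rintro Q1 Q2 ⟨A, A', hA⟩ ⟨B, B', hB⟩
    refine ⟨A.conv B, A'.conv B', fun F => ?_⟩
    rw [Avg.map_conv_ap, Avg.map_conv_ap, Avg.map_conv_ap, Avg.conv_ap', hB, hA]
    rw [Avg.ap_comm' (A'.map i3) (B.map i1), Avg.ap_comm' (A'.map i2) (B.map i1),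
      Avg.ap_comm' (A'.map i3) (B'.map i2)]) Φ hΦ
  refine ⟨m, fun ε hε => ?_, fun q G hG => ?_, fun q G hG => ?_⟩
  · obtain ⟨Q, ⟨P, P', hP⟩, h⟩ := h1 ε hε
    refine ⟨P, P', fun u => ?_⟩
    have := h (u, 0, 0)
    rw [hP] at this
    refine le_of_eq_of_le ?_ this
    have e1 : ∀ x, ((P'.map i3).ap Φ) x = P'.ap (fun l' => Φ (x.1, x.2.1, l')) x.2.2 := by
      intro x
      simp only [Avg.ap]
      congr 1
      refine Finset.sum_congr rfl fun i _ => ?_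
      show Φ (x + (0, 0, P'.p i)) = _
      congr 1
      ext <;> simp
    have e2 : ∀ x, ((P'.map i2).ap ((P'.map i3).ap Φ)) x = P'.ap (fun l => P'.ap
        (fun l' => Φ (x.1, l, l')) x.2.2) x.2.1 := by
      intro x
      rw [Avg.ap]
      conv_rhs => rw [Avg.ap]
      congr 1
      refine Finset.sum_congr rfl fun i _ => ?_
      show (P'.map i3).ap Φ (x + (0, P'.p i, 0)) = _
      rw [e1]
      simp
    rw [Avg.ap]
    conv_rhs => rw [Avg.ap]
    congr 1
    refine Finset.sum_congr rfl fun i _ => ?_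
    show _ = (P'.map i2).ap ((P'.map i3).ap Φ) ((u, 0, 0) + (P.p i, 0, 0))
    rw [e2]
    simp
  · refine mean_inv_of C m h2 _ (fun G hG ε hε => ?_) G hG
    obtain ⟨R, hR⟩ := prog_small (q, (0 : E), (0 : E)) hG hε
    refine ⟨_, ⟨Avg.prog q R, Avg.dirac 0, fun F => ?_⟩, hR⟩
    rw [Avg.map_dirac_ap, Avg.map_dirac_ap, Avg.map_prog_ap]
    rfl
  · refine mean_inv_of C m h2 _ (fun G hG ε hε => ?_) G hG
    obtain ⟨R, hR⟩ := prog_small ((0 : E), q, (0 : E)) hG hε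
    refine ⟨((Avg.prog q R).map i3).conv ((Avg.prog q R).map i2), ⟨Avg.dirac 0, Avg.prog q R,
      fun F => ?_⟩, fun x => ?_⟩
    · rw [Avg.map_dirac_ap, Avg.conv_ap', Avg.ap_comm']
    · rw [Avg.conv_ap, Avg.map_prog_ap i2]
      exact Avg.ap_le _ _ hR

end WE

namespace WE
universe u
variable {E : Type} [AddCommGroup E] [Module ℝ E] {Y : Type u}

lemma Sys.norm_ι_famm (s : Sys Y) {J : Type} (m : Mean J) (θ : J → ℝ) (a : s.A) :
    ‖(s.ext m).ι (s.famm m θ a)‖ = ‖s.ι a‖ := by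
  rw [← sq_eq_sq₀ (norm_nonneg _) (norm_nonneg _), Sys.norm_ι_sq, Sys.norm_ι_sq, s.ext_φ,
    ← map_mul]
  simp only [Sys.evm_famm, s.φ_inv, m.const]

lemma Sys.famF_cons (s : Sys Y) {J : Type} (m : Mean J) (p : (E →ₗ[ℝ] ℝ) × s.A)
    (L : List ((E →ₗ[ℝ] ℝ) × s.A)) (κ : J → E) (τ : J → ℝ) :
    s.famF m (p :: L) κ τ = s.famm m (fun j => p.1 (κ j) + τ j) p.2 * s.famF m L κ τ := by
  simp [Sys.famF]

lemma Sys.famF_bd (s : Sys Y) {J : Type} (m : Mean J) (L : List ((E →ₗ[ℝ] ℝ) × s.A)) (κ : J → E)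
    (τ : J → ℝ) {C : ℝ} (hC : ∀ u y, |(s.F L u).1 y| ≤ C) (z : J × Y) :
    |(s.famF m L κ τ).1 z| ≤ C := by
  have : (s.famF m L κ τ).1 z = (s.F L (κ z.1)).1 (s.S (τ z.1) z.2) := by
    have := congrFun (congrArg Subtype.val (s.evm_famF m L κ τ z.1)) z.2
    exact this
  rw [this]; exact hC _ _

/-- The identity behind the inverse theorem: the dual function is structured. -/
lemma gl_identity (s : Sys Y) (m : Mean (E × E × E))
    (hm1 : ∀ q G, Bdd G → m.m (fun x => G (x + (q, 0, 0))) = m.m G)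
    (hm2 : ∀ q G, Bdd G → m.m (fun x => G (x + (0, q, 0))) = m.m G)
    (π : E →ₗ[ℝ] E) (Ls rest : List ((E →ₗ[ℝ] ℝ) × s.A)) (l0 : E →ₗ[ℝ] ℝ) (a : s.A) (q : E)
    (θ θ' : E × E × E → E) (τ : E × E × E → ℝ)
    (hθ : ∀ j, θ j = j.1 + (j.2.1 - π j.2.1)) (hθ' : ∀ j, θ' j = j.1 + (j.2.2 - π j.2.2))
    (hτ : ∀ j, τ j = - l0 (θ j)) :
    s.M (s.F (Ls ++ rest) q) (s.V (l0 q) (s.Pi m ((s.ext m).ι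
      (s.famF m rest θ τ * s.famF m ((l0, a) :: rest) θ' τ)))) =
    s.Pi m ((s.ext m).ι ((s.ext m).F ((Ls.map (fun p => (p.1, s.pr m p.2)) ++
      ((l0, a) :: rest).map (fun p => (p.1 ∘ₗ π, s.famm m (fun j => p.1 (θ' j) + τ j) p.2))) ++
      rest.map (fun p => (p.1, s.pr m p.2 * s.famm m (fun j => p.1 (θ j) + τ j) p.2))) q)) := by
  rw [s.Pi_intertwine]
  apply s.ext_ι_eq
  intro b
  set y := ((l0, a) :: rest) with hy
  let G : E × E × E → ℝ := fun j => s.φ (s.F (Ls ++ rest) q *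
    s.act (l0 q) (s.act (τ j) (s.F rest (θ j)) * s.act (τ j) (s.F y (θ' j))) * b)
  have hGb : Bdd G := by
    obtain ⟨C, hC⟩ := s.evm_bdd m (s.pr m (s.F (Ls ++ rest) q) *
      (s.ext m).act (l0 q) (s.famF m rest θ τ * s.famF m y θ' τ) * s.pr m b)
    refine ⟨C, fun j => ?_⟩
    have := hC j
    simp only [map_mul, Sys.evm_pr, Sys.evm_act, Sys.evm_famF] at this
    simpa only [G, map_mul] using this
  have e1 : (fun j => s.φ (s.evm m j (s.pr m (s.F (Ls ++ rest) q) *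
      (s.ext m).act (l0 q) (s.famF m rest θ τ * s.famF m y θ' τ)) * b)) = G := by
    funext j
    simp only [map_mul, Sys.evm_pr, Sys.evm_act, Sys.evm_famF, G]
  rw [e1, ← hm1 (π q) G hGb, ← hm2 q (fun x => G (x + (π q, 0, 0)))
    (by obtain ⟨C, hC⟩ := hGb; exact ⟨C, fun j => hC _⟩)]
  congr 1
  funext j
  simp only [G]
  congr 2
  have t1 : θ (j + (0, q, 0) + (π q, 0, 0)) = θ j + q := by
    simp only [hθ, Prod.fst_add, Prod.snd_add, map_add]; simp; abel
  have t2 : θ' (j + (0, q, 0) + (π q, 0, 0)) = θ' j + π q := by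
    simp only [hθ', Prod.fst_add, Prod.snd_add, map_add]; simp; abel
  have t3 : τ (j + (0, q, 0) + (π q, 0, 0)) = τ j - l0 q := by
    rw [hτ, hτ, t1, map_add]; ring
  rw [t1, t2, t3]
  simp only [map_mul, Flow.act_act, add_sub_cancel, s.F_append, Sys.F_append]
  have f1 : s.evm m j ((s.ext m).F (Ls.map (fun p => (p.1, s.pr m p.2))) q) = s.F Ls q := by
    simp only [Sys.F, map_list_prod, List.map_map]
    congr 1
    refine List.map_congr_left fun p _ => ?_
    simp only [Function.comp, Sys.evm_act, Sys.evm_pr]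
  have f2 : s.evm m j ((s.ext m).F (y.map
      (fun p => (p.1 ∘ₗ π, s.famm m (fun j => p.1 (θ' j) + τ j) p.2))) q)
      = s.act (τ j) (s.F y (θ' j + π q)) := by
    simp only [Sys.F, map_list_prod, List.map_map]
    congr 1
    refine List.map_congr_left fun p _ => ?_
    simp only [Function.comp, Sys.evm_act, Sys.evm_famm, Flow.act_act, map_add,
      LinearMap.comp_apply]
    congr 2; ring
  have f3 : s.evm m j ((s.ext m).F (rest.map
      (fun p => (p.1, s.pr m p.2 * s.famm m (fun j => p.1 (θ j) + τ j) p.2))) q)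
      = s.F rest q * s.act (τ j) (s.F rest (θ j + q)) := by
    simp only [Sys.F, map_list_prod, List.map_map]
    rw [← List.prod_map_mul]
    congr 1
    refine List.map_congr_left fun p _ => ?_
    simp only [Function.comp, Sys.evm_act, Sys.evm_famm, Flow.act_act, map_add, map_mul,
      Sys.evm_pr]
    congr 3; ring
  rw [f1, f2, f3]
  ring

/-- The structured/orthogonal lemma. -/
theorem structLemma (G : GP.{u} E) (π : E →ₗ[ℝ] E) (hπ : ∀ u, π (π u) = π u) (s : Sys Y)
    (Ls : List ((E →ₗ[ℝ] ℝ) × s.A)) (hs : ∀ p ∈ Ls, p.1 ∘ₗ π = p.1)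
    (l0 : E →ₗ[ℝ] ℝ) (rest : List ((E →ₗ[ℝ] ℝ) × s.A))
    (IH : ∀ (Y' : Type u) (s' : Sys Y') (L1 L2 : List ((E →ₗ[ℝ] ℝ) × s'.A)),
      (∀ p ∈ L1, p.1 ∘ₗ π = p.1) → L2.map Prod.fst = rest.map Prod.fst →
      G.good (fun u => s'.ι (s'.F (L1 ++ L2) u)))
    (Z : ∀ F : E → s.H, (∀ ε > 0, ∃ a : s.A, ∃ P P' : Avg E,
      (∀ u, ‖F u - s.ι (s.F (Ls ++ (l0, a) :: rest) u)‖ ≤ ε) ∧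
      ∀ u, P.ap (fun v => ‖(P'.map (fun l => l - π l)).ap
        (fun v => s.ι (s.F ((l0, a) :: rest) v)) v‖ ^ 2) u ≤ ε) → G.good F) (a : s.A) :
    G.good (fun u => s.ι (s.F (Ls ++ (l0, a) :: rest) u)) := by
  obtain ⟨CD, hCD0, hCD⟩ := s.F_bdd (Ls ++ rest)
  obtain ⟨CR, hCR0, hCR⟩ := s.F_bdd rest
  let Fg : s.H → E → s.H := fun g u => s.M (s.F (Ls ++ rest) u) (s.V (l0 u) g)
  have Fι : ∀ a u, Fg (s.ι a) u = s.ι (s.F (Ls ++ (l0, a) :: rest) u) := by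
    intro a u
    simp only [Fg, s.V_ι, s.M_ι, s.F_append, s.F_cons]
    congr 1; ring
  have Fsub : ∀ g g' u, ‖Fg g u - Fg g' u‖ ≤ CD * ‖g - g'‖ := by
    intro g g' u
    simp only [Fg, ← map_sub]
    refine (s.norm_M_le hCD0 (hCD u) _).trans ?_
    rw [s.norm_V]
  let Zs : Submodule ℝ s.H :=
    { carrier := {g | G.good (Fg g)}
      add_mem' := by
        intro g g' h h'
        have := G.add _ _ h h'
        simpa only [Fg, Set.mem_ofPred_eq, map_add] using! this
      zero_mem' := by
        refine G.lim _ fun ε hε => ?_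
        obtain hz := IH Y s [(0, 0)] (rest) (by simp) rfl
        refine ⟨_, hz, fun u => ?_⟩
        simp [Fg, s.F_cons, hε.le]
      smul_mem' := by
        intro c g h
        have := G.smul c _ h
        simpa only [Fg, Set.mem_ofPred_eq, map_smul] using! this }
  have hmem : ∀ g, g ∈ Zs ↔ G.good (Fg g) := fun g => Iff.rfl
  have hcl : IsClosed (Zs : Set s.H) := by
    rw [← closure_subset_iff_isClosed]
    intro g hg
    refine G.lim _ fun ε hε => ?_
    obtain ⟨g', hg', hd⟩ := Metric.mem_closure_iff.1 hg (ε / (CD + 1)) (by positivity)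
    refine ⟨Fg g', hg', fun u => (Fsub g g' u).trans ?_⟩
    rw [dist_eq_norm] at hd
    rw [lt_div_iff₀ (by positivity)] at hd
    nlinarith [norm_nonneg (g - g')]
  suffices hperp : ∀ g ∈ Zsᗮ, g ∈ Zs by
    have : CompleteSpace Zs := hcl.completeSpace_coe
    have htop : Zs = ⊤ := by
      rw [← Submodule.orthogonal_eq_bot_iff, Submodule.eq_bot_iff]
      intro g hg
      have := (Submodule.mem_orthogonal _ _).1 hg g (hperp g hg)
      exact inner_self_eq_zero.1 this
    have : s.ι a ∈ Zs := by rw [htop]; trivial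
    rw [hmem, show Fg (s.ι a) = fun u => s.ι (s.F (Ls ++ (l0, a) :: rest) u) from
      funext (Fι a)] at this
    exact this
  intro g hg
  rw [hmem]
  refine Z _ fun ε hε => ?_
  -- choice of the approximation
  obtain ⟨ε1, hε1, h1a, h1b, h1c⟩ : ∃ ε1 > 0, ε1 ≤ 1 ∧ CD * ε1 ≤ ε ∧
      ε1 * (CR * (CR * (‖g‖ + 1))) ≤ ε / 2 := by
    refine ⟨min 1 (min (ε / (CD + 1)) (ε / 2 / (CR * (CR * (‖g‖ + 1)) + 1))), by positivity,
      min_le_left _ _, ?_, ?_⟩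
    · have : min 1 (min (ε / (CD + 1)) (ε / 2 / (CR * (CR * (‖g‖ + 1)) + 1))) ≤ ε / (CD + 1) :=
        (min_le_right _ _).trans (min_le_left _ _)
      rw [le_div_iff₀ (by positivity)] at this
      have h0 : 0 < min 1 (min (ε / (CD + 1)) (ε / 2 / (CR * (CR * (‖g‖ + 1)) + 1))) := by
        positivity
      nlinarith
    · have : min 1 (min (ε / (CD + 1)) (ε / 2 / (CR * (CR * (‖g‖ + 1)) + 1)))
          ≤ ε / 2 / (CR * (CR * (‖g‖ + 1)) + 1) :=
        (min_le_right _ _).trans (min_le_right _ _)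
      rw [le_div_iff₀ (by positivity)] at this
      have h0 : 0 < min 1 (min (ε / (CD + 1)) (ε / 2 / (CR * (CR * (‖g‖ + 1)) + 1))) := by
        positivity
      nlinarith
  obtain ⟨b, hb⟩ : ∃ b, ‖g - s.ι b‖ ≤ ε1 := by
    obtain ⟨b, hb⟩ := s.ι_dense.exists_dist_lt g hε1
    exact ⟨b, by rw [← dist_eq_norm]; exact hb.le⟩
  set y := ((l0, b) :: rest) with hy
  let θ : E × E × E → E := fun j => j.1 + (j.2.1 - π j.2.1)
  let θ' : E × E × E → E := fun j => j.1 + (j.2.2 - π j.2.2)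
  let τ : E × E × E → ℝ := fun j => - l0 (θ j)
  let Φ : E × E × E → ℝ := fun j => s.φ (s.F y (θ j) * s.F y (θ' j))
  obtain ⟨Cy, hCy0, hCy⟩ := s.F_norm_bdd y
  have hΦ : Bdd Φ := ⟨Cy * Cy, fun j => by
    simp only [Φ]
    rw [← s.inner_ι]
    exact (abs_real_inner_le_norm _ _).trans (mul_le_mul (hCy _) (hCy _) (norm_nonneg _) hCy0)⟩
  obtain ⟨m, hmP, hm1, hm2⟩ := triple_mean Φ hΦ
  set c := s.famF m rest θ τ * s.famF m y θ' τ with hc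
  set σ := s.Pi m ((s.ext m).ι c) with hσ
  have hσZ : σ ∈ Zs := by
    rw [hmem]
    have := G.clm (s.Pi m) _ (IH _ (s.ext m)
      (Ls.map (fun p => (p.1, s.pr m p.2)) ++
        y.map (fun p => (p.1 ∘ₗ π, s.famm m (fun j => p.1 (θ' j) + τ j) p.2)))
      (rest.map (fun p => (p.1, s.pr m p.2 * s.famm m (fun j => p.1 (θ j) + τ j) p.2)))
      (by
        intro p hp
        rcases List.mem_append.1 hp with hp | hp
        · obtain ⟨q, hq, rfl⟩ := List.mem_map.1 hp
          exact hs q hq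
        · obtain ⟨q, hq, rfl⟩ := List.mem_map.1 hp
          ext u
          simp [hπ])
      (by rw [List.map_map]; rfl))
    convert this using 1
    funext q
    exact gl_identity s m hm1 hm2 π Ls rest l0 b q θ θ' τ (fun _ => rfl) (fun _ => rfl)
      (fun _ => rfl)
  have hmΦ : m.m Φ = inner ℝ σ (s.ι b) := by
    rw [hσ, s.inner_Pi, Sys.inner_ι, s.ext_φ]
    congr 1
    funext j
    simp only [hc, map_mul, Sys.evm_famF, Sys.evm_pr, Φ]
    rw [← s.φ_inv (l0 (θ j)) (_ * b)]
    simp only [map_mul, Flow.act_act, τ, add_neg_cancel, Flow.act_zero]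
    congr 1
    rw [hy, s.F_cons]
    ring
  have hσn : ‖σ‖ ≤ CR * (CR * (‖g‖ + 1)) := by
    refine (s.norm_Pi_le m _).trans ?_
    rw [hc]
    refine ((s.ext m).norm_ι_mul_le hCR0 (s.famF_bd m rest θ τ hCR) _).trans ?_
    refine mul_le_mul_of_nonneg_left ?_ hCR0
    rw [hy, s.famF_cons, mul_comm]
    refine ((s.ext m).norm_ι_mul_le hCR0 (s.famF_bd m rest θ' τ hCR) _).trans ?_
    refine mul_le_mul_of_nonneg_left ?_ hCR0
    rw [s.norm_ι_famm]
    have : ‖s.ι b‖ ≤ ‖g‖ + ‖g - s.ι b‖ := by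
      have := norm_sub_le g (g - s.ι b)
      simpa using this
    linarith
  have hmle : m.m Φ ≤ ε / 2 := by
    have h0 : inner ℝ σ g = 0 := (Submodule.mem_orthogonal _ _).1 hg σ hσZ
    have h2 : m.m Φ = - inner ℝ σ (g - s.ι b) := by
      rw [inner_sub_right, h0, hmΦ]; ring
    rw [h2]
    refine (neg_le_abs _).trans ((abs_real_inner_le_norm _ _).trans ?_)
    calc ‖σ‖ * ‖g - s.ι b‖ ≤ CR * (CR * (‖g‖ + 1)) * ε1 :=
          mul_le_mul hσn hb (norm_nonneg _) (by positivity)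
      _ ≤ ε / 2 := by linarith
  obtain ⟨P, P', hPP⟩ := hmP (ε / 2) (by positivity)
  refine ⟨b, P, P', fun u => ?_, fun u => ?_⟩
  · rw [← Fι]
    exact (Fsub _ _ u).trans ((mul_le_mul_of_nonneg_left hb hCD0).trans h1b)
  · have := hPP u
    refine (le_of_eq ?_).trans (this.trans (by linarith))
    congr 1
    funext v
    simp only [Avg.ap]
    rw [← real_inner_self_eq_norm_sq, real_inner_smul_left, real_inner_smul_right, sum_inner]
    simp only [smul_eq_mul]
    refine congrArg₂ _ rfl ?_
    rw [Finset.mul_sum]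
    refine Finset.sum_congr rfl fun i _ => ?_
    rw [inner_sum]
    refine congrArg₂ _ rfl ?_
    refine Finset.sum_congr rfl fun i' _ => ?_
    rw [s.inner_ι]
    simp only [Φ, θ, θ', zero_add]
    rfl

end WE

namespace WE
universe u
set_option linter.unusedSectionVars false
variable {Y : Type u} {E : Type} [AddCommGroup E] [Module ℝ E]

/-- Averages become nearly constant. -/
def Osc {H : Type*} [NormedAddCommGroup H] [NormedSpace ℝ H] (F : E → H) : Prop :=
  ∀ ε > 0, ∃ P : Avg E, ∀ u u', ‖P.ap F u - P.ap F u'‖ ≤ ε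

section
variable {H : Type*} [NormedAddCommGroup H] [NormedSpace ℝ H]
variable {H' : Type*} [NormedAddCommGroup H'] [NormedSpace ℝ H']

lemma osc_ap (Q : Avg E) {F : E → H} {ε : ℝ} (h : ∀ u u', ‖F u - F u'‖ ≤ ε) (u u' : E) :
    ‖Q.ap F u - Q.ap F u'‖ ≤ ε := by
  have e : Q.ap F u - Q.ap F u' = Q.ap (fun v => F (v + u) - F (v + u')) 0 := by
    simp only [Avg.ap, ← smul_sub, ← Finset.sum_sub_distrib, zero_add]
    simp only [add_comm]
  rw [e]
  exact Q.norm_ap_le 0 fun v => h _ _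

lemma Osc.add {F G : E → H} (hF : Osc F) (hG : Osc G) : Osc (fun u => F u + G u) := by
  intro ε hε
  obtain ⟨P, hP⟩ := hF (ε / 2) (by positivity)
  obtain ⟨Q, hQ⟩ := hG (ε / 2) (by positivity)
  refine ⟨P.conv Q, fun u u' => ?_⟩
  have h1 := osc_ap Q hP u u'
  have h2 := osc_ap P hQ u u'
  simp only [Avg.ap_add, Avg.conv_ap]
  rw [P.ap_comm Q F, P.ap_comm Q F]
  refine (le_of_eq ?_).trans ((norm_add_le _ _).trans ((add_le_add h1 h2).trans (by linarith)))
  congr 1; abel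

lemma Osc.smul {F : E → H} (c : ℝ) (hF : Osc F) : Osc (fun u => c • F u) := by
  intro ε hε
  obtain ⟨P, hP⟩ := hF (ε / (|c| + 1)) (by positivity)
  refine ⟨P, fun u u' => ?_⟩
  rw [Avg.ap_smul, Avg.ap_smul, ← smul_sub, norm_smul, Real.norm_eq_abs]
  have := hP u u'
  rw [le_div_iff₀ (by positivity)] at this
  nlinarith [norm_nonneg (P.ap F u - P.ap F u')]

lemma Osc.lim {F : E → H} (h : ∀ ε > 0, ∃ G, Osc G ∧ ∀ u, ‖F u - G u‖ ≤ ε) : Osc F := by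
  intro ε hε
  obtain ⟨G, hG, hFG⟩ := h (ε / 3) (by positivity)
  obtain ⟨P, hP⟩ := hG (ε / 3) (by positivity)
  refine ⟨P, fun u u' => ?_⟩
  have h1 : ∀ u, ‖P.ap F u - P.ap G u‖ ≤ ε / 3 := fun u => by
    rw [← P.ap_sub]
    exact P.norm_ap_le u hFG
  have e : P.ap F u - P.ap F u' = (P.ap F u - P.ap G u) + (P.ap G u - P.ap G u')
      - (P.ap F u' - P.ap G u') := by abel
  rw [e]
  refine (norm_sub_le _ _).trans ?_
  have := norm_add_le (P.ap F u - P.ap G u) (P.ap G u - P.ap G u')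
  linarith [h1 u, h1 u', hP u u']

lemma Osc.clm {F : E → H} (A : H →L[ℝ] H') (hF : Osc F) : Osc (fun u => A (F u)) := by
  intro ε hε
  obtain ⟨P, hP⟩ := hF (ε / (‖A‖ + 1)) (by positivity)
  refine ⟨P, fun u u' => ?_⟩
  rw [Avg.ap_clm, Avg.ap_clm, ← map_sub]
  refine (A.le_opNorm _).trans ?_
  have := hP u u'
  rw [le_div_iff₀ (by positivity)] at this
  nlinarith [norm_nonneg (P.ap F u - P.ap F u')]

lemma Osc.const (c : H) : Osc (fun _ : E => c) := fun ε hε =>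
  ⟨Avg.dirac 0, fun u u' => by simp [Avg.ap_const, hε.le]⟩

lemma Osc.sum {ι : Type*} (s : Finset ι) {F : ι → E → H} (h : ∀ i ∈ s, Osc (F i)) :
    Osc (fun u => ∑ i ∈ s, F i u) := by
  classical
  induction s using Finset.induction_on with
  | empty => simpa using Osc.const (0 : H)
  | insert i s hi ih =>
    simp only [Finset.sum_insert hi]
    exact (h i (by simp)).add (ih fun j hj => h j (by simp [hj]))

end

/-- Step 1 class. -/
def oscGP : GP.{u} E where
  good F := Osc F
  add _ _ h h' := h.add h'
  smul c _ h := h.smul c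
  lim _ h := Osc.lim h
  clm A _ h := h.clm A

theorem step1_aux (fs : List (E →ₗ[ℝ] ℝ)) : ∀ (Y : Type u) (s : Sys Y)
    (L1 L2 : List ((E →ₗ[ℝ] ℝ) × s.A)), (∀ p ∈ L1, p.1 ∘ₗ (0 : E →ₗ[ℝ] E) = p.1) →
    L2.map Prod.fst = fs → Osc (fun u => s.ι (s.F (L1 ++ L2) u)) := by
  have hc : ∀ (Y : Type u) (s : Sys Y) (L1 : List ((E →ₗ[ℝ] ℝ) × s.A)),
    (∀ p ∈ L1, p.1 ∘ₗ (0 : E →ₗ[ℝ] E) = p.1) → ∀ u, s.F L1 u = s.F L1 0 := by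
    intro Y s L1 h u
    simp only [Sys.F]
    congr 1
    refine List.map_congr_left fun p hp => ?_
    rw [← h p hp]; simp
  induction fs with
  | nil =>
    intro Y s L1 L2 h1 h2
    have : L2 = [] := by simpa using h2
    subst this
    rw [List.append_nil]
    have e : (fun u => s.ι (s.F L1 u)) = fun _ => s.ι (s.F L1 0) := by
      funext u; rw [hc Y s L1 h1]
    rw [e]
    exact Osc.const _
  | cons l0 fs ih =>
    intro Y s L1 L2 h1 h2
    match L2, h2 with
    | [], h2 => simp at h2
    | (l, a) :: rest, h2 =>
      simp only [List.map_cons, List.cons.injEq] at h2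
      obtain ⟨rfl, h3⟩ := h2
      refine structLemma oscGP 0 (by simp) s L1 h1 l rest
        (fun Y' s' M1 M2 hM1 hM2 => ih Y' s' M1 M2 hM1 (hM2.trans h3)) ?_ a
      intro F hF
      show Osc F
      obtain ⟨C, hC0, hC⟩ := s.F_bdd L1
      intro ε hε
      set η := ε / 4 / (C + 1) with hη
      have hη0 : 0 < η := by positivity
      have hη1 : C * η ≤ ε / 4 := by
        rw [hη, mul_div_assoc', div_le_iff₀ (by positivity)]; nlinarith
      obtain ⟨a, P, P', hFa, hPP⟩ := hF (min (ε / 4) (η ^ 2)) (by positivity)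
      refine ⟨P.conv P', fun u u' => ?_⟩
      have key : ∀ u, ‖(P.conv P').ap F u‖ ≤ ε / 2 := by
        intro u
        set G := fun u => s.ι (s.F ((l, a) :: rest) u) with hG
        have e1 : ∀ u, s.ι (s.F (L1 ++ (l, a) :: rest) u) = s.M (s.F L1 0) (G u) := by
          intro u
          rw [hG, s.F_append, hc Y s L1 h1 u, s.M_ι]
        have e2 : (P.conv P').ap F u = (P.conv P').ap (fun u => F u -
            s.ι (s.F (L1 ++ (l, a) :: rest) u)) u + s.M (s.F L1 0) ((P.conv P').ap G u) := by
          rw [Avg.ap_sub, ← Avg.ap_clm]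
          simp only [e1]; abel
        have b1 : ‖(P.conv P').ap (fun u => F u - s.ι (s.F (L1 ++ (l, a) :: rest) u)) u‖
            ≤ ε / 4 := Avg.norm_ap_le _ u fun u => (hFa u).trans (min_le_left _ _)
        have b2 : ‖(P.conv P').ap G u‖ ≤ η := by
          refine le_of_sq_le_sq ?_ hη0.le
          rw [Avg.conv_ap]
          refine (Avg.norm_ap_sq_le _ _ _).trans ?_
          have := (hPP u).trans (min_le_right _ _)
          have e3 : P'.map (fun l => l - (0 : E →ₗ[ℝ] E) l) = P' := by
            cases P'; simp [Avg.map]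
          rw [e3] at this
          exact this
        rw [e2]
        have b3 := s.norm_M_le hC0 (hC 0) ((P.conv P').ap G u)
        have := norm_add_le ((P.conv P').ap (fun u => F u -
            s.ι (s.F (L1 ++ (l, a) :: rest) u)) u) (s.M (s.F L1 0) ((P.conv P').ap G u))
        nlinarith
      have := norm_sub_le ((P.conv P').ap F u) ((P.conv P').ap F u')
      linarith [key u, key u']

theorem step1 (s : Sys Y) (L : List ((E →ₗ[ℝ] ℝ) × s.A)) : Osc (fun u => s.ι (s.F L u)) := by
  simpa using step1_aux (L.map Prod.fst) Y s [] L (by simp) rfl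

theorem step1_scalar (s : Sys Y) (L : List ((E →ₗ[ℝ] ℝ) × s.A)) :
    Osc (fun u => s.φ (s.F L u)) := by
  have := (step1 s L).clm (innerSL ℝ (s.ι 1))
  simpa [Sys.inner_ι] using this

lemma Avg.mean_ap (P : Avg E) (m : Mean E)
    (hm : ∀ q G, Bdd G → m.m (fun x => G (x + q)) = m.m G) (G : E → ℝ) (hG : Bdd G) :
    m.m (P.ap G) = m.m G := by
  have e : P.ap G = (Fintype.card P.I : ℝ)⁻¹ • ∑ i, fun u => G (u + P.p i) := by
    funext u; simp [Avg.ap]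
  rw [e, map_smul, map_sum]
  simp only [hm _ G hG, Finset.sum_const, Finset.card_univ]
  rw [← Nat.cast_smul_eq_nsmul ℝ, smul_smul, inv_mul_cancel₀ P.card_pos.ne', one_smul]

lemma Osc.le_mean {G : E → ℝ} (h : Osc G) (hG : Bdd G) (m : Mean E)
    (hm : ∀ q G, Bdd G → m.m (fun x => G (x + q)) = m.m G) {ε : ℝ} (hε : 0 < ε) :
    ∃ P : Avg E, ∀ u, P.ap G u ≤ m.m G + ε := by
  obtain ⟨P, hP⟩ := h ε hε
  refine ⟨P, fun u => ?_⟩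
  rw [← P.mean_ap m hm G hG]
  obtain ⟨C, hC⟩ := hG
  have h1 := m.mono (g := fun _ => P.ap G u - ε) (h := P.ap G) ⟨|P.ap G u - ε|, fun _ => le_rfl⟩
    ⟨C, fun u => P.norm_ap_le (F := G) u hC⟩ (fun u' => by
      have := (abs_le.1 (hP u u')).2; linarith)
  rw [m.const] at h1
  linarith

end WE

namespace WE
universe u
set_option linter.unusedSectionVars false

section hilbert
variable {E : Type} [AddCommGroup E] [Module ℝ E]
variable {H : Type*} [NormedAddCommGroup H] [InnerProductSpace ℝ H] [CompleteSpace H]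

lemma unip_pow (N : Module.End ℝ E) (r : ℕ) (x : E) :
    ∃ z, ((1 + N) ^ r) x = x + (r : ℝ) • N x + N (N z) := by
  induction r with
  | zero => exact ⟨0, by simp⟩
  | succ r ih =>
    obtain ⟨z, hz⟩ := ih
    refine ⟨(r : ℝ) • x + z + N z, ?_⟩
    rw [pow_succ', Module.End.mul_apply, hz]
    simp only [LinearMap.add_apply, Module.End.one_apply, map_add, map_smul, Nat.cast_succ, add_smul,
      one_smul, smul_add]
    abel

theorem mautner (N : Module.End ℝ E) (hN : IsNilpotent N) (τ : H →L[ℝ] H) (hτ : ∀ x, ‖τ x‖ = ‖x‖)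
    (σ : E → H →L[ℝ] H) (hσ : ∀ q x, ‖σ q x‖ = ‖x‖) (hσa : ∀ p q x, σ (p + q) x = σ p (σ q x))
    (hστ : ∀ q x, σ q (τ x) = τ (σ ((1 + N) q) x)) (y : H)
    (hy : ∀ q, Tendsto (fun n : ℕ => σ (((n : ℝ) + 1)⁻¹ • q) y) atTop (nhds y)) (x0 : E) :
    Tendsto (fun R => birkhoffAverage ℝ τ _root_.id R (σ (N x0) y - y)) atTop (nhds 0) := by
  have hτ1 : ‖τ‖ ≤ 1 := ContinuousLinearMap.opNorm_le_bound _ zero_le_one (fun x => by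
    rw [hτ, one_mul])
  set t := N x0 with ht
  have hlim := τ.tendsto_birkhoffAverage_orthogonalProjection hτ1 (σ t y - y)
  set w : H := ((τ.eqLocus (1 : H →L[ℝ] H)).orthogonalProjectionOnto (σ t y - y) : H) with hw
  have hwfix : τ w = w := by
    have := ((τ.eqLocus (1 : H →L[ℝ] H)).orthogonalProjectionOnto (σ t y - y)).2
    exact this
  -- zero
  have h0 : ∀ x, σ 0 x = x := by
    intro x
    have h1 := hσa 0 0 x
    rw [add_zero] at h1
    have h2 : ‖σ 0 x - x‖ = 0 := by
      rw [← hσ 0, map_sub, ← h1]; simp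
    exact sub_eq_zero.1 (norm_eq_zero.1 h2)
  -- continuity vectors
  let Cn : Set H := {x | ∀ q, Tendsto (fun n : ℕ => σ (((n : ℝ) + 1)⁻¹ • q) x) atTop (nhds x)}
  have Cadd : ∀ x ∈ Cn, ∀ x' ∈ Cn, x + x' ∈ Cn := by
    intro x hx x' hx' q
    simpa only [map_add] using (hx q).add (hx' q)
  have Csmul : ∀ c : ℝ, ∀ x ∈ Cn, c • x ∈ Cn := by
    intro c x hx q
    simpa only [map_smul] using (hx q).const_smul c
  have Cτ : ∀ x ∈ Cn, τ x ∈ Cn := by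
    intro x hx q
    simp only [hστ, map_smul]
    exact (τ.continuous.tendsto x).comp (hx _)
  have Cσ : ∀ p, ∀ x ∈ Cn, σ p x ∈ Cn := by
    intro p x hx q
    have : ∀ n : ℕ, σ (((n : ℝ) + 1)⁻¹ • q) (σ p x) = σ p (σ (((n : ℝ) + 1)⁻¹ • q) x) := by
      intro n
      rw [← hσa, ← hσa, add_comm]
    simp only [this]
    exact ((σ p).continuous.tendsto x).comp (hx _)
  have Ccl : IsClosed Cn := by
    rw [← closure_subset_iff_isClosed]
    intro x hx q
    rw [Metric.tendsto_atTop]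
    intro ε hε
    obtain ⟨x', hx', hd⟩ := Metric.mem_closure_iff.1 hx (ε / 3) (by positivity)
    obtain ⟨n0, hn0⟩ := Metric.tendsto_atTop.1 (hx' q) (ε / 3) (by positivity)
    refine ⟨n0, fun n hn => ?_⟩
    have h1 : dist (σ (((n : ℝ) + 1)⁻¹ • q) x) (σ (((n : ℝ) + 1)⁻¹ • q) x') < ε / 3 := by
      rw [dist_eq_norm, ← map_sub, hσ, ← dist_eq_norm]; exact hd
    have h2 := hn0 n hn
    rw [dist_comm] at hd
    have := dist_triangle4 (σ (((n : ℝ) + 1)⁻¹ • q) x) (σ (((n : ℝ) + 1)⁻¹ • q) x') x' x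
    linarith
  have hx0 : σ t y - y ∈ Cn := by
    rw [sub_eq_add_neg, ← neg_one_smul ℝ y]
    exact Cadd _ (Cσ _ _ hy) _ (Csmul _ _ hy)
  have hiter : ∀ n : ℕ, τ^[n] (σ t y - y) ∈ Cn := by
    intro n
    induction n with
    | zero => exact hx0
    | succ n ih => rw [Function.iterate_succ_apply']; exact Cτ _ ih
  have hwC : w ∈ Cn := by
    refine Ccl.mem_of_tendsto hlim (Eventually.of_forall fun n => ?_)
    simp only [birkhoffAverage, birkhoffSum]
    refine Csmul _ _ ?_
    refine Finset.sum_induction _ (· ∈ Cn) (fun a b ha hb => Cadd a ha b hb) ?_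
      (fun i _ => hiter i)
    intro q
    simp
  -- invariance
  have hU : ∀ r : ℕ, ∀ q, ‖σ (((1 + N) ^ r) q) w - w‖ = ‖σ q w - w‖ := by
    intro r
    induction r with
    | zero => intro q; simp
    | succ r ih =>
      intro q
      rw [pow_succ, Module.End.mul_apply, ih, ← hτ, map_sub, ← hστ, hwfix]
  have hNk : ∀ j k : ℕ, 1 ≤ k → (∀ v, (N ^ (k + j)) v = 0) → ∀ v, σ ((N ^ k) v) w = w := by
    intro j
    induction j with
    | zero =>
      intro k hk h v
      rw [add_zero] at h
      rw [h, h0]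
    | succ j ih =>
      intro k hk h v
      have ih' := ih (k + 1) (by omega) (by
        intro v; rw [show k + 1 + j = k + (j + 1) by ring]; exact h v)
      set x := (N ^ (k - 1)) v with hx
      have e1 : (N ^ k) v = N x := by
        rw [hx, ← Module.End.mul_apply, ← pow_succ', Nat.sub_add_cancel hk]
      rw [e1]
      have hcomm : ∀ r : ℕ, ∀ v, ((1 + N) ^ r) ((N ^ (k - 1)) v) = (N ^ (k - 1)) (((1 + N) ^ r) v) := by
        intro r v
        have : Commute ((1 + N) ^ r) (N ^ (k - 1)) :=
          (((Commute.one_left N).add_left (Commute.refl N)).pow_pow _ _)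
        rw [← Module.End.mul_apply, this.eq, Module.End.mul_apply]
      have e2 : ∀ n : ℕ, ‖σ (N x + ((n : ℝ) + 1)⁻¹ • x) w - w‖
          = ‖σ (((n : ℝ) + 1)⁻¹ • x) w - w‖ := by
        intro n
        rw [← hU (n + 1) (((n : ℝ) + 1)⁻¹ • x)]
        obtain ⟨z, hz⟩ := unip_pow N (n + 1) v
        have hn : ((n : ℝ) + 1)⁻¹ * ((n : ℝ) + 1) = 1 := inv_mul_cancel₀ (by positivity)
        have e3 : ((1 + N) ^ (n + 1)) (((n : ℝ) + 1)⁻¹ • x)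
            = (N x + ((n : ℝ) + 1)⁻¹ • x) + (N ^ (k + 1)) (((n : ℝ) + 1)⁻¹ • z) := by
          rw [map_smul, hx, hcomm, hz]
          have e4 : (N ^ (k + 1)) z = (N ^ (k - 1)) (N (N z)) := by
            rw [← Module.End.mul_apply, ← Module.End.mul_apply, ← pow_succ, ← pow_succ]
            congr 2; omega
          have e5 : N ((N ^ (k - 1)) v) = (N ^ (k - 1)) (N v) := by
            rw [← Module.End.mul_apply, ← Module.End.mul_apply, ← pow_succ, ← pow_succ']
          rw [map_smul (N ^ (k + 1)), e4, e5]
          simp only [map_add, map_smul, smul_add, smul_smul]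
          push_cast
          rw [hn, one_smul]; abel
        rw [e3, hσa _ ((N ^ (k + 1)) _), ih']
      have l1 : Tendsto (fun n : ℕ => ‖σ (N x + ((n : ℝ) + 1)⁻¹ • x) w - w‖) atTop
          (nhds ‖σ (N x) w - w‖) := by
        simp only [hσa]
        exact (((((σ (N x)).continuous.tendsto w).comp (hwC x)).sub_const w).norm)
      have l2 : Tendsto (fun n : ℕ => ‖σ (((n : ℝ) + 1)⁻¹ • x) w - w‖) atTop (nhds 0) := by
        simpa using ((hwC x).sub_const w).norm
      simp only [e2] at l1
      have := tendsto_nhds_unique l1 l2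
      exact sub_eq_zero.1 (norm_eq_zero.1 this)
  obtain ⟨d, hd⟩ := hN
  have htw : σ t w = w := by
    have := hNk d 1 le_rfl (by intro v; rw [pow_add, hd, mul_zero]; rfl) x0
    rwa [pow_one] at this
  have hww : inner ℝ w w = 0 := by
    have h1 : inner ℝ w (σ t y - y) = inner ℝ w w := by
      have h2 : inner ℝ ((σ t y - y) - w) w = 0 :=
        (τ.eqLocus (1 : H →L[ℝ] H)).starProjection_inner_eq_zero (σ t y - y) w (by exact hwfix)
      rw [inner_sub_left, sub_eq_zero] at h2
      rw [real_inner_comm, h2]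
    have h3 : inner ℝ w (σ t y) = inner ℝ w y := by
      let S : H →ₗᵢ[ℝ] H := ⟨(σ t : H →ₗ[ℝ] H), hσ t⟩
      have := S.inner_map_map w y
      have e : S w = w := htw
      rw [e] at this
      exact this
    rw [← h1, inner_sub_right, h3, sub_self]
  have hw0 : w = 0 := inner_self_eq_zero.1 hww
  rw [hw0] at hlim
  exact hlim

end hilbert
end WE

namespace WE
universe u
set_option linter.unusedSectionVars false
variable {Y : Type u} {E : Type} [AddCommGroup E] [Module ℝ E]

/-- A mean invariant under translations and a given automorphism. -/
theorem exists_UMean (U : E ≃ₗ[ℝ] E) : ∃ m : Mean E,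
    (∀ q G, Bdd G → m.m (fun x => G (x + q)) = m.m G) ∧
    (∀ G, Bdd G → m.m (fun x => G (U x)) = m.m G) := by
  obtain ⟨m, -, hm⟩ := single_mean (E := E) (fun _ => 0) ⟨0, fun _ => by simp⟩
  obtain ⟨ν, -, hν⟩ := single_mean (E := ℤ) (fun _ => 0) ⟨0, fun _ => by simp⟩
  have hb : ∀ G : E → ℝ, (∃ C, ∀ j, |G j| ≤ C) → ∃ C, ∀ r : ℤ, |m.m (fun x => G ((U ^ r) x))| ≤ C := by
    rintro G ⟨C, hC⟩
    refine ⟨C, fun r => abs_le.2 ⟨?_, ?_⟩⟩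
    · rw [← m.const (-C)]
      exact m.mono ⟨|C|, fun _ => by simp⟩ ⟨C, fun x => hC _⟩ fun x => (abs_le.1 (hC _)).1
    · rw [← m.const C]
      exact m.mono ⟨C, fun x => hC _⟩ ⟨|C|, fun _ => by simp⟩ fun x => (abs_le.1 (hC _)).2
  let M : (E → ℝ) →ₗ[ℝ] ℝ := ν.m ∘ₗ LinearMap.pi (fun r : ℤ => m.m ∘ₗ
    LinearMap.funLeft ℝ ℝ (fun x => (U ^ r) x))
  have hM : ∀ G, M G = ν.m (fun r => m.m (fun x => G ((U ^ r) x))) := fun G => rfl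
  refine ⟨⟨M, ?_, ?_⟩, ?_, ?_⟩
  · rw [hM]; simp only [m.const, ν.const]
  · intro G hG h0
    rw [hM]
    refine ν.nonneg _ (hb G hG) fun r => m.nonneg _ ?_ fun x => h0 _
    obtain ⟨C, hC⟩ := hG
    exact ⟨C, fun x => hC _⟩
  · intro q G hG
    show M _ = M _
    rw [hM, hM]
    congr 1
    funext r
    have := hm ((U ^ r).symm q) (fun x => G ((U ^ r) x)) (by
      obtain ⟨C, hC⟩ := hG
      exact ⟨C, fun x => hC _⟩)
    simpa using this
  · intro G hG
    show M _ = M _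
    rw [hM, hM]
    have := hν 1 (fun r => m.m (fun x => G ((U ^ r) x))) (hb G hG)
    rw [← this]
    congr 1
    funext r
    congr 1
    funext x
    rw [add_comm, zpow_add, zpow_one]
    rfl

/-- Substitution in the base of an extension. -/
def Sys.sub (s : Sys Y) {J : Type} (m : Mean J) (g : J → J) : (s.ext m).A →ₐ[ℝ] (s.ext m).A :=
  (s.toFlow.prod J).pull (s.toFlow.prod J) (fun p => (g p.1, p.2)) (fun _ _ => rfl)

@[simp] lemma Sys.evm_sub (s : Sys Y) {J : Type} (m : Mean J) (g : J → J) (j : J)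
    (a : (s.ext m).A) : s.evm m j (s.sub m g a) = s.evm m (g j) a := rfl

/-- Composition of the forms in a list with a linear map. -/
def Sys.co (s : Sys Y) (A : E →ₗ[ℝ] E) (L : List ((E →ₗ[ℝ] ℝ) × s.A)) :
    List ((E →ₗ[ℝ] ℝ) × s.A) := L.map fun p => (p.1 ∘ₗ A, p.2)

lemma Sys.F_co (s : Sys Y) (A : E →ₗ[ℝ] E) (L : List ((E →ₗ[ℝ] ℝ) × s.A)) (u : E) :
    s.F (s.co A L) u = s.F L (A u) := by
  simp only [Sys.F, Sys.co, List.map_map]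
  rfl

/-- The Mautner square function. -/
noncomputable def Sys.D (s : Sys Y) (U : E →ₗ[ℝ] E) (L : List ((E →ₗ[ℝ] ℝ) × s.A)) (t : E) (R : ℕ)
    (u : E) : ℝ :=
  ‖(R : ℝ)⁻¹ • ∑ r ∈ range R, (s.ι (s.F L ((U ^ r) u + t)) - s.ι (s.F L ((U ^ r) u)))‖ ^ 2

lemma normsq_comb (s : Sys Y) {κ : Type*} (I : Finset κ) (c : κ → ℝ) (a : κ → s.A) :
    ‖∑ i ∈ I, c i • s.ι (a i)‖ ^ 2 = ∑ i ∈ I, ∑ j ∈ I, (c i * c j) • s.φ (a i * a j) := by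
  rw [← real_inner_self_eq_norm_sq, sum_inner]
  refine Finset.sum_congr rfl fun i _ => ?_
  rw [inner_sum]
  refine Finset.sum_congr rfl fun j _ => ?_
  rw [real_inner_smul_left, real_inner_smul_right, s.inner_ι, smul_eq_mul]; ring

/-- Expansion of `D` into correlation functions. -/
lemma Sys.D_expand (s : Sys Y) (U : E →ₗ[ℝ] E) (L : List ((E →ₗ[ℝ] ℝ) × s.A)) (t : E) (R : ℕ) :
    s.D U L t R = fun u => ∑ i ∈ range R ×ˢ (univ : Finset Bool), ∑ j ∈ range R ×ˢ (univ : Finset Bool),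
      (((R : ℝ)⁻¹ * if i.2 then 1 else -1) * ((R : ℝ)⁻¹ * if j.2 then 1 else -1)) •
      s.φ (s.F (s.co (U ^ i.1) (if i.2 then s.tr t L else L) ++
        s.co (U ^ j.1) (if j.2 then s.tr t L else L)) u) := by
  funext u
  simp only [s.F_append]
  refine Eq.trans ?_ (normsq_comb s (range R ×ˢ (univ : Finset Bool))
    (fun i => (R : ℝ)⁻¹ * if i.2 then 1 else -1)
    (fun i => s.F (s.co (U ^ i.1) (if i.2 then s.tr t L else L)) u))
  rw [Sys.D, Finset.sum_product, Finset.smul_sum]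
  congr 2
  refine Finset.sum_congr rfl fun r _ => ?_
  rw [Fintype.sum_bool]
  simp only [s.F_co, if_true, s.F_tr, Bool.false_eq_true, if_false, mul_one, mul_neg, neg_smul,
    smul_add, smul_neg, sub_eq_add_neg]

lemma Sys.φ_F_bdd (s : Sys Y) (L : List ((E →ₗ[ℝ] ℝ) × s.A)) : Bdd (fun u => s.φ (s.F L u)) := by
  obtain ⟨C, hC0, hC⟩ := s.F_norm_bdd L
  refine ⟨‖s.ι 1‖ * C, fun u => ?_⟩
  have : s.φ (s.F L u) = inner ℝ (s.ι 1) (s.ι (s.F L u)) := by rw [s.inner_ι, one_mul]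
  simp only [this]
  exact (abs_real_inner_le_norm _ _).trans (by gcongr; exact hC u)

lemma Sys.D_bdd (s : Sys Y) (U : E →ₗ[ℝ] E) (L : List ((E →ₗ[ℝ] ℝ) × s.A)) (t : E) (R : ℕ) :
    Bdd (s.D U L t R) := by
  rw [s.D_expand]
  have hs : ∀ {κ : Type} (I : Finset κ) (f : κ → E → ℝ), (∀ i, Bdd (f i)) →
      Bdd (fun u => ∑ i ∈ I, f i u) := by
    intro κ I f h
    choose C hC using h
    exact ⟨∑ i ∈ I, C i, fun u => (Finset.abs_sum_le_sum_abs _ _).trans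
      (Finset.sum_le_sum fun i _ => hC i u)⟩
  exact hs _ _ fun i => hs _ _ fun j => Bdd.smul (s.φ_F_bdd _) _

lemma Sys.D_osc (s : Sys Y) (U : E →ₗ[ℝ] E) (L : List ((E →ₗ[ℝ] ℝ) × s.A)) (t : E) (R : ℕ) :
    Osc (s.D U L t R) := by
  rw [s.D_expand]
  exact Osc.sum _ fun i _ => Osc.sum _ fun j _ => (step1_scalar s _).smul _

theorem claimIII (N : Module.End ℝ E) (hN : IsNilpotent N) (s : Sys Y)
    (L : List ((E →ₗ[ℝ] ℝ) × s.A)) (x0 : E) {ε : ℝ} (hε : 0 < ε) :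
    ∃ R0, ∀ R ≥ R0, ∃ P : Avg E, ∀ u, P.ap (s.D (1 + N) L (N x0) R) u ≤ ε := by
  have hunit : IsUnit (1 + N) := hN.isUnit_one_add
  let U : E ≃ₗ[ℝ] E := LinearEquiv.ofBijective (1 + N) ((Module.End.isUnit_iff _).1 hunit)
  obtain ⟨m, hm1, hm2⟩ := exists_UMean U
  set t := N x0 with ht
  let S := s.ext m
  let τ := s.sub m (fun v => (1 + N) v)
  let σ : E → S.A →ₐ[ℝ] S.A := fun q => s.sub m (fun v => v + q)
  have hτφ : ∀ a, S.φ (τ a) = S.φ a := fun a => by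
    show (s.ext m).φ _ = (s.ext m).φ _
    rw [s.ext_φ, s.ext_φ]
    exact hm2 (fun v => s.φ (s.evm m v a)) (s.evm_bdd m a)
  have hσφ : ∀ q a, S.φ (σ q a) = S.φ a := fun q a => by
    show (s.ext m).φ _ = (s.ext m).φ _
    rw [s.ext_φ, s.ext_φ]
    exact hm1 q (fun v => s.φ (s.evm m v a)) (s.evm_bdd m a)
  let yt : S.A := s.famF m L id (fun _ => 0)
  have hyt : ∀ v, s.evm m v yt = s.F L v := by
    intro v
    show s.evm m v (s.famF m L id (fun _ => 0)) = _
    rw [s.evm_famF, Flow.act_zero]; rfl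
  have key := mautner N hN (S.koop S τ) (S.norm_koop S hτφ) (fun q => S.koop S (σ q))
    (fun q => S.norm_koop S (hσφ q)) (by
      intro p q x
      refine S.ι_dense.induction_on
        (p := fun x => S.koop S (σ (p + q)) x = S.koop S (σ p) (S.koop S (σ q) x)) x
        (isClosed_eq (by fun_prop) (by fun_prop)) (fun a => ?_)
      rw [S.koop_ι S (hσφ _), S.koop_ι S (hσφ _), S.koop_ι S (hσφ _)]
      congr 1
      refine s.evm_ext m fun j => ?_
      show s.evm m (j + (p + q)) a = s.evm m (j + p + q) a
      rw [add_assoc]) (by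
      intro q x
      refine S.ι_dense.induction_on
        (p := fun x => S.koop S (σ q) (S.koop S τ x)
          = S.koop S τ (S.koop S (σ ((1 + N) q)) x)) x
        (isClosed_eq (by fun_prop) (by fun_prop)) (fun a => ?_)
      rw [S.koop_ι S hτφ, S.koop_ι S (hσφ _), S.koop_ι S (hσφ _), S.koop_ι S hτφ]
      congr 1
      refine s.evm_ext m fun j => ?_
      show s.evm m ((1 + N) (j + q)) a = s.evm m ((1 + N) j + (1 + N) q) a
      rw [map_add]) (S.ι yt) (by
      intro q
      obtain ⟨K, hK0, hK⟩ := s.F_lip' L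
      rw [tendsto_iff_norm_sub_tendsto_zero]
      refine squeeze_zero (fun _ => norm_nonneg _) (fun n => ?_)
        (?_ : Tendsto (fun n : ℕ => ((n : ℝ) + 1)⁻¹ * (K * (L.map fun p => |p.1 q|).sum)) atTop
          (nhds 0))
      · rw [S.koop_ι S (hσφ _), ← map_sub]
        have hs : 0 ≤ (L.map fun p => |p.1 q|).sum := List.sum_nonneg (by
          intro x hx
          obtain ⟨q, -, rfl⟩ := List.mem_map.1 hx
          exact abs_nonneg _)
        refine S.norm_ι_le (by positivity) ?_
        rintro ⟨v, y⟩
        have e1 : (σ (((n : ℝ) + 1)⁻¹ • q) yt - yt).1 (v, y)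
            = (s.evm m (v + ((n : ℝ) + 1)⁻¹ • q) yt).1 y - (s.evm m v yt).1 y := rfl
        rw [e1, hyt, hyt]
        refine (hK _ _ _).trans (le_of_eq ?_)
        rw [add_sub_cancel_left]
        have : (fun p : (E →ₗ[ℝ] ℝ) × s.A => |p.1 (((n : ℝ) + 1)⁻¹ • q)|)
            = fun p => ((n : ℝ) + 1)⁻¹ * |p.1 q| := by
          funext p
          rw [map_smul, smul_eq_mul, abs_mul, abs_of_nonneg (a := ((n : ℝ) + 1)⁻¹) (by positivity)]
        rw [this, List.sum_map_mul_left]; ring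
      · have := (tendsto_one_div_add_atTop_nhds_zero_nat (𝕜 := ℝ)).mul_const
          (K * (L.map fun p => |p.1 q|).sum)
        simpa using this) x0
  have hD : ∀ R, m.m (s.D (1 + N) L t R)
      = ‖birkhoffAverage ℝ (S.koop S τ) _root_.id R (S.koop S (σ t) (S.ι yt) - S.ι yt)‖ ^ 2 := by
    intro R
    have e0 : ∀ r : ℕ, ∀ a, (S.koop S τ)^[r] (S.ι a) = S.ι (τ^[r] a) := by
      intro r a
      induction r with
      | zero => rfl
      | succ r ih => rw [Function.iterate_succ_apply', Function.iterate_succ_apply', ih,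
          S.koop_ι S hτφ]
    have e1 : ∀ r : ℕ, ∀ a v, s.evm m v (τ^[r] a) = s.evm m (((1 + N) ^ r) v) a := by
      intro r
      induction r with
      | zero => intro a v; simp
      | succ r ih =>
        intro a v
        rw [Function.iterate_succ_apply, ih, pow_succ', Module.End.mul_apply]
        rfl
    simp only [birkhoffAverage, birkhoffSum, _root_.id]
    rw [S.koop_ι S (hσφ _), ← map_sub]
    simp only [e0]
    rw [← map_sum, ← map_smul, S.norm_ι_sq]
    show _ = (s.ext m).φ _
    rw [s.ext_φ]
    congr 1
    funext v
    rw [Sys.D]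
    simp only [← map_sub]
    rw [← map_sum, ← map_smul, s.norm_ι_sq]
    congr 1
    simp only [map_mul]
    have e2 : s.evm m v ((R : ℝ)⁻¹ • ∑ r ∈ range R, τ^[r] (σ t yt - yt))
        = (R : ℝ)⁻¹ • ∑ r ∈ range R, (s.F L (((1 + N) ^ r) v + t) - s.F L (((1 + N) ^ r) v)) := by
      rw [map_smul, map_sum]
      congr 1
      refine Finset.sum_congr rfl fun r _ => ?_
      rw [e1, map_sub, hyt]
      congr 1
      show s.evm m (((1 + N) ^ r) v + t) yt = _
      rw [hyt]
    rw [e2]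
  have hlim : Tendsto (fun R => m.m (s.D (1 + N) L t R)) atTop (nhds 0) := by
    simp only [hD]
    have := key.norm.pow 2
    simpa using this
  obtain ⟨R0, hR0⟩ := eventually_atTop.1 (hlim.eventually_le_const (show (0 : ℝ) < ε / 2 by positivity))
  refine ⟨R0, fun R hR => ?_⟩
  obtain ⟨P, hP⟩ := (s.D_osc (1 + N) L t R).le_mean (s.D_bdd _ L t R) m hm1
    (show 0 < ε / 2 by positivity)
  exact ⟨P, fun u => (hP u).trans (by linarith [hR0 R hR])⟩

end WE

namespace WE
universe u
set_option linter.unusedSectionVars false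

/-- Weights. -/
structure Wt where
  w : ℕ → ℝ
  W : ℕ → ℝ
  W_succ : ∀ n, W (n + 1) = W n + w n
  pos : ∀ n, 0 < w n
  anti : Antitone w
  w_lim : Tendsto w atTop (nhds 0)
  W_lim : Tendsto W atTop atTop
  nw_lim : Tendsto (fun n : ℕ => (n : ℝ) * w n) atTop atTop

variable {H : Type*} [NormedAddCommGroup H] [NormedSpace ℝ H]
variable {H' : Type*} [NormedAddCommGroup H'] [NormedSpace ℝ H']

namespace Wt
variable (c : Wt)

lemma W_mono : StrictMono c.W := strictMono_nat_of_lt_succ fun n => by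
  rw [c.W_succ]; linarith [c.pos n]

/-- Window filter. -/
def fil : Filter (ℕ × ℕ) := comap (fun p : ℕ × ℕ => c.W p.2 - c.W p.1) atTop

/-- Weighted window average. -/
noncomputable def av (x : ℕ → H) (p : ℕ × ℕ) : H :=
  (c.W p.2 - c.W p.1)⁻¹ • ∑ n ∈ Ico p.1 p.2, c.w n • x n

lemma ev_ge (K : ℝ) : ∀ᶠ p in c.fil, K ≤ c.W p.2 - c.W p.1 :=
  tendsto_comap.eventually (eventually_ge_atTop K)

lemma ev_of {Q : ℕ × ℕ → Prop} (K : ℝ) (h : ∀ p : ℕ × ℕ, K ≤ c.W p.2 - c.W p.1 → Q p) :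
    ∀ᶠ p in c.fil, Q p := (c.ev_ge K).mono h

lemma ev_iff {Q : ℕ × ℕ → Prop} : (∀ᶠ p in c.fil, Q p) ↔
    ∃ K : ℝ, ∀ p : ℕ × ℕ, K ≤ c.W p.2 - c.W p.1 → Q p := by
  refine ⟨fun h => ?_, fun ⟨K, h⟩ => c.ev_of K h⟩
  rw [fil, eventually_comap] at h
  obtain ⟨K, hK⟩ := eventually_atTop.1 h
  exact ⟨K, fun p hp => hK _ hp p rfl⟩

lemma sum_w {M N : ℕ} (h : M ≤ N) : ∑ n ∈ Ico M N, c.w n = c.W N - c.W M := by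
  rw [← Finset.sum_Ico_sub _ h]
  refine Finset.sum_congr rfl fun n _ => ?_
  rw [c.W_succ]; ring

lemma le_of_win {p : ℕ × ℕ} (h : 0 < c.W p.2 - c.W p.1) : p.1 ≤ p.2 := by
  by_contra hlt
  have := c.W_mono (not_le.1 hlt)
  linarith

lemma av_add (x y : ℕ → H) (p : ℕ × ℕ) : c.av (fun n => x n + y n) p = c.av x p + c.av y p := by
  simp [av, Finset.sum_add_distrib]

lemma av_sub (x y : ℕ → H) (p : ℕ × ℕ) : c.av (fun n => x n - y n) p = c.av x p - c.av y p := by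
  simp [av, smul_sub]

lemma av_smul (a : ℝ) (x : ℕ → H) (p : ℕ × ℕ) : c.av (fun n => a • x n) p = a • c.av x p := by
  simp only [av, Finset.smul_sum]
  refine Finset.sum_congr rfl fun n _ => ?_
  rw [smul_comm (c.w n), smul_comm]

lemma av_clm (A : H →L[ℝ] H') (x : ℕ → H) (p : ℕ × ℕ) : c.av (fun n => A (x n)) p = A (c.av x p) := by
  simp [av, map_sum]

/-- Upper bound for window averages. -/
def UB (x : ℕ → ℝ) (B : ℝ) : Prop := ∀ ε > 0, ∀ᶠ p in c.fil, c.av x p ≤ B + ε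

/-- Upper bound for norms of window averages. -/
def NB (x : ℕ → H) (B : ℝ) : Prop := ∀ ε > 0, ∀ᶠ p in c.fil, ‖c.av x p‖ ≤ B + ε

variable {c}

lemma NB.mono' {x : ℕ → H} {B B' : ℝ} (h : c.NB x B) (hB : B ≤ B') : c.NB x B' :=
  fun ε hε => (h ε hε).mono fun p hp => hp.trans (by linarith)

lemma NB.of_forall {x : ℕ → H} {B : ℝ} (h : ∀ ε > 0, c.NB x (B + ε)) : c.NB x B := fun ε hε => by
  have := h (ε / 2) (by positivity) (ε / 2) (by positivity)
  exact this.mono fun p hp => hp.trans (by linarith)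

lemma NB.add {x y : ℕ → H} {B B' : ℝ} (h : c.NB x B) (h' : c.NB y B') :
    c.NB (fun n => x n + y n) (B + B') := fun ε hε => by
  filter_upwards [h (ε / 2) (by positivity), h' (ε / 2) (by positivity)] with p h1 h2
  rw [av_add]
  exact (norm_add_le _ _).trans (by linarith)

lemma NB.smul {x : ℕ → H} (h : c.NB x 0) (a : ℝ) : c.NB (fun n => a • x n) 0 := fun ε hε => by
  filter_upwards [h (ε / (|a| + 1)) (by positivity)] with p h1
  rw [av_smul, norm_smul, Real.norm_eq_abs]
  rw [zero_add, le_div_iff₀ (by positivity)] at h1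
  nlinarith [norm_nonneg (c.av x p)]

lemma NB.neg {x : ℕ → H} {B : ℝ} (h : c.NB x B) : c.NB (fun n => - x n) B := fun ε hε => by
  filter_upwards [h ε hε] with p h1
  have : c.av (fun n => - x n) p = - c.av x p := by
    simp [av]
  rwa [this, norm_neg]

lemma NB.sub {x y : ℕ → H} {B B' : ℝ} (h : c.NB x B) (h' : c.NB y B') :
    c.NB (fun n => x n - y n) (B + B') := by
  simp only [sub_eq_add_neg]; exact h.add h'.neg

lemma NB.clm {x : ℕ → H} (h : c.NB x 0) (A : H →L[ℝ] H') : c.NB (fun n => A (x n)) 0 := fun ε hε => by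
  filter_upwards [h (ε / (‖A‖ + 1)) (by positivity)] with p h1
  rw [av_clm]
  rw [zero_add, le_div_iff₀ (by positivity)] at h1
  refine (A.le_opNorm _).trans ?_
  nlinarith [norm_nonneg (c.av x p), norm_nonneg A]

lemma NB.zero : c.NB (fun _ => (0 : H)) 0 := fun ε hε => by
  refine Eventually.of_forall fun p => ?_
  simp [av, hε.le]

lemma NB.sum {κ : Type*} (I : Finset κ) {x : κ → ℕ → H} (h : ∀ i ∈ I, c.NB (x i) 0) :
    c.NB (fun n => ∑ i ∈ I, x i n) 0 := by
  classical
  induction I using Finset.induction_on with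
  | empty => simpa using NB.zero
  | insert i s hi ih =>
    simp only [Finset.sum_insert hi]
    have := (h i (by simp)).add (ih fun j hj => h j (by simp [hj]))
    rwa [add_zero] at this

lemma UB.add {x y : ℕ → ℝ} {B B' : ℝ} (h : c.UB x B) (h' : c.UB y B') :
    c.UB (fun n => x n + y n) (B + B') := fun ε hε => by
  filter_upwards [h (ε / 2) (by positivity), h' (ε / 2) (by positivity)] with p h1 h2
  rw [av_add]; linarith

lemma UB.mono' {x : ℕ → ℝ} {B B' : ℝ} (h : c.UB x B) (hB : B ≤ B') : c.UB x B' :=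
  fun ε hε => (h ε hε).mono fun p hp => hp.trans (by linarith)

lemma UB.smul {x : ℕ → ℝ} {B a : ℝ} (h : c.UB x B) (ha : 0 ≤ a) :
    c.UB (fun n => a * x n) (a * B) := fun ε hε => by
  filter_upwards [h (ε / (a + 1)) (by positivity)] with p h1
  have := c.av_smul a x p
  simp only [smul_eq_mul] at this
  rw [this]
  have h2 : a * (ε / (a + 1)) ≤ ε := by
    rw [mul_div_assoc', div_le_iff₀ (by positivity)]; nlinarith
  nlinarith

lemma UB.of_NB {x : ℕ → ℝ} {B : ℝ} (h : c.NB x B) : c.UB x B := fun ε hε =>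
  (h ε hε).mono fun _ hp => (le_abs_self _).trans hp

lemma av_mono {x y : ℕ → ℝ} (h : ∀ n, x n ≤ y n) {p : ℕ × ℕ} (hp : 0 < c.W p.2 - c.W p.1) :
    c.av x p ≤ c.av y p := by
  simp only [av, smul_eq_mul]
  gcongr with n _
  · exact (c.pos n).le
  · exact h n

lemma av_const (B : ℝ) {p : ℕ × ℕ} (hp : 0 < c.W p.2 - c.W p.1) : c.av (fun _ => B) p = B := by
  simp only [av, smul_eq_mul, ← Finset.sum_mul]
  rw [c.sum_w (c.le_of_win hp)]
  field_simp

lemma UB.of_le {x y : ℕ → ℝ} {B : ℝ} (h : c.UB y B) (hxy : ∀ n, x n ≤ y n) : c.UB x B :=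
  fun ε hε => by
  filter_upwards [h ε hε, c.ev_ge 1] with p h1 h2
  exact (av_mono hxy (by linarith)).trans h1

lemma UB.const (B : ℝ) : c.UB (fun _ => B) B := fun ε hε => by
  filter_upwards [c.ev_ge 1] with p h2
  rw [av_const B (by linarith)]; linarith

lemma UB.sum {κ : Type*} (I : Finset κ) {x : κ → ℕ → ℝ} {B : κ → ℝ} (h : ∀ i ∈ I, c.UB (x i) (B i)) :
    c.UB (fun n => ∑ i ∈ I, x i n) (∑ i ∈ I, B i) := by
  classical
  induction I using Finset.induction_on with
  | empty => simpa using UB.const (c := c) 0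
  | insert i s hi ih =>
    simp only [Finset.sum_insert hi]
    exact (h i (by simp)).add (ih fun j hj => h j (by simp [hj]))

lemma norm_av_le {x : ℕ → H} {p : ℕ × ℕ} (hp : 0 < c.W p.2 - c.W p.1) :
    ‖c.av x p‖ ≤ c.av (fun n => ‖x n‖) p := by
  simp only [av, norm_smul, smul_eq_mul, norm_inv, Real.norm_of_nonneg hp.le]
  gcongr
  refine (norm_sum_le _ _).trans (le_of_eq ?_)
  refine Finset.sum_congr rfl fun n _ => ?_
  rw [norm_smul, Real.norm_of_nonneg (c.pos n).le]

lemma NB.of_UB {x : ℕ → H} {B : ℝ} (h : c.UB (fun n => ‖x n‖) B) : c.NB x B := fun ε hε => by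
  filter_upwards [h ε hε, c.ev_ge 1] with p h1 h2
  exact (norm_av_le (by linarith)).trans h1

lemma NB.of_bound {x : ℕ → H} {B : ℝ} (h : ∀ n, ‖x n‖ ≤ B) : c.NB x B :=
  NB.of_UB ((UB.const B).of_le h)

/-- Sums with a bounded error are negligible. -/
lemma NB.of_sum {x : ℕ → H} {C : ℝ} (h : ∀ M N : ℕ, M ≤ N → ‖∑ n ∈ Ico M N, c.w n • x n‖ ≤ C) :
    c.NB x 0 := fun ε hε => by
  filter_upwards [c.ev_ge 1, c.ev_ge (C / ε)] with p h1 h2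
  rw [av, norm_smul, norm_inv, Real.norm_of_nonneg (by linarith), zero_add,
    inv_mul_le_iff₀ (by linarith)]
  rw [div_le_iff₀ hε] at h2
  exact (h _ _ (c.le_of_win (by linarith))).trans h2

lemma NB.of_tendsto {x : ℕ → H} (h : Tendsto x atTop (nhds 0)) : c.NB x 0 := by
  refine NB.of_forall fun ε hε => ?_
  obtain ⟨n0, hn0⟩ := Metric.tendsto_atTop.1 h ε hε
  have e : x = fun n => (if n < n0 then x n else 0) + (if n < n0 then 0 else x n) := by
    funext n; split_ifs <;> simp
  rw [e]
  refine NB.add (NB.of_sum (C := ∑ n ∈ range n0, c.w n * ‖x n‖) fun M N _ => ?_)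
    (NB.of_bound fun n => ?_)
  · refine (norm_sum_le _ _).trans ?_
    have e2 : ∑ n ∈ Ico M N, ‖c.w n • (if n < n0 then x n else 0)‖
        = ∑ n ∈ (Ico M N).filter (· < n0), c.w n * ‖x n‖ := by
      rw [Finset.sum_filter]
      refine Finset.sum_congr rfl fun n _ => ?_
      split_ifs
      · rw [norm_smul, Real.norm_of_nonneg (c.pos n).le]
      · simp
    rw [e2]
    refine Finset.sum_le_sum_of_subset_of_nonneg ?_ fun n _ _ =>
      mul_nonneg (c.pos n).le (norm_nonneg _)
    intro n hn
    exact Finset.mem_range.2 (Finset.mem_filter.1 hn).2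
  · split_ifs with h
    · simpa using hε.le
    · simpa using (hn0 n (not_lt.1 h)).le

lemma NB.shift {x : ℕ → H} {C : ℝ} (hC : ∀ n, ‖x n‖ ≤ C) : c.NB (fun n => x (n + 1) - x n) 0 := by
  have hC0 : 0 ≤ C := (norm_nonneg _).trans (hC 0)
  refine NB.of_sum (C := 2 * C * c.w 0) fun M N hMN => ?_
  have key : ‖∑ n ∈ Ico M N, c.w n • (x (n + 1) - x n) - c.w N • x N + c.w M • x M‖
      ≤ C * (c.w M - c.w N) := by
    induction N, hMN using Nat.le_induction with
    | base => simp
    | succ N hN ih =>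
      rw [Finset.sum_Ico_succ_top hN]
      have e : ∑ n ∈ Ico M N, c.w n • (x (n + 1) - x n) + c.w N • (x (N + 1) - x N)
          - c.w (N + 1) • x (N + 1) + c.w M • x M
          = (∑ n ∈ Ico M N, c.w n • (x (n + 1) - x n) - c.w N • x N + c.w M • x M)
            + (c.w N - c.w (N + 1)) • x (N + 1) := by
        rw [smul_sub, sub_smul]; abel
      rw [e]
      refine (norm_add_le _ _).trans ?_
      have h1 : 0 ≤ c.w N - c.w (N + 1) := by linarith [c.anti (Nat.le_succ N)]
      rw [norm_smul, Real.norm_of_nonneg h1]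
      nlinarith [hC (N + 1)]
  set S := ∑ n ∈ Ico M N, c.w n • (x (n + 1) - x n)
  have e : S = (S - c.w N • x N + c.w M • x M) + c.w N • x N - c.w M • x M := by abel
  rw [e]
  have n1 : ‖c.w N • x N‖ ≤ c.w N * C := by
    rw [norm_smul, Real.norm_of_nonneg (c.pos N).le]
    exact mul_le_mul_of_nonneg_left (hC N) (c.pos N).le
  have n2 : ‖c.w M • x M‖ ≤ c.w M * C := by
    rw [norm_smul, Real.norm_of_nonneg (c.pos M).le]
    exact mul_le_mul_of_nonneg_left (hC M) (c.pos M).le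
  have n3 := norm_sub_le ((S - c.w N • x N + c.w M • x M) + c.w N • x N) (c.w M • x M)
  have n4 := norm_add_le (S - c.w N • x N + c.w M • x M) (c.w N • x N)
  have n5 := c.anti (Nat.zero_le M)
  nlinarith

lemma NB.shift_add {x : ℕ → H} {C : ℝ} (hC : ∀ n, ‖x n‖ ≤ C) (r : ℕ) :
    c.NB (fun n => x (n + r) - x n) 0 := by
  induction r with
  | zero => simpa using NB.zero
  | succ r ih =>
    have h1 := NB.shift (c := c) (x := fun n => x (n + r)) fun n => hC _
    have := h1.add ih
    rw [add_zero] at this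
    refine (congrArg (fun z => c.NB z 0) ?_).mp this
    funext n
    simp only [show n + 1 + r = n + (r + 1) by ring]
    abel

/-- Slow functions are asymptotically translation invariant. -/
lemma NB.slow [CompleteSpace H] {ψ : ℝ → H} {C K : ℝ} (hC : ∀ x, ‖ψ x‖ ≤ C)
    (hK : ∀ x y, ‖ψ x - ψ y‖ ≤ K * |x - y|) (t : ℝ) :
    c.NB (fun n => ψ (c.W n + t) - ψ (c.W n)) 0 := by
  have hK0 : 0 ≤ K := by simpa using (norm_nonneg _).trans (hK 1 0)
  have hcont : ∀ ψ : ℝ → H, (∀ x y, ‖ψ x - ψ y‖ ≤ K * |x - y|) → Continuous ψ := by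
    intro ψ hψ
    refine (LipschitzWith.of_dist_le_mul (K := ⟨K, hK0⟩) fun x y => ?_).continuous
    rw [dist_eq_norm, Real.dist_eq]; exact hψ x y
  -- comparison with integrals
  have comp : ∀ ψ : ℝ → H, (∀ x y, ‖ψ x - ψ y‖ ≤ K * |x - y|) →
      c.NB (fun n => ψ (c.W n) - (c.w n)⁻¹ • ∫ x in c.W n..c.W (n + 1), ψ x) 0 := by
    intro ψ hψ
    refine NB.of_tendsto (squeeze_zero_norm (fun n => ?_)
      (by simpa using c.w_lim.const_mul K : Tendsto (fun n => K * c.w n) atTop (nhds 0)))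
    have hw := c.pos n
    have e : ψ (c.W n) - (c.w n)⁻¹ • ∫ x in c.W n..c.W (n + 1), ψ x
        = (c.w n)⁻¹ • ∫ x in c.W n..c.W (n + 1), (ψ (c.W n) - ψ x) := by
      rw [intervalIntegral.integral_sub intervalIntegrable_const
        ((hcont ψ hψ).intervalIntegrable _ _), intervalIntegral.integral_const, c.W_succ,
        add_sub_cancel_left, smul_sub, smul_smul, inv_mul_cancel₀ hw.ne', one_smul]
    rw [e, norm_smul, norm_inv, Real.norm_of_nonneg hw.le, inv_mul_le_iff₀ hw]
    have := intervalIntegral.norm_integral_le_of_norm_le_const (a := c.W n) (b := c.W (n + 1))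
      (f := fun x => ψ (c.W n) - ψ x) (C := K * c.w n) (fun x hx => by
        rw [Set.uIoc_of_le (by rw [c.W_succ]; linarith)] at hx
        refine (hψ _ _).trans ?_
        gcongr
        rw [c.W_succ] at hx
        rw [abs_le]; constructor <;> linarith [hx.1, hx.2])
    refine this.trans (le_of_eq ?_)
    rw [c.W_succ, add_sub_cancel_left, abs_of_pos hw]; ring
  have h1 := comp (fun x => ψ (x + t)) (fun x y => by
    have := hK (x + t) (y + t)
    rwa [add_sub_add_right_eq_sub] at this)
  have h2 := comp ψ hK
  have h3 : c.NB (fun n => (c.w n)⁻¹ • (∫ x in c.W n..c.W (n + 1), ψ (x + t))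
      - (c.w n)⁻¹ • ∫ x in c.W n..c.W (n + 1), ψ x) 0 := by
    refine NB.of_sum (C := 2 * (C * |t|)) fun M N hMN => ?_
    have e : ∀ n, c.w n • ((c.w n)⁻¹ • (∫ x in c.W n..c.W (n + 1), ψ (x + t))
      - (c.w n)⁻¹ • ∫ x in c.W n..c.W (n + 1), ψ x)
      = (∫ x in c.W n..c.W (n + 1), ψ (x + t)) - ∫ x in c.W n..c.W (n + 1), ψ x := by
      intro n
      rw [smul_sub, smul_smul, smul_smul, mul_inv_cancel₀ (c.pos n).ne', one_smul, one_smul]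
    have hi : ∀ a b, IntervalIntegrable ψ volume a b := fun a b =>
      (hcont ψ hK).intervalIntegrable _ _
    have hi' : ∀ a b, IntervalIntegrable (fun x => ψ (x + t)) volume a b := fun a b =>
      ((hcont ψ hK).comp (continuous_id.add continuous_const)).intervalIntegrable _ _
    simp only [e]
    rw [Finset.sum_sub_distrib, intervalIntegral.sum_integral_adjacent_intervals_Ico hMN
      (fun k _ => hi' _ _), intervalIntegral.sum_integral_adjacent_intervals_Ico hMN
      (fun k _ => hi _ _), intervalIntegral.integral_comp_add_right]
    have e3 : (∫ x in c.W M + t..c.W N + t, ψ x) - ∫ x in c.W M..c.W N, ψ x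
        = (∫ x in c.W N..c.W N + t, ψ x) - ∫ x in c.W M..c.W M + t, ψ x := by
      rw [← intervalIntegral.integral_add_adjacent_intervals (hi (c.W M + t) (c.W N))
        (hi (c.W N) (c.W N + t)),
        ← intervalIntegral.integral_add_adjacent_intervals (hi (c.W M) (c.W M + t))
        (hi (c.W M + t) (c.W N))]
      abel
    rw [e3]
    have b : ∀ a, ‖∫ x in a..a + t, ψ x‖ ≤ C * |t| := by
      intro a
      have := intervalIntegral.norm_integral_le_of_norm_le_const (a := a) (b := a + t)
        (f := ψ) (C := C) (fun x _ => hC x)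
      simpa using this
    refine (norm_sub_le _ _).trans ?_
    linarith [b (c.W N), b (c.W M)]
  have := (h1.sub h2).add h3
  simp only [add_zero] at this
  refine (congrArg (fun z => c.NB z 0) ?_).mp this
  funext n
  abel

/-- From window averages to Cesàro averages. -/
theorem NB.cesaro {z : ℕ → H} {C : ℝ} (hC : ∀ n, ‖z n‖ ≤ C) (hz : c.NB z 0) :
    Tendsto (fun N : ℕ => (N : ℝ)⁻¹ • ∑ n ∈ range N, z n) atTop (nhds 0) := by
  have hC0 : 0 ≤ C := (norm_nonneg _).trans (hC 0)
  rw [Metric.tendsto_atTop]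
  intro ε hε
  obtain ⟨K0, hK0⟩ := c.ev_iff.1 (hz (ε / 3) (by positivity))
  set K := max K0 1 with hKdef
  have hK1 : 1 ≤ K := le_max_right _ _
  have hT : ∀ m N, m ≤ N → ‖∑ n ∈ Ico m N, c.w n • z n‖ ≤ ε / 3 * (c.W N - c.W m) + C * K := by
    intro m N hmN
    have hW : 0 ≤ c.W N - c.W m := by linarith [c.W_mono.monotone hmN]
    by_cases h : K ≤ c.W N - c.W m
    · have h1 := hK0 (m, N) ((le_max_left _ _).trans h)
      have hp : 0 < c.W N - c.W m := by linarith
      simp only [av] at h1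
      rw [norm_smul, norm_inv, Real.norm_of_nonneg hp.le, inv_mul_le_iff₀ hp] at h1
      nlinarith
    · have h1 : ‖∑ n ∈ Ico m N, c.w n • z n‖ ≤ ∑ n ∈ Ico m N, c.w n * C := by
        refine (norm_sum_le _ _).trans (Finset.sum_le_sum fun n _ => ?_)
        rw [norm_smul, Real.norm_of_nonneg (c.pos n).le]
        exact mul_le_mul_of_nonneg_left (hC n) (c.pos n).le
      rw [← Finset.sum_mul, c.sum_w hmN] at h1
      have : (c.W N - c.W m) * C ≤ K * C := mul_le_mul_of_nonneg_right (not_le.1 h).le hC0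
      nlinarith
  have key : ∀ N k, k ≤ N → ‖∑ n ∈ range k, z n + (c.w k)⁻¹ • ∑ n ∈ Ico k N, c.w n • z n‖
      ≤ ε / 3 * k + (c.w k)⁻¹ * (ε / 3 * (c.W N - c.W k) + C * K) := by
    intro N k
    induction k with
    | zero =>
      intro _
      have h0 := hT 0 N (Nat.zero_le _)
      rw [Finset.sum_range_zero, zero_add, norm_smul, norm_inv, Real.norm_of_nonneg (c.pos 0).le]
      have := mul_le_mul_of_nonneg_left h0 (inv_nonneg.2 (c.pos 0).le)
      simpa using this
    | succ k ih =>
      intro hk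
      have ih' := ih (by omega)
      have e1 : ∑ n ∈ Ico k N, c.w n • z n = c.w k • z k + ∑ n ∈ Ico (k + 1) N, c.w n • z n :=
        Finset.sum_eq_sum_Ico_succ_bot (by omega) _
      have e2 : ∑ n ∈ range (k + 1), z n + (c.w (k + 1))⁻¹ • ∑ n ∈ Ico (k + 1) N, c.w n • z n
          = (∑ n ∈ range k, z n + (c.w k)⁻¹ • ∑ n ∈ Ico k N, c.w n • z n)
            + ((c.w (k + 1))⁻¹ - (c.w k)⁻¹) • ∑ n ∈ Ico (k + 1) N, c.w n • z n := by
        rw [e1, Finset.sum_range_succ, smul_add, smul_smul, inv_mul_cancel₀ (c.pos k).ne',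
          one_smul, sub_smul]
        abel
      have h1 : 0 ≤ (c.w (k + 1))⁻¹ - (c.w k)⁻¹ := by
        have := inv_anti₀ (c.pos (k + 1)) (c.anti (Nat.le_succ k))
        linarith
      rw [e2]
      refine (norm_add_le _ _).trans ?_
      rw [norm_smul, Real.norm_of_nonneg h1]
      have h2 := mul_le_mul_of_nonneg_left (hT (k + 1) N hk) h1
      have h3 : (c.w k)⁻¹ * (ε / 3 * (c.W N - c.W k) + C * K)
          = ε / 3 + (c.w k)⁻¹ * (ε / 3 * (c.W N - c.W (k + 1)) + C * K) := by
        rw [c.W_succ]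
        have := c.pos k
        field_simp
        ring
      push_cast
      nlinarith
  obtain ⟨n1, hn1⟩ := eventually_atTop.1 (c.nw_lim.eventually_ge_atTop (3 * C * K / ε))
  refine ⟨n1 + 1, fun N hN => ?_⟩
  have hN0 : (0 : ℝ) < N := by exact_mod_cast (by omega : 0 < N)
  have h1 := key N N le_rfl
  have h2 := hn1 N (by omega)
  simp only [Finset.Ico_self, Finset.sum_empty, smul_zero, add_zero, sub_self, mul_zero,
    zero_add] at h1
  rw [dist_zero_right, norm_smul, norm_inv, Real.norm_of_nonneg hN0.le, inv_mul_lt_iff₀ hN0]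
  have hw := c.pos N
  have h3 : (c.w N)⁻¹ * (C * K) ≤ ε / 3 * N := by
    rw [inv_mul_le_iff₀ hw]
    rw [div_le_iff₀ hε] at h2
    nlinarith
  nlinarith

end Wt
end WE

namespace WE
universe u
set_option linter.unusedSectionVars false

/-- A curve driven by a unipotent map. -/
structure Curve (E : Type) [AddCommGroup E] [Module ℝ E] extends Wt where
  N : Module.End ℝ E
  d : ℕ
  Nd : N ^ d = 0
  e0 : E
  c0 : E →ₗ[ℝ] ℝ
  c0_e0 : c0 e0 = 1
  c0_N : ∀ v, c0 (N v) = 0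
  rng : ∀ v, ∃ v', v - c0 v • e0 = N v'
  u : ℕ → E
  u_succ : ∀ n, u (n + 1) = (1 + N) (u n) + w n • e0
  c0_u : ∀ n, c0 (u n) = W n

namespace Curve
variable {E : Type} [AddCommGroup E] [Module ℝ E] (c : Curve E)

/-- The unipotent map. -/
def U : Module.End ℝ E := 1 + c.N

/-- The projection onto the slow direction. -/
def π : E →ₗ[ℝ] E := c.c0.smulRight c.e0

lemma π_apply (v : E) : c.π v = c.c0 v • c.e0 := rfl

lemma π_π (v : E) : c.π (c.π v) = c.π v := by
  simp [π_apply, c.c0_e0]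

/-- Coefficients. -/
def cf (i : ℕ) (l : E →ₗ[ℝ] ℝ) : ℝ := l ((c.N ^ i) c.e0)

lemma cf_sub (i : ℕ) (l l' : E →ₗ[ℝ] ℝ) : c.cf i (l - l') = c.cf i l - c.cf i l' := rfl

lemma cf_ge {i : ℕ} (h : c.d ≤ i) (l : E →ₗ[ℝ] ℝ) : c.cf i l = 0 := by
  rw [cf, show c.N ^ i = 0 from by rw [← Nat.sub_add_cancel h, pow_add, c.Nd, mul_zero]]; simp

/-- Leading index. -/
def top (i : ℕ) (l : E →ₗ[ℝ] ℝ) : Prop := c.cf i l ≠ 0 ∧ ∀ j > i, c.cf j l = 0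

lemma top_lt {i : ℕ} {l : E →ₗ[ℝ] ℝ} (h : c.top i l) : i < c.d := by
  by_contra hi
  exact h.1 (c.cf_ge (not_lt.1 hi) l)

lemma top_unique {i j : ℕ} {l : E →ₗ[ℝ] ℝ} (h : c.top i l) (h' : c.top j l) : i = j := by
  rcases lt_trichotomy i j with h1 | h1 | h1
  · exact absurd (h.2 j h1) h'.1
  · exact h1
  · exact absurd (h'.2 i h1) h.1

lemma top_exists {i : ℕ} {l : E →ₗ[ℝ] ℝ} (h : c.cf i l ≠ 0) : ∃ j ≥ i, c.top j l := by
  classical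
  have hi : i ≤ c.d := by
    by_contra hi
    exact h (c.cf_ge (not_le.1 hi).le l)
  refine ⟨Nat.findGreatest (fun j => c.cf j l ≠ 0) c.d,
    Nat.le_findGreatest (P := fun j => c.cf j l ≠ 0) hi h,
    Nat.findGreatest_spec (P := fun j => c.cf j l ≠ 0) hi h, fun j hj => ?_⟩
  by_cases hjd : j ≤ c.d
  · by_contra hne
    exact absurd (Nat.le_findGreatest (P := fun j => c.cf j l ≠ 0) hjd hne) (by omega)
  · exact c.cf_ge (by omega) l

/-- Fast forms. -/
def fast (l : E →ₗ[ℝ] ℝ) : Prop := ∃ i, 1 ≤ i ∧ c.top i l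

lemma slow_N {l : E →ₗ[ℝ] ℝ} (h : ∀ i ≥ 1, c.cf i l = 0) (v : E) : l (c.N v) = 0 := by
  have key : ∀ k, ∀ v : E, ∃ v', l (c.N v) = l ((c.N ^ (k + 1)) v') := by
    intro k
    induction k with
    | zero => intro v; exact ⟨v, by simp⟩
    | succ k ih =>
      intro v
      obtain ⟨v', hv'⟩ := ih v
      obtain ⟨v'', hv''⟩ := c.rng v'
      refine ⟨v'', ?_⟩
      rw [hv', pow_succ c.N (k + 1), Module.End.mul_apply, ← hv'', map_sub, map_sub, map_smul, map_smul]
      have := h (k + 1) (by omega)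
      rw [cf] at this
      rw [this]; simp
  obtain ⟨v', hv'⟩ := key c.d v
  rw [hv', pow_succ', c.Nd]; simp

lemma slow_π {l : E →ₗ[ℝ] ℝ} (h : ∀ i ≥ 1, c.cf i l = 0) : l ∘ₗ c.π = l := by
  ext v
  obtain ⟨v', hv'⟩ := c.rng v
  have := c.slow_N h v'
  rw [← hv', map_sub, sub_eq_zero] at this
  rw [this]; rfl

lemma slow_of_not_fast {l : E →ₗ[ℝ] ℝ} (h : ¬ c.fast l) : l ∘ₗ c.π = l := by
  refine c.slow_π fun i hi => ?_
  by_contra hne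
  obtain ⟨j, hj, hj'⟩ := c.top_exists hne
  exact h ⟨j, hi.trans hj, hj'⟩

lemma c0_U (v : E) (r : ℕ) : c.c0 ((c.U ^ r) v) = c.c0 v := by
  induction r with
  | zero => simp
  | succ r ih =>
    rw [pow_succ', Module.End.mul_apply, U, LinearMap.add_apply, map_add, c.c0_N, ← U]
    simpa using ih

lemma π_U (v : E) (r : ℕ) : c.π ((c.U ^ r) v) = c.π v := by
  rw [π_apply, c0_U, π_apply]

lemma cf_U (l : E →ₗ[ℝ] ℝ) (i r : ℕ) (h : ∀ j > i, c.cf j l = 0) : ∀ j ≥ i,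
    c.cf j (l ∘ₗ (c.U ^ r)) = c.cf j l := by
  induction r with
  | zero => intro j _; rfl
  | succ r ih =>
    intro j hj
    have e : c.cf j (l ∘ₗ (c.U ^ (r + 1))) = c.cf j (l ∘ₗ (c.U ^ r)) + c.cf (j + 1) (l ∘ₗ (c.U ^ r)) := by
      simp only [cf, LinearMap.comp_apply]
      rw [pow_succ, Module.End.mul_apply, U, LinearMap.add_apply, ← U, pow_succ' c.N, Module.End.mul_apply,
        map_add, map_add]
      rfl
    rw [e, ih j hj, ih (j + 1) (by omega), h (j + 1) (by omega), add_zero]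

lemma top_U {i r : ℕ} {l : E →ₗ[ℝ] ℝ} (h : c.top i l) : c.top i (l ∘ₗ (c.U ^ r)) := by
  refine ⟨by rw [c.cf_U l i r h.2 i le_rfl]; exact h.1, fun j hj => ?_⟩
  rw [c.cf_U l i r h.2 j hj.le, h.2 j hj]

lemma top_U_iff {i r : ℕ} {l : E →ₗ[ℝ] ℝ} (h : c.top i (l ∘ₗ (c.U ^ r))) :
    c.top i l ∧ c.cf i (l ∘ₗ (c.U ^ r)) = c.cf i l := by
  by_cases h0 : ∃ j, c.cf j l ≠ 0
  · obtain ⟨j, hj⟩ := h0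
    obtain ⟨k, -, hk⟩ := c.top_exists hj
    have := c.top_unique h (c.top_U hk)
    subst this
    exact ⟨hk, c.cf_U l i r hk.2 i le_rfl⟩
  · push Not at h0
    exact absurd ((c.cf_U l i r (fun j _ => h0 j) i le_rfl).trans (h0 i)) h.1

lemma fast_U {l : E →ₗ[ℝ] ℝ} (h : c.fast l) (r : ℕ) : c.fast (l ∘ₗ (c.U ^ r)) := by
  obtain ⟨i, hi, h⟩ := h
  exact ⟨i, hi, c.top_U h⟩

lemma u_add (r : ℕ) : ∀ l : E →ₗ[ℝ] ℝ,
    Tendsto (fun n => l (c.u (n + r) - (c.U ^ r) (c.u n))) atTop (nhds 0) := by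
  induction r with
  | zero => intro l; simp
  | succ r ih =>
    intro l
    have e : ∀ n, l (c.u (n + (r + 1)) - (c.U ^ (r + 1)) (c.u n)) =
        (l ∘ₗ c.U) (c.u (n + r) - (c.U ^ r) (c.u n)) + c.w (n + r) * l c.e0 := by
      intro n
      rw [← add_assoc, c.u_succ, pow_succ', Module.End.mul_apply]
      simp only [LinearMap.comp_apply, map_sub, map_add, map_smul, smul_eq_mul, U]
      ring
    simp only [e]
    have h2 : Tendsto (fun n => c.w (n + r) * l c.e0) atTop (nhds (0 * l c.e0)) :=
      ((tendsto_add_atTop_iff_nat r).2 c.w_lim).mul_const _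
    simpa using (ih (l ∘ₗ c.U)).add h2

variable {Y : Type u}

/-- Leading coefficients are controlled by `A`. -/
def Bd (A : ℕ → Finset ℝ) {B : Type*} (L : List ((E →ₗ[ℝ] ℝ) × B)) : Prop :=
  ∀ p ∈ L, ∀ i ≥ 1, c.top i p.1 → c.cf i p.1 ∈ A i

/-- The order on bounding families. -/
def Alt (A' A : ℕ → Finset ℝ) : Prop :=
  ∃ i < c.d, (∀ j > i, (A' j).card = (A j).card) ∧ (A' i).card < (A i).card

lemma Alt_wf : WellFounded c.Alt := by
  have wf : WellFounded (fun x y : Lex (Fin c.d → ℕ) => x < y) := wellFounded_lt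
  refine Subrelation.wf (r := InvImage (fun x y : Lex (Fin c.d → ℕ) => x < y)
    (fun A : ℕ → Finset ℝ => toLex fun k : Fin c.d => (A (c.d - 1 - k)).card)) ?_ (InvImage.wf _ wf)
  rintro A' A ⟨i, hi, h1, h2⟩
  refine ⟨⟨c.d - 1 - i, by omega⟩, fun j hj => ?_, ?_⟩
  · exact h1 _ (by have : (j : ℕ) < c.d - 1 - i := hj; omega)
  · have : c.d - 1 - (c.d - 1 - i) = i := by omega
    simpa [this] using h2

/-- Almost invariance along the curve. -/
def gd {H : Type*} [NormedAddCommGroup H] [NormedSpace ℝ H] (F : E → H) : Prop :=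
  ∀ t, c.NB (fun n => F (c.u n + t) - F (c.u n)) 0

/-- The good property. -/
def gp : GP.{u} E where
  good F := c.gd F
  add F G hF hG := fun t => by
    have := (hF t).add (hG t)
    rw [add_zero] at this
    convert this using 2
    exact add_sub_add_comm _ _ _ _
  smul a F hF := fun t => by
    have := (hF t).smul a
    simpa only [smul_sub] using this
  lim F h := fun t => by
    refine Wt.NB.of_forall fun ε hε => ?_
    obtain ⟨G, hG, hFG⟩ := h (ε / 2) (by positivity)
    have h1 : c.NB (fun n => (F (c.u n + t) - G (c.u n + t)) - (F (c.u n) - G (c.u n))) ε :=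
      Wt.NB.of_bound fun n => (norm_sub_le _ _).trans (by linarith [hFG (c.u n + t), hFG (c.u n)])
    have := (hG t).add h1
    convert this using 2
    abel
  clm A F hF := fun t => by
    have := (hF t).clm A
    simpa only [map_sub] using this

end Curve
end WE

namespace WE
universe u
set_option linter.unusedSectionVars false

namespace Curve
variable {E : Type} [AddCommGroup E] [Module ℝ E] (c : Curve E)
variable {Y : Type u}

/-- Scalar good functions. -/
def SG (C : E → ℝ) : Prop := (∃ K, ∀ u, ‖C u‖ ≤ K) ∧
  (∀ a b : ℕ → E, (∀ l : E →ₗ[ℝ] ℝ, Tendsto (fun n => l (a n - b n)) atTop (nhds 0)) →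
    Tendsto (fun n => C (a n) - C (b n)) atTop (nhds 0)) ∧ c.gd C

variable {c}

lemma SG.smul {C : E → ℝ} (h : c.SG C) (a : ℝ) : c.SG (fun u => a • C u) := by
  obtain ⟨⟨K, hK⟩, h2, h3⟩ := h
  refine ⟨⟨‖a‖ * K, fun u => ?_⟩, fun x y hxy => ?_, fun t => ?_⟩
  · rw [norm_smul]; gcongr; exact hK u
  · have := (h2 x y hxy).const_smul a
    simpa only [smul_sub, smul_zero] using this
  · have := (h3 t).smul a
    simpa only [smul_sub] using this

lemma SG.zero : c.SG (fun _ => (0 : ℝ)) :=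
  ⟨⟨0, fun u => by simp⟩, fun a b h => by simp, fun t => by simpa using Wt.NB.zero (c := c.toWt) (H := ℝ)⟩

lemma SG.add {C D : E → ℝ} (h : c.SG C) (h' : c.SG D) : c.SG (fun u => C u + D u) := by
  obtain ⟨⟨K, hK⟩, h2, h3⟩ := h
  obtain ⟨⟨K', hK'⟩, h2', h3'⟩ := h'
  refine ⟨⟨K + K', fun u => (norm_add_le _ _).trans (add_le_add (hK u) (hK' u))⟩, fun x y hxy => ?_, fun t => ?_⟩
  · have := (h2 x y hxy).add (h2' x y hxy)
    simpa only [add_sub_add_comm, add_zero] using this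
  · have := (h3 t).add (h3' t)
    simpa only [add_sub_add_comm, add_zero] using this

lemma SG.sum {κ : Type*} (I : Finset κ) {C : κ → E → ℝ} (h : ∀ i ∈ I, c.SG (C i)) :
    c.SG (fun u => ∑ i ∈ I, C i u) := by
  classical
  induction I using Finset.induction_on with
  | empty => simpa using SG.zero
  | insert i I hi ih =>
    simp only [Finset.sum_insert hi]
    exact (h i (by simp)).add (ih fun j hj => h j (by simp [hj]))

lemma SG.UB {C : E → ℝ} (h : c.SG C) (P : Avg E) {B : ℝ} (hP : ∀ u, P.ap C u ≤ B) :
    c.UB (fun n => C (c.u n)) B := by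
  obtain ⟨-, -, h3⟩ := h
  have h1 : c.NB (fun n => P.ap C (c.u n) - C (c.u n)) 0 := by
    have hs : c.NB (fun n => (Fintype.card P.I : ℝ)⁻¹ • ∑ i ∈ univ, (C (c.u n + P.p i) - C (c.u n))) 0 :=
      (Wt.NB.sum univ fun i _ => h3 (P.p i)).smul _
    convert hs using 2 with n
    rw [Finset.sum_sub_distrib, smul_sub, Finset.sum_const, Finset.card_univ, ← Nat.cast_smul_eq_nsmul ℝ,
      smul_smul, inv_mul_cancel₀ P.card_pos.ne', one_smul]
    rfl
  have h2 : c.UB (fun n => P.ap C (c.u n)) B := (Wt.UB.const B).of_le fun n => hP _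
  have := h2.add (Wt.UB.of_NB h1.neg)
  rw [add_zero] at this
  exact this.of_le fun n => by linarith

lemma SG.UB_U {C : E → ℝ} (h : c.SG C) (P : Avg E) {B : ℝ} (hP : ∀ u, P.ap C u ≤ B) (r : ℕ) :
    c.UB (fun n => C ((c.U ^ r) (c.u n))) B := by
  have h0 := h.UB P hP
  obtain ⟨⟨K, hK⟩, h2, h3⟩ := h
  have h4 := Wt.NB.of_tendsto (c := c.toWt) (h2 (fun n => c.u (n + r)) (fun n => (c.U ^ r) (c.u n)) (c.u_add r))
  have h5 := Wt.NB.shift_add (c := c.toWt) (x := fun n => C (c.u n)) (fun n => hK (c.u n)) r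
  have := (h0.add (Wt.UB.of_NB h5)).add (Wt.UB.of_NB h4.neg)
  rw [add_zero, add_zero] at this
  exact this.of_le fun n => by linarith

variable (c)

/-- The statement for all systems. -/
def Str (A : ℕ → Finset ℝ) : Prop :=
  ∀ (Y : Type u) (s : Sys Y) (L : List ((E →ₗ[ℝ] ℝ) × s.A)), c.Bd A L → c.gd (fun u => s.ι (s.F L u))

lemma φ_sub (s : Sys Y) (l : E →ₗ[ℝ] ℝ) (L : List ((E →ₗ[ℝ] ℝ) × s.A)) (u : E) :
    s.φ (s.F L u) = s.φ (s.F (L.map fun p => (p.1 - l, p.2)) u) := by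
  have : s.F (L.map fun p => (p.1 - l, p.2)) u = s.act (- l u) (s.F L u) := by
    induction L with
    | nil => simp
    | cons p L ih =>
      rw [List.map_cons, s.F_cons, s.F_cons, ih, map_mul, Flow.act_act]
      congr 2
      simp; ring_nf
  rw [this, s.φ_inv]

theorem scal (A : ℕ → Finset ℝ) (IH : ∀ A', c.Alt A' A → Str.{u} c A') (s : Sys Y)
    (L : List ((E →ₗ[ℝ] ℝ) × s.A)) (hL : c.Bd A L) (hf : ∀ p ∈ L, c.fast p.1) :
    c.SG (fun u => s.φ (s.F L u)) := by
  classical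
  have hι : ∀ (L : List ((E →ₗ[ℝ] ℝ) × s.A)) u, s.φ (s.F L u) = innerSL ℝ (s.ι 1) (s.ι (s.F L u)) := by
    intro L u; simp [Sys.inner_ι]
  refine ⟨s.φ_F_bdd L, fun a b hab => ?_, ?_⟩
  · have := ((innerSL ℝ (s.ι 1)).continuous.tendsto 0).comp (s.F_tendsto L a b fun p _ => hab p.1)
    simpa only [Function.comp_def, map_sub, map_zero, ← hι] using this
  · suffices h : ∃ L' : List ((E →ₗ[ℝ] ℝ) × s.A), (∀ u, s.φ (s.F L u) = s.φ (s.F L' u)) ∧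
        c.gd (fun u => s.ι (s.F L' u)) by
      obtain ⟨L', h1, h2⟩ := h
      intro t
      have := (h2 t).clm (innerSL ℝ (s.ι 1))
      simpa only [map_sub, ← hι, ← h1] using this
    by_cases hne : L = []
    · refine ⟨[], fun u => by rw [hne], fun t => ?_⟩
      simpa using Wt.NB.zero (c := c.toWt) (H := s.H)
    have hex : ∃ i, ∃ p ∈ L, c.top i p.1 := by
      obtain ⟨p, hp⟩ := List.exists_mem_of_ne_nil L hne
      obtain ⟨i, -, hi⟩ := hf p hp
      exact ⟨i, p, hp, hi⟩
    set i1 := Nat.find hex with hi1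
    obtain ⟨p1, hp1, ht1⟩ := Nat.find_spec hex
    rw [← hi1] at ht1
    have hmin : ∀ p ∈ L, ∀ i, c.top i p.1 → i1 ≤ i := fun p hp i hi => Nat.find_min' hex ⟨p, hp, hi⟩
    have hi1' : 1 ≤ i1 := by
      obtain ⟨i, hi, h⟩ := hf p1 hp1
      rwa [c.top_unique ht1 h]
    let L' : List ((E →ₗ[ℝ] ℝ) × s.A) := L.map fun p => (p.1 - p1.1, p.2)
    let A' : ℕ → Finset ℝ := fun k => if i1 < k then A k else if k = i1 then
      ((A i1).image (fun x => x - c.cf i1 p1.1)).erase 0 else (L'.map fun p => c.cf k p.1).toFinset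
    refine ⟨L', φ_sub s p1.1 L, IH A' ⟨i1, c.top_lt ht1, fun j hj => ?_, ?_⟩ Y s L' ?_⟩
    · simp only [A', if_pos hj]
    · simp only [A', lt_irrefl, if_false, if_true]
      refine lt_of_lt_of_le (Finset.card_erase_lt_of_mem ?_) Finset.card_image_le
      exact Finset.mem_image.2 ⟨_, hL p1 hp1 i1 hi1' ht1, sub_self _⟩
    · intro q hq i hi hti
      obtain ⟨p, hp, rfl⟩ := List.mem_map.1 hq
      obtain ⟨k, hk, htk⟩ := hf p hp
      have hki := hmin p hp k htk
      rcases lt_trichotomy i1 i with h | h | h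
      · simp only [A', if_pos h]
        have e : ∀ j > i1, c.cf j (p.1 - p1.1) = c.cf j p.1 := fun j hj => by
          rw [c.cf_sub, ht1.2 j hj, sub_zero]
        simp only [e i h]
        refine hL p hp i hi ⟨?_, fun j hj => ?_⟩
        · rw [← e i h]; exact hti.1
        · rw [← e j (by omega)]; exact hti.2 j hj
      · subst h
        simp only [A', lt_irrefl, if_false, if_true]
        refine Finset.mem_erase.2 ⟨hti.1, Finset.mem_image.2 ⟨c.cf i1 p.1, ?_, ?_⟩⟩
        · have : k = i1 := by
            by_contra hne
            have hlt : i1 < k := by omega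
            have h1 := hti.2 k hlt
            simp only [c.cf_sub, ht1.2 k hlt, sub_zero] at h1
            exact htk.1 h1
          subst this
          exact hL p hp _ hi htk
        · exact (c.cf_sub _ _ _).symm
      · simp only [A', if_neg (show ¬ i1 < i by omega), if_neg (show i ≠ i1 by omega)]
        exact List.mem_toFinset.2 (List.mem_map.2 ⟨_, hq, rfl⟩)

end Curve
end WE

namespace WE
universe u
set_option linter.unusedSectionVars false

lemma norm_avg_sq {κ : Type*} {H : Type*} [NormedAddCommGroup H] [NormedSpace ℝ H] (I : Finset κ)
    (x : κ → H) : ‖(I.card : ℝ)⁻¹ • ∑ i ∈ I, x i‖ ^ 2 ≤ (I.card : ℝ)⁻¹ * ∑ i ∈ I, ‖x i‖ ^ 2 := by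
  rcases I.eq_empty_or_nonempty with h | h
  · subst h; simp
  have hc : (0 : ℝ) < I.card := by exact_mod_cast h.card_pos
  rw [norm_smul, mul_pow, norm_inv, RCLike.norm_natCast]
  have h1 : ‖∑ i ∈ I, x i‖ ^ 2 ≤ I.card * ∑ i ∈ I, ‖x i‖ ^ 2 :=
    (pow_le_pow_left₀ (norm_nonneg _) (norm_sum_le _ _) 2).trans sq_sum_le_card_mul_sum_sq
  calc ((I.card : ℝ)⁻¹) ^ 2 * ‖∑ i ∈ I, x i‖ ^ 2
      ≤ ((I.card : ℝ)⁻¹) ^ 2 * (I.card * ∑ i ∈ I, ‖x i‖ ^ 2) := by gcongr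
    _ = _ := by field_simp

namespace Curve
variable {E : Type} [AddCommGroup E] [Module ℝ E] (c : Curve E)
variable {Y : Type u}

lemma Bd.append {A : ℕ → Finset ℝ} {B : Type*} {L L' : List ((E →ₗ[ℝ] ℝ) × B)} (h : c.Bd A L) (h' : c.Bd A L') :
    c.Bd A (L ++ L') := fun p hp => by
  rcases List.mem_append.1 hp with hp | hp
  · exact h p hp
  · exact h' p hp

set_option linter.unusedSectionVars false

/-- Bounded fast lists. -/
def BF (A : ℕ → Finset ℝ) {B : Type*} (L : List ((E →ₗ[ℝ] ℝ) × B)) : Prop :=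
  c.Bd A L ∧ ∀ p ∈ L, c.fast p.1

variable {c}

lemma BF.append {A : ℕ → Finset ℝ} {B : Type*} {L L' : List ((E →ₗ[ℝ] ℝ) × B)} (h : c.BF A L) (h' : c.BF A L') :
    c.BF A (L ++ L') := ⟨Bd.append c h.1 h'.1, fun p hp => by
  rcases List.mem_append.1 hp with hp | hp
  · exact h.2 p hp
  · exact h'.2 p hp⟩

lemma BF.tr {A : ℕ → Finset ℝ} {s : Sys Y} {L : List ((E →ₗ[ℝ] ℝ) × s.A)} (h : c.BF A L) (t : E) :
    c.BF A (s.tr t L) := by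
  refine ⟨fun p hp => ?_, fun p hp => ?_⟩ <;> obtain ⟨q, hq, rfl⟩ := List.mem_map.1 hp
  · exact h.1 q hq
  · exact h.2 q hq

lemma BF.co {A : ℕ → Finset ℝ} {s : Sys Y} {L : List ((E →ₗ[ℝ] ℝ) × s.A)} (h : c.BF A L) (r : ℕ) :
    c.BF A (s.co (c.U ^ r) L) := by
  refine ⟨fun p hp i hi hti => ?_, fun p hp => ?_⟩ <;> obtain ⟨q, hq, rfl⟩ := List.mem_map.1 hp
  · obtain ⟨h1, h2⟩ := c.top_U_iff hti
    simp only [h2]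
    exact h.1 q hq i hi h1
  · exact c.fast_U (h.2 q hq) r

variable (c)

lemma slow_F {s : Sys Y} {Ls : List ((E →ₗ[ℝ] ℝ) × s.A)} (hs : ∀ p ∈ Ls, p.1 ∘ₗ c.π = p.1) (u : E) :
    s.F Ls u = s.F Ls (c.π u) := by
  simp only [Sys.F]
  congr 1
  refine List.map_congr_left fun p hp => ?_
  conv_lhs => rw [← hs p hp]
  rfl

theorem Zcore (A : ℕ → Finset ℝ) (IH : ∀ A', c.Alt A' A → Str.{u} c A') (s : Sys Y)
    (Ls : List ((E →ₗ[ℝ] ℝ) × s.A)) (hs : ∀ p ∈ Ls, p.1 ∘ₗ c.π = p.1)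
    {K : ℝ} (hK0 : 0 ≤ K) (hK : ∀ u y, |(s.F Ls u).1 y| ≤ K)
    (L : List ((E →ₗ[ℝ] ℝ) × s.A)) (hL : c.BF A L) (P P' : Avg E) {η : ℝ} (hη : 0 < η)
    (hP : ∀ u, P.ap (fun v => ‖(P'.map (fun l => l - c.π l)).ap (fun v => s.ι (s.F L v)) v‖ ^ 2) u ≤ η ^ 2) :
    c.NB (fun n => s.ι (s.F (Ls ++ L) (c.u n))) (K * (5 * η)) := by
  classical
  set y : E → s.H := fun v => s.ι (s.F L v) with hy
  have sc : ∀ L' : List ((E →ₗ[ℝ] ℝ) × s.A), c.BF A L' → c.SG (fun u => s.φ (s.F L' u)) :=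
    fun L' h => c.scal A IH s L' h.1 h.2
  set ρ : P'.I → E := fun i => P'.p i - c.π (P'.p i) with hρ
  set G : E → ℝ := fun v => ‖(P'.map (fun l => l - c.π l)).ap y v‖ ^ 2 with hG
  have hGe : ∀ v, G v = ‖(Fintype.card P'.I : ℝ)⁻¹ • ∑ i, y (v + ρ i)‖ ^ 2 := fun v => rfl
  have hGS : c.SG G := by
    have e : G = fun v => ∑ i : P'.I, ∑ j : P'.I, ((Fintype.card P'.I : ℝ)⁻¹ * (Fintype.card P'.I : ℝ)⁻¹) •
        s.φ (s.F (s.tr (ρ i) L ++ s.tr (ρ j) L) v) := by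
      funext v
      rw [hGe, Finset.smul_sum]
      have := normsq_comb s (univ : Finset P'.I) (fun _ => (Fintype.card P'.I : ℝ)⁻¹)
        (fun i => s.F (s.tr (ρ i) L) v)
      simp only [s.F_append, ← this]
      simp only [s.F_tr, hy]
    rw [e]
    exact SG.sum _ fun i _ => SG.sum _ fun j _ => (sc _ ((hL.tr _).append (hL.tr _))).smul _
  have hx : ∀ i : P'.I, ∃ x, ρ i = c.N x := fun i => c.rng (P'.p i)
  choose x hx using hx
  have hnil : IsNilpotent c.N := ⟨c.d, c.Nd⟩
  choose R0 hR0 using fun i : P'.I => claimIII c.N hnil s L (x i) (ε := η ^ 2) (by positivity)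
  set R : ℕ := ∑ i, R0 i + 1 with hR
  have hRi : ∀ i, R0 i ≤ R := fun i => by
    have := Finset.single_le_sum (f := R0) (fun _ _ => Nat.zero_le _) (Finset.mem_univ i)
    omega
  have hRpos : (0 : ℝ) < R := by positivity
  have hD : ∀ i, c.UB (fun n => s.D c.U L (ρ i) R (c.u n)) (η ^ 2) := by
    intro i
    obtain ⟨Q, hQ⟩ := hR0 i R (hRi i)
    rw [← hx i] at hQ
    refine SG.UB ?_ Q hQ
    show c.SG (s.D c.U L (ρ i) R)
    rw [s.D_expand]
    refine SG.sum _ fun j _ => SG.sum _ fun k _ => (sc _ (BF.append (BF.co ?_ _) (BF.co ?_ _))).smul _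
    · split_ifs; exacts [hL.tr _, hL]
    · split_ifs; exacts [hL.tr _, hL]
  -- the averaged function
  set YR : E → s.H := fun v => (R : ℝ)⁻¹ • ∑ r ∈ range R, y ((c.U ^ r) v) with hYR
  have hYsq : c.UB (fun n => ‖YR (c.u n)‖ ^ 2) (4 * η ^ 2) := by
    have hpt : ∀ v, ‖YR v‖ ^ 2 ≤ 2 * ((R : ℝ)⁻¹ * ∑ r ∈ range R, G ((c.U ^ r) v)) +
        2 * ((Fintype.card P'.I : ℝ)⁻¹ * ∑ i ∈ univ, s.D c.U L (ρ i) R v) := by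
      intro v
      set Z : s.H := (R : ℝ)⁻¹ • ∑ r ∈ range R, (Fintype.card P'.I : ℝ)⁻¹ • ∑ i, y ((c.U ^ r) v + ρ i) with hZ
      set D : s.H := (Fintype.card P'.I : ℝ)⁻¹ • ∑ i, (R : ℝ)⁻¹ • ∑ r ∈ range R,
        (y ((c.U ^ r) v + ρ i) - y ((c.U ^ r) v)) with hDd
      have e : YR v = Z - D := by
        have e1 : D = Z - (Fintype.card P'.I : ℝ)⁻¹ • ∑ _i : P'.I, YR v := by
          rw [hDd, hZ]
          simp only [Finset.sum_sub_distrib, smul_sub, hYR]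
          congr 1
          simp only [Finset.smul_sum]
          rw [Finset.sum_comm]
          refine Finset.sum_congr rfl fun r _ => Finset.sum_congr rfl fun i _ => smul_comm _ _ _
        rw [e1, Finset.sum_const, Finset.card_univ, ← Nat.cast_smul_eq_nsmul ℝ, smul_smul,
          inv_mul_cancel₀ P'.card_pos.ne', one_smul]
        abel
      have h1 : ‖Z‖ ^ 2 ≤ (R : ℝ)⁻¹ * ∑ r ∈ range R, G ((c.U ^ r) v) := by
        have := norm_avg_sq (range R) fun r => (Fintype.card P'.I : ℝ)⁻¹ • ∑ i, y ((c.U ^ r) v + ρ i)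
        rw [Finset.card_range] at this
        exact this
      have h2 : ‖D‖ ^ 2 ≤ (Fintype.card P'.I : ℝ)⁻¹ * ∑ i ∈ univ, s.D c.U L (ρ i) R v := by
        have := norm_avg_sq (univ : Finset P'.I) fun i => (R : ℝ)⁻¹ • ∑ r ∈ range R,
          (y ((c.U ^ r) v + ρ i) - y ((c.U ^ r) v))
        rw [Finset.card_univ] at this
        exact this
      have h3 : ‖YR v‖ ≤ ‖Z‖ + ‖D‖ := by rw [e]; exact norm_sub_le _ _
      nlinarith [norm_nonneg (YR v), norm_nonneg Z, norm_nonneg D, sq_nonneg (‖Z‖ - ‖D‖)]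
    have u1 : c.UB (fun n => 2 * ((R : ℝ)⁻¹ * ∑ r ∈ range R, G ((c.U ^ r) (c.u n)))) (2 * ((R : ℝ)⁻¹ * ∑ r ∈ range R, η ^ 2)) :=
      ((Wt.UB.sum (range R) fun r _ => hGS.UB_U P hP r).smul (by positivity)).smul (by norm_num)
    have u2 : c.UB (fun n => 2 * ((Fintype.card P'.I : ℝ)⁻¹ * ∑ i ∈ univ, s.D c.U L (ρ i) R (c.u n)))
        (2 * ((Fintype.card P'.I : ℝ)⁻¹ * ∑ i ∈ (univ : Finset P'.I), η ^ 2)) :=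
      ((Wt.UB.sum univ fun i _ => hD i).smul (by positivity)).smul (by norm_num)
    refine ((u1.add u2).of_le fun n => hpt _).mono' (le_of_eq ?_)
    have := P'.card_pos
    simp only [Finset.sum_const, Finset.card_univ, Finset.card_range, nsmul_eq_mul]
    field_simp
    ring
  have hYn : c.UB (fun n => ‖s.M (s.F Ls (c.u n)) (YR (c.u n))‖) (K * (5 * η)) := by
    have h1 : c.UB (fun n => K * (η + η⁻¹ * ‖YR (c.u n)‖ ^ 2)) (K * (η + η⁻¹ * (4 * η ^ 2))) :=
      (((Wt.UB.const η).add (hYsq.smul (by positivity)))).smul hK0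
    refine (h1.of_le fun n => ?_).mono' (le_of_eq (by field_simp; ring))
    refine (s.norm_M_le hK0 (hK _) _).trans ?_
    gcongr
    set z := ‖YR (c.u n)‖
    have : 0 ≤ η⁻¹ * (z - η) ^ 2 := by positivity
    have e : η⁻¹ * (z - η) ^ 2 = η⁻¹ * z ^ 2 - 2 * z + η := by field_simp; ring
    have hz : 0 ≤ z := norm_nonneg _
    linarith
  have hX : c.NB (fun n => s.ι (s.F (Ls ++ L) (c.u n)) - s.M (s.F Ls (c.u n)) (YR (c.u n))) 0 := by
    obtain ⟨C, hC0, hC⟩ := s.F_norm_bdd (Ls ++ L)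
    have h1 : ∀ r, c.NB (fun n => s.ι (s.F (Ls ++ L) (c.u n)) - s.M (s.F Ls (c.u n)) (y ((c.U ^ r) (c.u n)))) 0 := by
      intro r
      have a1 := Wt.NB.shift_add (c := c.toWt) (x := fun n => s.ι (s.F (Ls ++ L) (c.u n))) (fun n => hC _) r
      have a2 := Wt.NB.of_tendsto (c := c.toWt) (s.F_tendsto (Ls ++ L) (fun n => c.u (n + r))
        (fun n => (c.U ^ r) (c.u n)) fun p _ => c.u_add r p.1)
      have := a2.sub a1
      rw [add_zero] at this
      convert this using 2 with n
      have e : s.ι (s.F (Ls ++ L) ((c.U ^ r) (c.u n))) = s.M (s.F Ls (c.u n)) (y ((c.U ^ r) (c.u n))) := by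
        rw [s.F_append, hy, s.M_ι, c.slow_F hs ((c.U ^ r) (c.u n)), c.π_U, ← c.slow_F hs]
      rw [e]; abel
    have h2 := (Wt.NB.sum (range R) fun r _ => h1 r).smul (R : ℝ)⁻¹
    convert h2 using 2 with n
    rw [Finset.sum_sub_distrib, smul_sub, Finset.sum_const, Finset.card_range, ← Nat.cast_smul_eq_nsmul ℝ,
      smul_smul, inv_mul_cancel₀ hRpos.ne', one_smul, hYR]
    simp only [map_smul, map_sum]
  have := hX.add (Wt.NB.of_UB hYn)
  rw [zero_add] at this
  convert this using 2
  abel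

end Curve
end WE

namespace WE
universe u
set_option linter.unusedSectionVars false

lemma Avg.ap_trans {E : Type} [AddCommGroup E] {H : Type*} [NormedAddCommGroup H] [NormedSpace ℝ H]
    (P : Avg E) (F : E → H) (t u : E) : P.ap (fun v => F (v + t)) u = P.ap F (u + t) := by
  simp only [Avg.ap]
  congr 1
  refine Finset.sum_congr rfl fun i _ => ?_
  rw [add_right_comm]

namespace Curve
variable {E : Type} [AddCommGroup E] [Module ℝ E] (c : Curve E)
variable {Y : Type u}

lemma gd_slow (s : Sys Y) (L : List ((E →ₗ[ℝ] ℝ) × s.A)) (hs : ∀ p ∈ L, p.1 ∘ₗ c.π = p.1) :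
    c.gd (fun u => s.ι (s.F L u)) := by
  obtain ⟨C, -, hC⟩ := s.F_norm_bdd L
  obtain ⟨K, hK0, hK⟩ := s.F_lip L
  intro t
  have h := Wt.NB.slow (c := c.toWt) (ψ := fun x => s.ι (s.F L (x • c.e0))) (C := C)
    (K := K * (L.map fun p => |p.1 c.e0|).sum) (fun x => hC _) (fun x y => ?_) (c.c0 t)
  · convert h using 2 with n
    beta_reduce
    rw [c.slow_F hs (c.u n), c.slow_F hs (c.u n + t), c.π_apply, c.π_apply, map_add, c.c0_u]
  · refine (hK _ _).trans (le_of_eq ?_)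
    rw [mul_assoc, ← List.sum_map_mul_right]
    congr 2
    refine List.map_congr_left fun p _ => ?_
    rw [← sub_smul, map_smul, smul_eq_mul, abs_mul, mul_comm]

theorem str_aux (A : ℕ → Finset ℝ) (IH : ∀ A', c.Alt A' A → Str.{u} c A') (fs : List (E →ₗ[ℝ] ℝ)) :
    (∀ l ∈ fs, (∀ i ≥ 1, c.top i l → c.cf i l ∈ A i) ∧ c.fast l) →
    ∀ (Y : Type u) (s : Sys Y)
    (L1 L2 : List ((E →ₗ[ℝ] ℝ) × s.A)), (∀ p ∈ L1, p.1 ∘ₗ c.π = p.1) →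
    L2.map Prod.fst = fs → c.gd (fun u => s.ι (s.F (L1 ++ L2) u)) := by
  induction fs with
  | nil =>
    intro _ Y s L1 L2 h1 h2
    have : L2 = [] := by simpa using h2
    subst this
    rw [List.append_nil]
    exact c.gd_slow s L1 h1
  | cons l0 fs ih =>
    intro hfs Y s L1 L2 h1 h2
    match L2, h2 with
    | [], h2 => simp at h2
    | (l, a) :: rest, h2 =>
      have hBF : ∀ a' : s.A, c.BF A ((l, a') :: rest) := by
        intro a'
        have : ((l, a') :: rest).map Prod.fst = l0 :: fs := by simpa using h2
        refine ⟨fun p hp => ?_, fun p hp => ?_⟩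
        · exact (hfs p.1 (this ▸ List.mem_map_of_mem hp)).1
        · exact (hfs p.1 (this ▸ List.mem_map_of_mem hp)).2
      simp only [List.map_cons, List.cons.injEq] at h2
      obtain ⟨rfl, h3⟩ := h2
      refine structLemma c.gp c.π c.π_π s L1 h1 l rest
        (fun Y' s' M1 M2 hM1 hM2 => ih (fun l hl => hfs l (by simp [hl])) Y' s' M1 M2 hM1 (hM2.trans h3)) ?_ a
      intro F hF
      show c.gd F
      obtain ⟨C, hC0, hC⟩ := s.F_bdd L1
      intro t
      refine Wt.NB.of_forall fun ε hε => ?_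
      rw [zero_add]
      set η := ε / 20 / (C + 1) with hη
      have hη0 : 0 < η := by positivity
      have hη1 : C * (5 * η) ≤ ε / 4 := by
        have : C * η ≤ ε / 20 := by
          rw [hη, mul_div_assoc', div_le_iff₀ (by positivity)]; nlinarith
        linarith
      obtain ⟨a, P, P', hFa, hPP⟩ := hF (min (ε / 4) (η ^ 2)) (by positivity)
      have hPP1 := fun u => (hPP u).trans (min_le_right _ _)
      have b1 := c.Zcore A IH s L1 h1 hC0 hC _ (hBF a) P P' hη0 hPP1
      have hs' : ∀ p ∈ s.tr t L1, p.1 ∘ₗ c.π = p.1 := by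
        intro p hp
        obtain ⟨q, hq, rfl⟩ := List.mem_map.1 hp
        exact h1 q hq
      have b2 := c.Zcore A IH s (s.tr t L1) hs' hC0 (fun u y => by rw [s.F_tr]; exact hC _ y)
        _ ((hBF a).tr t) P P' hη0 (fun u => by
          have := hPP1 (u + t)
          simp only [s.F_tr]
          rw [← Avg.ap_trans] at this
          simp only [← Avg.ap_trans] at this
          exact this)
      have e : ∀ u, s.F (s.tr t L1 ++ s.tr t ((l, a) :: rest)) u = s.F (L1 ++ (l, a) :: rest) (u + t) := by
        intro u; rw [s.F_append, s.F_tr, s.F_tr, s.F_append]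
      simp only [e] at b2
      have b3 : c.NB (fun n => (F (c.u n + t) - s.ι (s.F (L1 ++ (l, a) :: rest) (c.u n + t))) -
          (F (c.u n) - s.ι (s.F (L1 ++ (l, a) :: rest) (c.u n)))) (ε / 2) :=
        Wt.NB.of_bound fun n => (norm_sub_le _ _).trans (by
          have x1 := (hFa (c.u n + t)).trans (min_le_left _ _)
          have x2 := (hFa (c.u n)).trans (min_le_left _ _)
          linarith)
      have := (b3.add (b2.sub b1)).mono' (B' := ε) (by linarith)
      convert this using 2
      abel

theorem str : ∀ A : ℕ → Finset ℝ, Str.{u} c A := by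
  classical
  intro A
  induction A using c.Alt_wf.induction with
  | _ A IH =>
    intro Y s L hL
    have hp := List.filter_append_perm (fun p : (E →ₗ[ℝ] ℝ) × s.A => decide (¬ c.fast p.1)) L
    have e : (fun u => s.ι (s.F L u)) = fun u => s.ι (s.F (L.filter (fun p => decide (¬ c.fast p.1)) ++
        L.filter (fun p => !decide (¬ c.fast p.1))) u) := by
      funext u; rw [s.F_perm hp]
    rw [e]
    refine c.str_aux A IH _ ?_ Y s _ _ ?_ rfl
    · intro l hl
      obtain ⟨p, hp, rfl⟩ := List.mem_map.1 hl
      simp only [List.mem_filter] at hp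
      exact ⟨hL p hp.1, by simpa using hp.2⟩
    · intro p hp
      simp only [List.mem_filter] at hp
      exact c.slow_of_not_fast (by simpa using hp.2)

theorem gd_all (s : Sys Y) (L : List ((E →ₗ[ℝ] ℝ) × s.A)) : c.gd (fun u => s.ι (s.F L u)) := by
  classical
  refine c.str (fun i => (L.map fun p => c.cf i p.1).toFinset) Y s L fun p hp i _ _ => ?_
  exact List.mem_toFinset.2 (List.mem_map.2 ⟨p, hp, rfl⟩)

/-- Output (a). -/
theorem out_a (s : Sys Y) (L : List ((E →ₗ[ℝ] ℝ) × s.A)) (P : Avg E) :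
    Tendsto (fun N : ℕ => (N : ℝ)⁻¹ • ∑ n ∈ range N, (P.ap (fun u => s.ι (s.F L u)) (c.u n) - s.ι (s.F L (c.u n))))
      atTop (nhds 0) := by
  obtain ⟨C, -, hC⟩ := s.F_norm_bdd L
  refine Wt.NB.cesaro (c := c.toWt) (C := C + C) (fun n => (norm_sub_le _ _).trans
    (add_le_add (P.norm_ap_le _ hC) (hC _))) ?_
  have hs : c.NB (fun n => (Fintype.card P.I : ℝ)⁻¹ • ∑ i ∈ univ, (s.ι (s.F L (c.u n + P.p i)) - s.ι (s.F L (c.u n)))) 0 :=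
    (Wt.NB.sum univ fun i _ => c.gd_all s L (P.p i)).smul _
  convert hs using 2 with n
  rw [Finset.sum_sub_distrib, smul_sub, Finset.sum_const, Finset.card_univ, ← Nat.cast_smul_eq_nsmul ℝ,
    smul_smul, inv_mul_cancel₀ P.card_pos.ne', one_smul]
  rfl

/-- Output (b). -/
theorem out_b (s : Sys Y) (L : List ((E →ₗ[ℝ] ℝ) × s.A)) :
    CauchySeq (fun N : ℕ => (N : ℝ)⁻¹ • ∑ n ∈ range N, s.ι (s.F L (c.u n))) := by
  rw [Metric.cauchySeq_iff']
  intro ε hε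
  obtain ⟨P, hP⟩ := step1 s L (ε / 8) (by positivity)
  have ha := c.out_a s L P
  rw [Metric.tendsto_atTop] at ha
  obtain ⟨N0, hN0⟩ := ha (ε / 8) (by positivity)
  set z := P.ap (fun u => s.ι (s.F L u)) 0
  have key : ∀ N ≥ max N0 1, ‖(N : ℝ)⁻¹ • ∑ n ∈ range N, s.ι (s.F L (c.u n)) - z‖ ≤ ε / 4 := by
    intro N hN
    have h1 := hN0 N ((le_max_left _ _).trans hN)
    rw [dist_zero_right] at h1
    have hNpos : (0 : ℝ) < N := by exact_mod_cast (le_max_right N0 1).trans hN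
    have h2 : ‖(N : ℝ)⁻¹ • ∑ n ∈ range N, (P.ap (fun u => s.ι (s.F L u)) (c.u n) - z)‖ ≤ ε / 8 := by
      rw [norm_smul, norm_inv, RCLike.norm_natCast, inv_mul_le_iff₀ hNpos]
      refine (norm_sum_le _ _).trans ((Finset.sum_le_sum fun n _ => hP (c.u n) 0).trans ?_)
      simp
    have e : (N : ℝ)⁻¹ • ∑ n ∈ range N, s.ι (s.F L (c.u n)) - z =
        (N : ℝ)⁻¹ • ∑ n ∈ range N, (P.ap (fun u => s.ι (s.F L u)) (c.u n) - z) -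
        (N : ℝ)⁻¹ • ∑ n ∈ range N, (P.ap (fun u => s.ι (s.F L u)) (c.u n) - s.ι (s.F L (c.u n))) := by
      rw [← smul_sub, ← Finset.sum_sub_distrib]
      have : z = (N : ℝ)⁻¹ • ∑ n ∈ range N, z := by
        rw [Finset.sum_const, Finset.card_range, ← Nat.cast_smul_eq_nsmul ℝ, smul_smul,
          inv_mul_cancel₀ hNpos.ne', one_smul]
      conv_lhs => rw [this]
      rw [← smul_sub, ← Finset.sum_sub_distrib]
      congr 1
      refine Finset.sum_congr rfl fun n _ => ?_
      abel
    rw [e]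
    refine (norm_sub_le _ _).trans (by linarith)
  refine ⟨max N0 1, fun N hN => ?_⟩
  rw [dist_eq_norm]
  have h1 := key N hN
  have h2 := key (max N0 1) le_rfl
  have := norm_sub_le_norm_sub_add_norm_sub
    ((N : ℝ)⁻¹ • ∑ n ∈ range N, s.ι (s.F L (c.u n))) z
    (((max N0 1 : ℕ) : ℝ)⁻¹ • ∑ n ∈ range (max N0 1), s.ι (s.F L (c.u n)))
  rw [norm_sub_rev z] at this
  linarith

end Curve
end WE

namespace WE
universe u
set_option linter.unusedSectionVars false

lemma ddIter_dd (f : ℕ → ℝ) (k : ℕ) : ddIter (dd f) k = ddIter f (k + 1) := by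
  induction k with
  | zero => rfl
  | succ k ih => show dd (ddIter (dd f) k) = dd (ddIter f (k + 1)); rw [ih]

lemma memF_inF1 (ℓ : ℕ) : ∀ f, memF ℓ f → inF1 (ddIter f ℓ) := by
  induction ℓ with
  | zero => intro f h; exact h
  | succ ℓ ih => intro f h; rw [← ddIter_dd]; exact ih _ h

/-- The lower shift. -/
noncomputable def shiftN (ℓ : ℕ) : Module.End ℝ (Fin (ℓ + 1) → ℝ) :=
  LinearMap.pi (Fin.cases 0 fun i : Fin ℓ => LinearMap.proj i.castSucc)

@[simp] lemma shiftN_zero (ℓ : ℕ) (v : Fin (ℓ + 1) → ℝ) : shiftN ℓ v 0 = 0 := by simp [shiftN]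
@[simp] lemma shiftN_succ (ℓ : ℕ) (v : Fin (ℓ + 1) → ℝ) (i : Fin ℓ) : shiftN ℓ v i.succ = v i.castSucc := by
  simp [shiftN]

lemma shiftN_pow (ℓ k : ℕ) (v : Fin (ℓ + 1) → ℝ) : ∀ i : Fin (ℓ + 1), (i : ℕ) < k → (shiftN ℓ ^ k) v i = 0 := by
  induction k with
  | zero => intro i hi; omega
  | succ k ih =>
    intro i
    rw [pow_succ', Module.End.mul_apply]
    refine Fin.cases (fun _ => by simp) (fun j hj => ?_) i
    rw [shiftN_succ]
    refine ih _ ?_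
    simp only [Fin.val_succ] at hj
    simp only [Fin.val_castSucc]
    omega

theorem exists_curve (ℓ : ℕ) (f : ℕ → ℝ) (hf : memF ℓ f)
    (hf2 : Tendsto (fun n : ℕ => (n : ℝ) * ddIter f (ℓ + 1) n) atTop atTop) :
    ∃ (c : Curve (Fin (ℓ + 1) → ℝ)) (lam : (Fin (ℓ + 1) → ℝ) →ₗ[ℝ] ℝ) (m : ℕ),
      (∀ n, lam (c.u n) = f (n + m)) ∧ ∃ v, lam v = 1 := by
  obtain ⟨h1, h2, n1, h3⟩ := memF_inF1 ℓ f hf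
  have hpos : ∀ᶠ n : ℕ in atTop, 0 < ddIter f (ℓ + 1) n := by
    filter_upwards [hf2.eventually_gt_atTop 0] with n hn
    by_contra hle
    have : (n : ℝ) * ddIter f (ℓ + 1) n ≤ 0 := mul_nonpos_of_nonneg_of_nonpos (by positivity) (not_lt.1 hle)
    linarith
  obtain ⟨n2, h4⟩ := eventually_atTop.1 hpos
  set m := n1 + n2 + 1 with hm
  let D : ℕ → ℕ → ℝ := fun i n => ddIter f i (n + i + m)
  have hD : ∀ i n, D i (n + 1) = D i n + D (i + 1) n := by
    intro i n
    have : D (i + 1) n = ddIter f i (n + (i + 1) + m) - ddIter f i (n + (i + 1) + m - 1) := by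
      show dd (ddIter f i) _ = _
      rw [dd, if_neg (by omega)]
    rw [this]
    have e1 : n + (i + 1) + m - 1 = n + i + m := by omega
    have e2 : n + 1 + i + m = n + (i + 1) + m := by omega
    simp only [D, e1, e2]; ring
  have hsh : Tendsto (fun n : ℕ => n + (ℓ + 1) + m) atTop atTop :=
    tendsto_atTop_mono (fun n => by omega : ∀ n : ℕ, n ≤ n + (ℓ + 1) + m) tendsto_id
  have hsh' : Tendsto (fun n : ℕ => n + ℓ + m) atTop atTop :=
    tendsto_atTop_mono (fun n => by omega : ∀ n : ℕ, n ≤ n + ℓ + m) tendsto_id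
  have hw : Tendsto (D (ℓ + 1)) atTop (nhds 0) := h2.comp hsh
  have hnw : Tendsto (fun n : ℕ => (n : ℝ) * D (ℓ + 1) n) atTop atTop := by
    have a1 := hf2.comp hsh
    have a2 : Tendsto (fun n => -(((ℓ : ℝ) + 1 + m) * D (ℓ + 1) n)) atTop (nhds (-(((ℓ : ℝ) + 1 + m) * 0))) :=
      (hw.const_mul _).neg
    have := a1.atTop_add a2
    convert this using 2 with n
    simp only [Function.comp, D]
    push_cast
    ring
  let c : Curve (Fin (ℓ + 1) → ℝ) :=
    { w := D (ℓ + 1)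
      W := D ℓ
      W_succ := hD ℓ
      pos := fun n => h4 _ (by omega)
      anti := fun a b hab => h3 _ _ (by omega) (by omega)
      w_lim := hw
      W_lim := h1.comp hsh'
      nw_lim := hnw
      N := shiftN ℓ
      d := ℓ + 1
      Nd := by
        refine LinearMap.ext fun v => funext fun i => ?_
        exact shiftN_pow ℓ (ℓ + 1) v i i.2
      e0 := Pi.single 0 1
      c0 := LinearMap.proj 0
      c0_e0 := by simp
      c0_N := fun v => by simp
      rng := fun v => by
        refine ⟨Fin.snoc (fun i : Fin ℓ => v i.succ) 0, funext fun i => ?_⟩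
        refine Fin.cases ?_ (fun j => ?_) i
        · simp
        · simp [Fin.succ_ne_zero]
      u := fun n i => D (ℓ - i) n
      u_succ := fun n => by
        funext i
        refine Fin.cases ?_ (fun j => ?_) i
        · simp [hD]
        · have : ℓ - (j : ℕ) = ℓ - (j + 1) + 1 := by omega
          simp [hD, this, Fin.succ_ne_zero]
      c0_u := fun n => by simp }
  refine ⟨c, LinearMap.proj (Fin.last ℓ), m, fun n => ?_, Pi.single (Fin.last ℓ) 1, by simp⟩
  simp [c, D, ddIter]

end WE

namespace WE
universe u
set_option linter.unusedSectionVars false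

section base
variable {X : Type u}

/-- The translation flow on `X × ℝ`. -/
def bFlow (X : Type u) : Flow (X × ℝ) where
  S t y := (y.1, y.2 + t)
  zero y := by simp
  add a b y := by ext <;> simp; ring

variable [MeasurableSpace X] (μ : Measure X) [IsProbabilityMeasure μ] (T : X → X)

/-- Equivariant measurable functions. -/
def bV : Subalgebra ℝ (bFlow X).alg where
  carrier := {a | Measurable a.1 ∧ ∀ x s, a.1 (T x, s) = a.1 (x, s + 1)}
  mul_mem' := by
    rintro a b ⟨h1, h2⟩ ⟨h3, h4⟩
    refine ⟨h1.mul h3, fun x s => ?_⟩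
    show a.1 _ * b.1 _ = a.1 _ * b.1 _
    rw [h2, h4]
  add_mem' := by
    rintro a b ⟨h1, h2⟩ ⟨h3, h4⟩
    refine ⟨h1.add h3, fun x s => ?_⟩
    show a.1 _ + b.1 _ = a.1 _ + b.1 _
    rw [h2, h4]
  algebraMap_mem' := by
    intro r
    exact ⟨measurable_const, fun x s => rfl⟩

variable {T}

lemma bV_act {a : (bFlow X).alg} (h : a ∈ bV T) (t : ℝ) : (bFlow X).act t a ∈ bV T := by
  refine ⟨?_, fun x s => ?_⟩
  · exact h.1.comp (measurable_fst.prodMk (measurable_snd.add_const t))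
  · show a.1 (T x, s + t) = a.1 (x, s + 1 + t)
    rw [h.2, add_right_comm]

/-- Fibre integral. -/
noncomputable def bI (a : (bFlow X).alg) (s : ℝ) : ℝ := ∫ x, a.1 (x, s) ∂μ

lemma b_int {a : (bFlow X).alg} (h : Measurable a.1) (s : ℝ) :
    Integrable (fun x => a.1 (x, s)) μ := by
  obtain ⟨⟨C, hC⟩, -⟩ := a.2
  refine Integrable.of_bound (h.comp (measurable_id.prodMk measurable_const)).aestronglyMeasurable C
    (Eventually.of_forall fun x => hC _)

lemma bI_cont {a : (bFlow X).alg} (h : Measurable a.1) : Continuous (bI μ a) := by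
  obtain ⟨K, hK⟩ := a.2.2
  have : LipschitzWith (Real.toNNReal |K|) (bI μ a) := by
    refine LipschitzWith.of_dist_le_mul fun s t => ?_
    rw [Real.dist_eq, Real.dist_eq, bI, bI, ← integral_sub (b_int μ h s) (b_int μ h t), Real.coe_toNNReal _ (abs_nonneg _)]
    have := norm_integral_le_of_norm_le_const (μ := μ) (f := fun x => a.1 (x, s) - a.1 (x, t)) (C := |K| * |s - t|)
      (Eventually.of_forall fun x => ?_)
    · simpa using this
    · have := hK (s - t) (x, t)
      simp only [bFlow, add_sub_cancel] at this
      exact this.trans (by gcongr; exact le_abs_self K)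
  exact this.continuous

/-- The state on equivariant functions. -/
noncomputable def b0 : bV T →ₗ[ℝ] ℝ where
  toFun a := ∫ s in (0 : ℝ)..1, bI μ a.1 s
  map_add' a b := by
    rw [← intervalIntegral.integral_add ((bI_cont μ a.2.1).intervalIntegrable _ _) ((bI_cont μ b.2.1).intervalIntegrable _ _)]
    congr 1; funext s
    exact integral_add (b_int μ a.2.1 s) (b_int μ b.2.1 s)
  map_smul' r a := by
    rw [RingHom.id_apply, smul_eq_mul, ← intervalIntegral.integral_const_mul]
    congr 1; funext s
    exact integral_const_mul r _

lemma b0_act (hT : MeasurePreserving T μ μ) (a : bV T) (t : ℝ) :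
    b0 μ ⟨(bFlow X).act t a.1, bV_act a.2 t⟩ = b0 μ a := by
  have hper : Function.Periodic (bI μ a.1) 1 := by
    intro s
    rw [bI, bI]
    simp only [← a.2.2]
    have hm : AEStronglyMeasurable (fun x => a.1.1 (x, s)) (Measure.map T μ) := by
      rw [hT.map_eq]; exact (b_int μ a.2.1 s).aestronglyMeasurable
    have := integral_map hT.measurable.aemeasurable hm
    rw [hT.map_eq] at this
    exact this.symm
  have e : b0 μ ⟨(bFlow X).act t a.1, bV_act a.2 t⟩ = ∫ s in (0 : ℝ)..1, bI μ a.1 (s + t) := rfl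
  rw [e, intervalIntegral.integral_comp_add_right (fun s => bI μ a.1 s)]
  have := hper.intervalIntegral_add_eq t 0
  rw [zero_add] at this ⊢
  rw [add_comm 1 t, this]
  rfl

lemma b0_nonneg (a : bV T) (h : ∀ y, 0 ≤ a.1.1 y) : 0 ≤ b0 μ a :=
  intervalIntegral.integral_nonneg (by norm_num) fun s _ => integral_nonneg fun x => h _

lemma b0_one : b0 μ (1 : bV T) = 1 := by
  have : b0 μ (1 : bV T) = ∫ s in (0 : ℝ)..1, ∫ x : X, (1 : ℝ) ∂μ := rfl
  rw [this]; simp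

theorem exists_base (hT : MeasurePreserving T μ μ) :
    ∃ φ : (bFlow X).alg →ₗ[ℝ] ℝ, φ 1 = 1 ∧ (∀ a : (bFlow X).alg, (∀ y, 0 ≤ a.1 y) → 0 ≤ φ a) ∧
      (∀ t a, φ ((bFlow X).act t a) = φ a) ∧ ∀ a : bV T, φ a.1 = b0 μ a := by
  let K : PointedCone ℝ (bFlow X).alg :=
    { carrier := {a | ∀ y, 0 ≤ a.1 y}
      add_mem' := fun {a b} ha hb y => add_nonneg (ha y) (hb y)
      zero_mem' := fun y => le_rfl
      smul_mem' := fun c a ha y => mul_nonneg c.2 (ha y) }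
  let f : (bFlow X).alg →ₗ.[ℝ] ℝ := ⟨Subalgebra.toSubmodule (bV T), b0 μ⟩
  obtain ⟨ψ, h1, h2⟩ := riesz_extension K f (fun a ha => b0_nonneg μ a ha) (fun a => by
    obtain ⟨⟨C, hC⟩, -⟩ := a.2
    refine ⟨⟨algebraMap ℝ _ C, (bV T).algebraMap_mem C⟩, fun y => ?_⟩
    show 0 ≤ C + a.1 y
    linarith [(abs_le.1 (hC y)).1])
  obtain ⟨m, -, hm⟩ := single_mean (E := ℝ) (fun _ => 0) ⟨0, fun _ => by simp⟩
  have hψ : ∀ a : (bFlow X).alg, Bdd (fun t => ψ ((bFlow X).act t a)) := by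
    intro a
    obtain ⟨⟨C, hC⟩, -⟩ := a.2
    have e1 : ∀ D : ℝ, ψ (algebraMap ℝ _ D) = D * ψ 1 := fun D => by
      rw [Algebra.algebraMap_eq_smul_one, map_smul, smul_eq_mul]
    refine ⟨C * ψ 1, fun t => abs_le.2 ⟨?_, ?_⟩⟩
    · have := h2 ((bFlow X).act t a + algebraMap ℝ _ C) (fun y => by
        show 0 ≤ a.1 _ + C
        linarith [(abs_le.1 (hC ((bFlow X).S t y))).1])
      rw [map_add, e1] at this; linarith
    · have := h2 (algebraMap ℝ _ C - (bFlow X).act t a) (fun y => by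
        show 0 ≤ C - a.1 _
        linarith [(abs_le.1 (hC ((bFlow X).S t y))).2])
      rw [map_sub, e1] at this; linarith
  have h3 : ∀ a : bV T, ψ a.1 = b0 μ a := fun a => h1 a
  have h4 : ∀ a : bV T, m.m (fun t => ψ ((bFlow X).act t a.1)) = b0 μ a := by
    intro a
    have : (fun t => ψ ((bFlow X).act t a.1)) = fun _ => b0 μ a := by
      funext t
      exact (h3 ⟨_, bV_act a.2 t⟩).trans (b0_act μ hT a t)
    rw [this, m.const]
  refine ⟨{ toFun := fun a => m.m (fun t => ψ ((bFlow X).act t a))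
            map_add' := fun a b => by
              rw [← map_add]; congr 1; funext t; simp
            map_smul' := fun r a => by
              rw [RingHom.id_apply, ← map_smul]; congr 1; funext t; simp }, (h4 1).trans (b0_one μ),
    fun a ha => m.nonneg _ (hψ a) fun t => h2 _ fun y => ha _, fun q a => ?_, h4⟩
  show m.m (fun t => ψ ((bFlow X).act t ((bFlow X).act q a))) = m.m (fun t => ψ ((bFlow X).act t a))
  have := hm q _ (hψ a)
  simpa only [Flow.act_act] using this

end base
end WE

namespace WE
universe u
set_option linter.unusedSectionVars false

/-- Distance to the nearest integer. -/
noncomputable def nd (s : ℝ) : ℝ := |s - round s|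

lemma nd_nonneg (s : ℝ) : 0 ≤ nd s := abs_nonneg _

lemma nd_le (s : ℝ) (z : ℤ) : nd s ≤ |s - z| := round_le s z

lemma nd_add_le (s t : ℝ) : nd (s + t) ≤ nd s + |t| := by
  refine (nd_le (s + t) (round s)).trans ?_
  rw [show s + t - (round s : ℝ) = (s - round s) + t by ring]
  exact abs_add_le _ _

lemma nd_lip (s t : ℝ) : |nd (s + t) - nd s| ≤ |t| := by
  rw [abs_le]
  have h1 := nd_add_le s t
  have h2 := nd_add_le (s + t) (-t)
  rw [add_neg_cancel_right, abs_neg] at h2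
  constructor <;> linarith

lemma nd_add_one (s : ℝ) : nd (s + 1) = nd s := by
  unfold nd
  rw [round_add_one]; push_cast; congr 1; ring

lemma nd_cont : Continuous nd := by
  have : LipschitzWith 1 nd := by
    refine LipschitzWith.of_dist_le_mul fun s t => ?_
    have := nd_lip t (s - t)
    rw [add_sub_cancel] at this
    simpa [Real.dist_eq] using this
  exact this.continuous

lemma floor_near {s a d : ℝ} (h0 : 0 ≤ s) (h1 : s ≤ d) (h2 : d ≤ nd (s + a)) : ⌊s + a⌋ = ⌊a⌋ := by
  rw [Int.floor_eq_iff]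
  refine ⟨(Int.floor_le a).trans (by linarith), ?_⟩
  by_contra hc
  push Not at hc
  have h3 := nd_le (s + a) (⌊a⌋ + 1)
  push_cast at h3
  rw [abs_of_nonneg (by linarith)] at h3
  linarith [Int.lt_floor_add_one a]

/-- Cutoff vanishing at integers. -/
noncomputable def psi (K : ℕ) (s : ℝ) : ℝ := min 1 (2 * K * nd s)

/-- Cutoff supported near integers. -/
noncomputable def chi (K : ℕ) (s : ℝ) : ℝ := max 0 (min 1 (2 - 2 * K * nd s))

lemma psi_nonneg (K : ℕ) (s : ℝ) : 0 ≤ psi K s :=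
  le_min zero_le_one (mul_nonneg (by positivity) (nd_nonneg s))

lemma psi_le_one (K : ℕ) (s : ℝ) : psi K s ≤ 1 := min_le_left _ _

lemma psi_lip (K : ℕ) (s t : ℝ) : |psi K (s + t) - psi K s| ≤ 2 * K * |t| := by
  unfold psi
  refine (abs_min_sub_min_le_max _ _ _ _).trans (max_le ?_ ?_)
  · simp; positivity
  · rw [← mul_sub, abs_mul, abs_of_nonneg (show (0 : ℝ) ≤ 2 * K by positivity)]
    exact mul_le_mul_of_nonneg_left (nd_lip s t) (by positivity)

lemma psi_lt_of_floor {K : ℕ} {s t : ℝ} (h : ⌊s + t⌋ ≠ ⌊s⌋) : psi K s ≤ 2 * K * |t| := by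
  refine (min_le_right _ _).trans ?_
  gcongr
  rcases lt_or_gt_of_ne h with h | h
  · refine (nd_le s ⌊s⌋).trans ?_
    have h1 : s + t < ⌊s⌋ := by rwa [← Int.floor_lt]
    have h2 := Int.floor_le s
    rw [abs_of_nonneg (by linarith)]
    rw [abs_of_neg (by linarith)]; linarith
  · refine (nd_le s ⌊s + t⌋).trans ?_
    have h1 : s < ⌊s + t⌋ := by rwa [← Int.floor_lt]
    have h2 := Int.floor_le (s + t)
    rw [abs_of_neg (by linarith)]
    rw [abs_of_pos (by linarith)]; linarith

lemma chi_nonneg (K : ℕ) (s : ℝ) : 0 ≤ chi K s := le_max_left _ _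

lemma chi_le_one (K : ℕ) (s : ℝ) : chi K s ≤ 1 := max_le zero_le_one (min_le_left _ _)

lemma chi_lip (K : ℕ) (s t : ℝ) : |chi K (s + t) - chi K s| ≤ 2 * K * |t| := by
  unfold chi
  refine (abs_max_sub_max_le_max _ _ _ _).trans (max_le (by simp; positivity) ?_)
  refine (abs_min_sub_min_le_max _ _ _ _).trans (max_le (by simp; positivity) ?_)
  rw [show 2 - 2 * (K : ℝ) * nd (s + t) - (2 - 2 * K * nd s) = -(2 * K * (nd (s + t) - nd s)) by ring,
    abs_neg, abs_mul, abs_of_nonneg (show (0 : ℝ) ≤ 2 * K by positivity)]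
  exact mul_le_mul_of_nonneg_left (nd_lip s t) (by positivity)

lemma chi_or_psi {K : ℕ} {s : ℝ} (h : chi K s ≠ 1) : psi K s = 1 ∧ (2 * K : ℝ)⁻¹ ≤ nd s := by
  have h1 : 1 < 2 * K * nd s := by
    by_contra hc
    push Not at hc
    apply h
    unfold chi
    rw [min_eq_left (by linarith)]; simp
  refine ⟨min_eq_left h1.le, ?_⟩
  have hK : (0 : ℝ) < 2 * K := by
    rcases Nat.eq_zero_or_pos K with h0 | h0
    · subst h0; norm_num at h1
    · positivity
  rw [inv_le_iff_one_le_mul₀ hK]; linarith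

lemma chi_sum {K : ℕ} (hK : 0 < K) (s : ℝ) : ∑ i : Fin K, chi K (s + (i : ℕ) / K) ≤ 2 := by
  classical
  have hK' : (0 : ℝ) < K := by exact_mod_cast hK
  set A : Finset (Fin K) := Finset.univ.filter fun i => nd (s + (i : ℕ) / K) < 1 / K with hA
  have h1 : ∑ i : Fin K, chi K (s + (i : ℕ) / K) ≤ ∑ i ∈ A, (1 : ℝ) := by
    rw [hA, Finset.sum_filter]
    refine Finset.sum_le_sum fun i _ => ?_
    split_ifs with h
    · exact chi_le_one _ _
    · push Not at h
      refine max_le le_rfl ((min_le_right _ _).trans ?_)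
      rw [div_le_iff₀ hK'] at h
      linarith
  refine h1.trans ?_
  have h2 : A.card ≤ ({⌊(K : ℝ) * s⌋, ⌊(K : ℝ) * s⌋ + 1} : Finset ℤ).card := by
    refine Finset.card_le_card_of_injOn (fun i => K * round (s + ((i : ℕ) : ℝ) / K) - (i : ℕ)) ?_ ?_
    · intro i hi
      rw [Finset.mem_coe, hA, Finset.mem_filter] at hi
      have h3 := hi.2
      unfold nd at h3
      set z := round (s + ((i : ℕ) : ℝ) / K)
      have h4 : |(K : ℝ) * s - ((K * z - (i : ℕ) : ℤ) : ℝ)| < 1 := by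
        have : (K : ℝ) * s - ((K * z - (i : ℕ) : ℤ) : ℝ) = K * (s + ((i : ℕ) : ℝ) / K - z) := by
          push_cast; field_simp; ring
        rw [this, abs_mul, abs_of_pos hK']
        rw [lt_div_iff₀ hK'] at h3
        linarith
      rw [abs_lt] at h4
      simp only [Finset.coe_insert, Finset.coe_singleton, Set.mem_insert_iff, Set.mem_singleton_iff]
      set w : ℤ := K * z - (i : ℕ)
      have h5 : ⌊(K : ℝ) * s⌋ < w + 1 := by
        rw [Int.floor_lt]; push_cast; linarith
      have h6 : w - 1 ≤ ⌊(K : ℝ) * s⌋ := by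
        rw [Int.le_floor]; push_cast; linarith
      omega
    · intro i _ j _ hij
      simp only at hij
      set a := round (s + ((i : ℕ) : ℝ) / K)
      set b := round (s + ((j : ℕ) : ℝ) / K)
      have h3 : (K : ℤ) * (a - b) = (i : ℕ) - (j : ℕ) := by linarith
      have hi := i.2
      have hj := j.2
      have h4 : a - b = 0 := by
        have h5 : a - b < 1 := by
          by_contra hc
          push Not at hc
          nlinarith
        have h6 : -1 < a - b := by
          by_contra hc
          push Not at hc
          nlinarith
        omega
      rw [h4] at h3
      apply Fin.ext
      omega
  have h3 := h2.trans Finset.card_le_two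
  rw [Finset.sum_const, nsmul_eq_mul, mul_one]
  exact_mod_cast h3

section fns
variable {X : Type u} [MeasurableSpace X] {T e : X → X}

lemma zpow_succ (hTe : ∀ x, e (T x) = x) (n : ℤ) (x : X) :
    zpowIter T e (n + 1) x = zpowIter T e n (T x) := by
  unfold zpowIter
  rcases lt_trichotomy n (-1) with h | h | h
  · rw [if_neg (by omega), if_neg (by omega), show (-n).toNat = (-(n + 1)).toNat + 1 by omega,
      Function.iterate_succ_apply, hTe]
  · subst h; simp [hTe]
  · rw [if_pos (by omega), if_pos (by omega), show (n + 1).toNat = n.toNat + 1 by omega,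
      Function.iterate_succ_apply]

lemma zpow_meas (hT : Measurable T) (he : Measurable e) (n : ℤ) : Measurable (zpowIter T e n) := by
  unfold zpowIter
  split_ifs
  · exact hT.iterate _
  · exact he.iterate _

/-- The cutoff as an element of the algebra. -/
noncomputable def chiA (X : Type u) (K : ℕ) : (bFlow X).alg :=
  ⟨fun y => chi K y.2, ⟨1, fun y => by rw [abs_of_nonneg (chi_nonneg _ _)]; exact chi_le_one _ _⟩,
    2 * K, fun t y => chi_lip K y.2 t⟩

lemma chiA_mem (K : ℕ) : chiA X K ∈ bV T := by
  refine ⟨?_, fun x s => ?_⟩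
  · have : Continuous (chi K) := by
      unfold chi
      have := nd_cont
      fun_prop
    exact this.measurable.comp measurable_snd
  · show chi K s = chi K (s + 1)
    unfold chi; rw [nd_add_one]

lemma hat_lip {T e : X → X} {h : X → ℝ} {C : ℝ} (hC : ∀ x, |h x| ≤ C) (K : ℕ) (x : X) (s t : ℝ) :
    |h (zpowIter T e ⌊s + t⌋ x) * psi K (s + t) - h (zpowIter T e ⌊s⌋ x) * psi K s|
      ≤ (4 * K * C) * |t| := by
  have hC0 : 0 ≤ C := (abs_nonneg _).trans (hC x)
  by_cases hf : ⌊s + t⌋ = ⌊s⌋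
  · rw [hf, ← mul_sub, abs_mul]
    have := mul_le_mul (hC (zpowIter T e ⌊s⌋ x)) (psi_lip K s t) (abs_nonneg _) hC0
    have h2 : 0 ≤ C * (2 * K * |t|) := by positivity
    linarith
  · have h1 := psi_lt_of_floor (K := K) hf
    have h2 : psi K (s + t) ≤ 2 * K * |t| := by
      have := psi_lt_of_floor (K := K) (s := s + t) (t := -t) (by
        rw [add_neg_cancel_right]; exact fun h => hf h.symm)
      rwa [abs_neg] at this
    refine (abs_sub _ _).trans ?_
    rw [abs_mul, abs_mul, abs_of_nonneg (psi_nonneg _ _), abs_of_nonneg (psi_nonneg _ _)]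
    have h3 := mul_le_mul (hC (zpowIter T e ⌊s + t⌋ x)) h2 (psi_nonneg _ _) hC0
    have h4 := mul_le_mul (hC (zpowIter T e ⌊s⌋ x)) h1 (psi_nonneg _ _) hC0
    linarith

/-- Smoothed suspension of `h`. -/
noncomputable def hatA (T e : X → X) (h : X → ℝ) (hb : ∃ C, ∀ x, |h x| ≤ C) (K : ℕ) : (bFlow X).alg :=
  ⟨fun y => h (zpowIter T e ⌊y.2⌋ y.1) * psi K y.2, by
    obtain ⟨C, hC⟩ := hb
    refine ⟨⟨C, fun y => ?_⟩, 4 * K * C, fun t y => hat_lip hC K y.1 y.2 t⟩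
    rw [abs_mul, abs_of_nonneg (psi_nonneg _ _)]
    have hC0 : 0 ≤ C := (abs_nonneg _).trans (hC y.1)
    exact (mul_le_mul (hC _) (psi_le_one _ _) (psi_nonneg _ _) hC0).trans (by simp)⟩

lemma hatA_mem (hT : Measurable T) (he : Measurable e) (hTe : ∀ x, e (T x) = x) {h : X → ℝ} (hm : Measurable h)
    (hb : ∃ C, ∀ x, |h x| ≤ C) (K : ℕ) : hatA T e h hb K ∈ bV T := by
  refine ⟨?_, fun x s => ?_⟩
  · have h1 : Measurable (fun p : X × ℤ => h (zpowIter T e p.2 p.1)) :=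
      measurable_from_prod_countable_left fun n => hm.comp (zpow_meas hT he n)
    have h2 : Measurable (fun y : X × ℝ => (y.1, ⌊y.2⌋)) :=
      measurable_fst.prodMk (Int.measurable_floor.comp measurable_snd)
    have h3 : Continuous (psi K) := by
      unfold psi
      have := nd_cont
      fun_prop
    exact (h1.comp h2).mul (h3.measurable.comp measurable_snd)
  · show h (zpowIter T e ⌊s⌋ (T x)) * psi K s = h (zpowIter T e ⌊s + 1⌋ x) * psi K (s + 1)
    rw [Int.floor_add_one, zpow_succ hTe]
    unfold psi; rw [nd_add_one]

end fns
end WE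

namespace WE
universe u
set_option linter.unusedSectionVars false

lemma shift_avg {H : Type*} [NormedAddCommGroup H] [NormedSpace ℝ H] {y : ℕ → H} {C : ℝ}
    (hy : ∀ n, ‖y n‖ ≤ C) (j N : ℕ) :
    ‖(N : ℝ)⁻¹ • ∑ n ∈ range N, y (n + j) - (N : ℝ)⁻¹ • ∑ n ∈ range N, y n‖ ≤ (N : ℝ)⁻¹ * (2 * j * C) := by
  have h1 := Finset.sum_range_add y N j
  have h2 := Finset.sum_range_add y j N
  rw [add_comm j N] at h2
  have h3 : ∑ n ∈ range N, y (n + j) - ∑ n ∈ range N, y n = ∑ x ∈ range j, y (N + x) - ∑ x ∈ range j, y x := by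
    simp only [add_comm _ j]
    rw [sub_eq_sub_iff_add_eq_add, add_comm _ (∑ n ∈ range N, y n), ← h1, h2, add_comm]
  rw [← smul_sub, h3, norm_smul, norm_inv, Real.norm_natCast]
  gcongr
  refine (norm_sub_le _ _).trans ?_
  have e1 : ‖∑ x ∈ range j, y (N + x)‖ ≤ j * C := by
    refine (norm_sum_le_of_le _ fun x _ => hy (N + x)).trans ?_
    simp
  have e2 : ‖∑ x ∈ range j, y x‖ ≤ j * C := by
    refine (norm_sum_le_of_le _ fun x _ => hy x).trans ?_
    simp
  linarith

/-- Cesàro averages of null sequences. -/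
lemma cesaro_null {H : Type*} [NormedAddCommGroup H] [NormedSpace ℝ H] {y : ℕ → H}
    (h : Tendsto y atTop (nhds 0)) : Tendsto (fun N : ℕ => (N : ℝ)⁻¹ • ∑ n ∈ range N, y n) atTop (nhds 0) :=
  h.cesaro_smul

section gen
variable {Y : Type u} {E : Type} [AddCommGroup E] [Module ℝ E]

lemma F_ofFn (s : Sys Y) {k : ℕ} (l : Fin k → E →ₗ[ℝ] ℝ) (a : Fin k → s.A) (u : E) :
    s.F (List.ofFn fun j => (l j, a j)) u = ∏ j, s.act (l j u) (a j) := by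
  unfold Sys.F
  rw [List.map_ofFn, List.prod_ofFn]
  rfl

theorem prod_cauchy (c : Curve E) (s : Sys Y) (lam : E →ₗ[ℝ] ℝ) {k : ℕ} (a : Fin k → s.A) :
    CauchySeq (fun N : ℕ => (N : ℝ)⁻¹ • ∑ n ∈ range N,
      s.ι (∏ j : Fin k, s.act (lam (c.u (n + j))) (a j))) := by
  have h1 := c.out_b s (List.ofFn fun j : Fin k => (lam ∘ₗ (c.U ^ (j : ℕ)), a j))
  simp only [F_ofFn] at h1
  have h2 := s.F_tendsto (E := Fin k → ℝ) (List.ofFn fun j : Fin k => (LinearMap.proj j, a j))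
    (l := (atTop : Filter ℕ)) (fun n j => lam (c.u (n + j))) (fun n j => lam ((c.U ^ (j : ℕ)) (c.u n))) (by
      intro p hp
      obtain ⟨j, rfl⟩ := (List.mem_ofFn' _ _).1 hp
      have := c.u_add j lam
      simpa using this)
  simp only [F_ofFn, LinearMap.proj_apply] at h2
  have h3 := cesaro_null h2
  obtain ⟨z, hz⟩ := cauchySeq_tendsto_of_complete h1
  have h4 := h3.add hz
  refine Tendsto.cauchySeq (x := 0 + z) (h4.congr fun N => ?_)
  rw [← smul_add, ← Finset.sum_add_distrib]
  congr 1
  refine Finset.sum_congr rfl fun n _ => ?_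
  simp [LinearMap.comp_apply]

theorem avg_small (c : Curve E) (s : Sys Y) (lam : E →ₗ[ℝ] ℝ) {v : E} (hv : lam v = 1) {K : ℕ} (hK : 0 < K)
    (a : s.A) (ha0 : ∀ y, |a.1 y| ≤ 1)
    (ha : ∀ t y, |∑ i : Fin K, (s.act (t + (i : ℕ) / K) a).1 y| ≤ 2) (j : ℕ) :
    ∀ᶠ N : ℕ in atTop, ‖(N : ℝ)⁻¹ • ∑ n ∈ range N, s.ι (s.act (lam (c.u (n + j))) a)‖ ≤ 3 / K := by
  have hK' : (0 : ℝ) < K := by exact_mod_cast hK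
  haveI : Nonempty (Fin K) := ⟨⟨0, hK⟩⟩
  let P : Avg E := ⟨Fin K, inferInstance, inferInstance, fun i => (((i : ℕ) : ℝ) / K) • v⟩
  have h1 := c.out_a s [(lam, a)] P
  have hF : ∀ u, s.F [(lam, a)] u = s.act (lam u) a := fun u => by simp [Sys.F]
  simp only [hF] at h1
  have h2 : ∀ u, ‖P.ap (fun u => s.ι (s.act (lam u) a)) u‖ ≤ 2 / K := by
    intro u
    have e : P.ap (fun u => s.ι (s.act (lam u) a)) u
        = (K : ℝ)⁻¹ • s.ι (∑ i : Fin K, s.act (lam u + (i : ℕ) / K) a) := by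
      unfold Avg.ap
      show (Fintype.card (Fin K) : ℝ)⁻¹ • ∑ i : Fin K, s.ι (s.act (lam (u + (((i : ℕ) : ℝ) / K) • v)) a) = _
      rw [Fintype.card_fin, map_sum]
      simp [hv]
    rw [e, norm_smul, norm_inv, Real.norm_natCast, div_eq_inv_mul]
    gcongr
    refine s.norm_ι_le (by norm_num) fun y => ?_
    have e2 : (∑ i : Fin K, s.act (lam u + (i : ℕ) / K) a).1 y
        = ∑ i : Fin K, (s.act (lam u + (i : ℕ) / K) a).1 y := by
      rw [AddSubmonoidClass.coe_finsetSum, Finset.sum_apply]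
    rw [e2]; exact ha _ _
  have hb : ∀ n, ‖s.ι (s.act (lam (c.u n)) a)‖ ≤ 1 := fun n =>
    s.norm_ι_le zero_le_one fun y => ha0 _
  have h3 : Tendsto (fun N : ℕ => (N : ℝ)⁻¹ * (2 * j * 1)) atTop (nhds 0) := by
    simpa using (tendsto_inv_atTop_nhds_zero_nat (𝕜 := ℝ)).mul_const (2 * (j : ℝ) * 1)
  have h4 := (h1.norm.add h3)
  simp only [norm_zero, add_zero] at h4
  filter_upwards [h4.eventually (gt_mem_nhds (show (0 : ℝ) < 1 / K by positivity))] with N hN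
  have h5 := shift_avg hb j N
  have h6 : ‖(N : ℝ)⁻¹ • ∑ n ∈ range N, P.ap (fun u => s.ι (s.act (lam u) a)) (c.u n)‖ ≤ 2 / K := by
    rw [norm_smul, norm_inv, Real.norm_natCast]
    have := norm_sum_le_of_le (range N) fun n _ => h2 (c.u n)
    rw [Finset.sum_const, card_range, nsmul_eq_mul] at this
    rcases Nat.eq_zero_or_pos N with h0 | h0
    · subst h0; simp; positivity
    · have hN0 : (0 : ℝ) < N := by exact_mod_cast h0
      rw [inv_mul_le_iff₀ hN0]; exact this
  rw [Finset.sum_sub_distrib, smul_sub] at hN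
  set A := (N : ℝ)⁻¹ • ∑ n ∈ range N, P.ap (fun u => s.ι (s.act (lam u) a)) (c.u n)
  set B := (N : ℝ)⁻¹ • ∑ n ∈ range N, s.ι (s.act (lam (c.u n)) a)
  set D := (N : ℝ)⁻¹ • ∑ n ∈ range N, s.ι (s.act (lam (c.u (n + j))) a)
  have e : D = (D - B) - (A - B) + A := by abel
  have h7 : ‖D‖ ≤ ‖D - B‖ + ‖A - B‖ + ‖A‖ := by
    calc ‖D‖ = ‖(D - B) - (A - B) + A‖ := by rw [← e]
      _ ≤ _ := (norm_add_le _ _).trans (by gcongr; exact norm_sub_le _ _)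
  have : (3 : ℝ) / K = 1 / K + 2 / K := by ring
  linarith

end gen

section base
variable {X : Type u} [MeasurableSpace X] (μ : Measure X) [IsProbabilityMeasure μ] {T : X → X}

lemma b0_ge (w : bV T) (hw : ∀ y, 0 ≤ w.1.1 y) {c : X → ℝ} (hc : Integrable c μ) {d : ℝ} (h0 : 0 ≤ d) (h1 : d ≤ 1)
    (h : ∀ x s, 0 ≤ s → s ≤ d → c x ≤ w.1.1 (x, s)) : d * ∫ x, c x ∂μ ≤ b0 μ w := by
  have hI : ∀ a b, IntervalIntegrable (bI μ w.1) volume a b := fun a b => (bI_cont μ w.2.1).intervalIntegrable _ _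
  have e1 : ∫ s in (0 : ℝ)..d, bI μ w.1 s ≤ ∫ s in (0 : ℝ)..1, bI μ w.1 s :=
    intervalIntegral.integral_mono_interval le_rfl h0 h1
      (Eventually.of_forall fun s => integral_nonneg fun x => hw _) (hI 0 1)
  have e2 : ∫ s in (0 : ℝ)..d, (∫ x, c x ∂μ) ≤ ∫ s in (0 : ℝ)..d, bI μ w.1 s := by
    refine intervalIntegral.integral_mono_on h0 (by simp) (hI 0 d) fun s hs => ?_
    exact integral_mono hc (b_int μ w.2.1 s) fun x => h x s hs.1 hs.2
  rw [intervalIntegral.integral_const, sub_zero, smul_eq_mul] at e2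
  exact e2.trans e1

lemma prod_near {k : ℕ} (T e : X → X) (h : Fin (k + 1) → X → ℝ) {D : ℝ} (hD : 1 ≤ D) (hh : ∀ i x, |h i x| ≤ D)
    {K : ℕ} (a : Fin (k + 1) → ℝ) (x : X) (s : ℝ) (h0 : 0 ≤ s) (h1 : s ≤ (2 * K : ℝ)⁻¹) :
    |∏ i, h i (zpowIter T e ⌊a i⌋ x) - ∏ i, (h i (zpowIter T e ⌊s + a i⌋ x) * psi K (s + a i))|
      ≤ 2 * D ^ (k + 1) * ∑ i, chi K (s + a i) := by
  have hD0 : (0 : ℝ) ≤ D ^ (k + 1) := by positivity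
  by_cases hc : ∀ i, chi K (s + a i) ≠ 1
  · have : ∏ i, h i (zpowIter T e ⌊a i⌋ x) = ∏ i, (h i (zpowIter T e ⌊s + a i⌋ x) * psi K (s + a i)) := by
      refine Finset.prod_congr rfl fun i _ => ?_
      obtain ⟨e1, e2⟩ := chi_or_psi (hc i)
      rw [e1, mul_one, floor_near h0 h1 e2]
    rw [this, sub_self, abs_zero]
    exact mul_nonneg (by positivity) (Finset.sum_nonneg fun i _ => chi_nonneg _ _)
  · push Not at hc
    obtain ⟨i, hi⟩ := hc
    have e1 : 1 ≤ ∑ i, chi K (s + a i) := by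
      rw [← hi]
      exact Finset.single_le_sum (f := fun i => chi K (s + a i)) (fun i _ => chi_nonneg _ _) (mem_univ i)
    have e2 : |∏ i, h i (zpowIter T e ⌊a i⌋ x)| ≤ D ^ (k + 1) := by
      rw [Finset.abs_prod]
      refine (Finset.prod_le_prod (fun i _ => abs_nonneg _) fun i _ => hh i _).trans ?_
      simp
    have e3 : |∏ i, (h i (zpowIter T e ⌊s + a i⌋ x) * psi K (s + a i))| ≤ D ^ (k + 1) := by
      rw [Finset.abs_prod]
      refine (Finset.prod_le_prod (fun i _ => abs_nonneg _) (g := fun _ => D) fun i _ => ?_).trans ?_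
      · rw [abs_mul, abs_of_nonneg (psi_nonneg _ _)]
        exact (mul_le_mul (hh i _) (psi_le_one _ _) (psi_nonneg _ _) (by linarith)).trans (by simp)
      · simp
    refine (abs_sub _ _).trans ?_
    nlinarith

end base
end WE

namespace WE
universe u
set_option linter.unusedSectionVars false

section main
variable {X : Type u} [MeasurableSpace X] (μ : Measure X) [IsProbabilityMeasure μ] {T e : X → X}
variable {E : Type} [AddCommGroup E] [Module ℝ E]

/-- Evaluation. -/
def ev (y : X × ℝ) : (bFlow X).alg →ₐ[ℝ] ℝ := (Pi.evalAlgHom ℝ (fun _ : X × ℝ => ℝ) y).comp (bFlow X).alg.val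

/-- The averages. -/
noncomputable def bav (T e : X → X) {k : ℕ} (h : Fin (k + 1) → X → ℝ) (a : ℕ → ℝ) (N : ℕ) (x : X) : ℝ :=
  (N : ℝ)⁻¹ * ∑ n ∈ range N, ∏ i : Fin (k + 1), h i (zpowIter T e ⌊a (n + (i : ℕ))⌋ x)

lemma bterm_bd {k : ℕ} {h : Fin (k + 1) → X → ℝ} {D : ℝ} (hh : ∀ i x, |h i x| ≤ D)
    (a : ℕ → ℝ) (n : ℕ) (x : X) : |∏ i : Fin (k + 1), h i (zpowIter T e ⌊a (n + (i : ℕ))⌋ x)| ≤ D ^ (k + 1) := by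
  rw [Finset.abs_prod]
  refine (Finset.prod_le_prod (fun i _ => abs_nonneg _) fun i _ => hh i _).trans ?_
  simp

lemma bav_bd {k : ℕ} {h : Fin (k + 1) → X → ℝ} {D : ℝ} (hh : ∀ i x, |h i x| ≤ D) (hD : 0 ≤ D)
    (a : ℕ → ℝ) (N : ℕ) (x : X) : |bav T e h a N x| ≤ D ^ (k + 1) := by
  unfold bav
  rw [abs_mul, abs_inv, Nat.abs_cast]
  have := (Finset.abs_sum_le_sum_abs _ _).trans (Finset.sum_le_sum fun n (_ : n ∈ range N) => bterm_bd (T := T) (e := e) hh a n x)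
  rw [Finset.sum_const, card_range, nsmul_eq_mul] at this
  rcases Nat.eq_zero_or_pos N with h0 | h0
  · subst h0; simp; positivity
  · have hN0 : (0 : ℝ) < N := by exact_mod_cast h0
    rw [inv_mul_le_iff₀ hN0]; exact this

lemma bav_meas {k : ℕ} {h : Fin (k + 1) → X → ℝ} (hT : Measurable T) (he : Measurable e) (hm : ∀ i, Measurable (h i))
    (a : ℕ → ℝ) (N : ℕ) : Measurable (bav T e h a N) := by
  unfold bav
  refine Measurable.const_mul (Finset.measurable_fun_sum _ fun n _ => Finset.measurable_fun_prod _ fun i _ => ?_) _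
  exact (hm i).comp (zpow_meas hT he _)

theorem l2_cauchy (hT : Measurable T) (he : Measurable e) (hTe : ∀ x, e (T x) = x) (hp : MeasurePreserving T μ μ)
    (c : Curve E) (lam : E →ₗ[ℝ] ℝ) {v : E} (hv : lam v = 1) {k : ℕ} {h : Fin (k + 1) → X → ℝ}
    (hm : ∀ i, Measurable (h i)) {D : ℝ} (hD : 1 ≤ D) (hh : ∀ i x, |h i x| ≤ D) {ε : ℝ} (hε : 0 < ε) :
    ∃ N0, ∀ N ≥ N0, ∀ M ≥ N0,
      ∫ x, (bav T e h (fun n => lam (c.u n)) N x - bav T e h (fun n => lam (c.u n)) M x) ^ 2 ∂μ ≤ ε := by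
  obtain ⟨φ, f1, f2, f3, f4⟩ := exists_base μ hp
  let s : Sys (X × ℝ) := ⟨bFlow X, φ, f1, f2, f3⟩
  have hφ : ∀ a : bV T, s.φ a.1 = b0 μ a := f4
  set B := D ^ (k + 1) with hB
  have hB0 : 1 ≤ B := one_le_pow₀ hD
  -- choose `K`
  obtain ⟨K, hK⟩ := exists_nat_gt (max 1 (2 * (24 * B ^ 2 * (3 * (k + 1)) ^ 2 * 2) / ε))
  have hK1 : (1 : ℝ) < K := (le_max_left _ _).trans_lt hK
  have hK0 : 0 < K := by
    have : (0 : ℝ) < K := by linarith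
    exact_mod_cast this
  have hK2 := (le_max_right _ _).trans_lt hK
  set δ : ℝ := (2 * K : ℝ)⁻¹ with hδ
  have hδ0 : 0 < δ := by positivity
  have hδ1 : δ ≤ 1 := inv_le_one_of_one_le₀ (by linarith)
  let A : Fin (k + 1) → s.A := fun i => hatA T e (h i) ⟨D, hh i⟩ K
  let Q : ℕ → s.A := fun n => ∏ j : Fin (k + 1), s.act (lam (c.u (n + j))) (A j)
  let BN : ℕ → s.A := fun N => (N : ℝ)⁻¹ • ∑ n ∈ range N, Q n
  let GG : Fin (k + 1) → ℕ → s.A := fun j N => (N : ℝ)⁻¹ • ∑ n ∈ range N, s.act (lam (c.u (n + j))) (chiA X K)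
  let G : ℕ → s.A := fun N => ∑ j, GG j N
  have hQ : ∀ n, Q n ∈ bV T := fun n => Subalgebra.prod_mem _ fun j _ =>
    bV_act (hatA_mem hT he hTe (hm j) ⟨D, hh j⟩ K) _
  have hBN : ∀ N, BN N ∈ bV T := fun N => (bV T).smul_mem ((bV T).sum_mem fun n _ => hQ n) _
  have hG : ∀ N, G N ∈ bV T := fun N => (bV T).sum_mem fun j _ =>
    (bV T).smul_mem ((bV T).sum_mem fun n _ => bV_act (chiA_mem K) _) _
  -- the average is Cauchy
  have hc1 : CauchySeq (fun N => s.ι (BN N)) := by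
    have := prod_cauchy c s lam A
    have e : (fun N => s.ι (BN N)) = fun N : ℕ => (N : ℝ)⁻¹ • ∑ n ∈ range N,
        s.ι (∏ j : Fin (k + 1), s.act (lam (c.u (n + j))) (A j)) := by
      funext N
      rw [← map_sum, ← map_smul]
    rw [e]; exact this
  have hg : ∀ᶠ N in atTop, ‖s.ι (G N)‖ ≤ 3 * (k + 1) / K := by
    have h1 : ∀ j : Fin (k + 1), ∀ᶠ N in atTop, ‖s.ι (GG j N)‖ ≤ 3 / K := by
      intro j
      have := avg_small c s lam hv hK0 (chiA X K) (fun y => by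
        show |chi K y.2| ≤ 1
        rw [abs_of_nonneg (chi_nonneg _ _)]; exact chi_le_one _ _) (fun t y => by
        show |∑ i : Fin K, chi K (y.2 + (t + (i : ℕ) / K))| ≤ 2
        rw [abs_of_nonneg (Finset.sum_nonneg fun i _ => chi_nonneg _ _)]
        simp only [← add_assoc]
        exact chi_sum hK0 _) j
      filter_upwards [this] with N hN
      rwa [← map_sum, ← map_smul] at hN
    filter_upwards [eventually_all.2 h1] with N hN
    have : s.ι (G N) = ∑ j, s.ι (GG j N) := map_sum _ _ _
    rw [this]
    refine (norm_sum_le_of_le _ fun j _ => hN j).trans ?_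
    simp; apply le_of_eq; ring
  have hdiff : ∀ N x r, 0 ≤ r → r ≤ δ →
      |bav T e h (fun n => lam (c.u n)) N x - ev (x, r) (BN N)| ≤ 2 * B * ev (x, r) (G N) := by
    intro N x r h0 h1
    have e1 : ev (x, r) (BN N) = (N : ℝ)⁻¹ * ∑ n ∈ range N, ∏ i : Fin (k + 1),
        (h i (zpowIter T e ⌊r + lam (c.u (n + i))⌋ x) * psi K (r + lam (c.u (n + i)))) := by
      show ev (x, r) ((N : ℝ)⁻¹ • ∑ n ∈ range N, ∏ j : Fin (k + 1), s.act (lam (c.u (n + j))) (A j)) = _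
      rw [map_smul, map_sum, smul_eq_mul]
      congr 1
      refine Finset.sum_congr rfl fun n _ => ?_
      rw [map_prod]; rfl
    have e2 : ev (x, r) (G N) = (N : ℝ)⁻¹ * ∑ n ∈ range N, ∑ i : Fin (k + 1), chi K (r + lam (c.u (n + i))) := by
      show ev (x, r) (∑ j : Fin (k + 1), (N : ℝ)⁻¹ • ∑ n ∈ range N, s.act (lam (c.u (n + j))) (chiA X K)) = _
      rw [map_sum, Finset.sum_comm, Finset.mul_sum]
      refine Finset.sum_congr rfl fun j _ => ?_
      rw [map_smul, map_sum, smul_eq_mul]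
      rfl
    rw [e1, e2, bav, ← mul_sub, ← Finset.sum_sub_distrib, abs_mul, abs_of_nonneg (by positivity),
      ← mul_assoc, mul_comm (2 * B), mul_assoc]
    gcongr
    refine (Finset.abs_sum_le_sum_abs _ _).trans ?_
    rw [Finset.mul_sum]
    exact Finset.sum_le_sum fun n _ => prod_near T e h hD hh (fun i => lam (c.u (n + i))) x r h0 h1
  have key : ∀ N M, δ * ∫ x, (bav T e h (fun n => lam (c.u n)) N x - bav T e h (fun n => lam (c.u n)) M x) ^ 2 ∂μ
      ≤ 3 * ‖s.ι (BN N) - s.ι (BN M)‖ ^ 2 + 12 * B ^ 2 * ‖s.ι (G N)‖ ^ 2 + 12 * B ^ 2 * ‖s.ι (G M)‖ ^ 2 := by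
    intro N M
    let w : s.A := (3 : ℝ) • ((BN N - BN M) * (BN N - BN M)) + (12 * B ^ 2) • (G N * G N) + (12 * B ^ 2) • (G M * G M)
    have hwm : w ∈ bV T := by
      have hd := (bV T).sub_mem (hBN N) (hBN M)
      exact (bV T).add_mem ((bV T).add_mem ((bV T).smul_mem ((bV T).mul_mem hd hd) _)
        ((bV T).smul_mem ((bV T).mul_mem (hG N) (hG N)) _)) ((bV T).smul_mem ((bV T).mul_mem (hG M) (hG M)) _)
    have hwe : ∀ y, w.1 y = 3 * (ev y (BN N) - ev y (BN M)) ^ 2 + 12 * B ^ 2 * (ev y (G N)) ^ 2 + 12 * B ^ 2 * (ev y (G M)) ^ 2 := by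
      intro y
      show ev y ((3 : ℝ) • ((BN N - BN M) * (BN N - BN M)) + (12 * B ^ 2) • (G N * G N) + (12 * B ^ 2) • (G M * G M)) = _
      rw [map_add, map_add, map_smul, map_smul, map_smul, map_mul, map_mul, map_mul, map_sub]
      simp only [smul_eq_mul]; ring
    have e1 := b0_ge μ ⟨w, hwm⟩ (fun y => by rw [hwe]; positivity)
      (c := fun x => (bav T e h (fun n => lam (c.u n)) N x - bav T e h (fun n => lam (c.u n)) M x) ^ 2)
      (by
        refine Integrable.of_bound (((bav_meas hT he hm _ N).sub (bav_meas hT he hm _ M)).pow_const 2).aestronglyMeasurable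
          ((B + B) ^ 2) (Eventually.of_forall fun x => ?_)
        rw [norm_pow, Real.norm_eq_abs]
        have := (abs_sub _ _).trans (add_le_add (bav_bd (T := T) (e := e) hh (by linarith) (fun n => lam (c.u n)) N x)
          (bav_bd (T := T) (e := e) hh (by linarith) (fun n => lam (c.u n)) M x))
        gcongr) hδ0.le hδ1
      (fun x r h0 h1 => by
        rw [hwe]
        have d1 := hdiff N x r h0 h1
        have d2 := hdiff M x r h0 h1
        set p := bav T e h (fun n => lam (c.u n)) N x
        set q := bav T e h (fun n => lam (c.u n)) M x
        set p' := ev (x, r) (BN N)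
        set q' := ev (x, r) (BN M)
        have d3 := sq_le_sq' (abs_le.1 d1).1 (abs_le.1 d1).2
        have d4 := sq_le_sq' (abs_le.1 d2).1 (abs_le.1 d2).2
        have d5 : (p - q) ^ 2 ≤ 3 * (p - p') ^ 2 + 3 * (p' - q') ^ 2 + 3 * (q - q') ^ 2 := by
          nlinarith [sq_nonneg ((p - p') - (p' - q')), sq_nonneg ((p - p') + (q - q')), sq_nonneg ((p' - q') + (q - q'))]
        nlinarith)
    rw [← hφ] at e1
    refine e1.trans (le_of_eq ?_)
    show s.φ ((3 : ℝ) • ((BN N - BN M) * (BN N - BN M)) + (12 * B ^ 2) • (G N * G N) + (12 * B ^ 2) • (G M * G M)) = _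
    rw [map_add, map_add, map_smul, map_smul, map_smul, ← map_sub, s.norm_ι_sq, s.norm_ι_sq, s.norm_ι_sq]
    simp only [smul_eq_mul]
  rw [Metric.cauchySeq_iff] at hc1
  obtain ⟨N1, hN1⟩ := hc1 (Real.sqrt (δ * ε / 6)) (by positivity)
  obtain ⟨N2, hN2⟩ := eventually_atTop.1 hg
  refine ⟨max N1 N2, fun N hN M hM => ?_⟩
  have k0 := key N M
  have k1 := hN1 N ((le_max_left _ _).trans hN) M ((le_max_left _ _).trans hM)
  have k2 := hN2 N ((le_max_right _ _).trans hN)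
  have k3 := hN2 M ((le_max_right _ _).trans hM)
  rw [dist_eq_norm] at k1
  have k1' : ‖s.ι (BN N) - s.ι (BN M)‖ ^ 2 ≤ δ * ε / 6 := by
    have := pow_le_pow_left₀ (norm_nonneg _) k1.le 2
    rwa [Real.sq_sqrt (by positivity)] at this
  have k2' := pow_le_pow_left₀ (norm_nonneg _) k2 2
  have k3' := pow_le_pow_left₀ (norm_nonneg _) k3 2
  have k4 : 24 * B ^ 2 * (3 * (k + 1) / K) ^ 2 ≤ δ * ε / 2 := by
    rw [div_lt_iff₀ hε] at hK2
    rw [hδ, div_pow, inv_mul_eq_div, div_div, ← mul_div_assoc, div_le_div_iff₀ (by positivity) (by positivity)]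
    have : (0 : ℝ) < K := by linarith
    nlinarith
  have k5 : δ * ∫ x, (bav T e h (fun n => lam (c.u n)) N x - bav T e h (fun n => lam (c.u n)) M x) ^ 2 ∂μ ≤ δ * ε := by
    refine k0.trans ?_
    have hb2 : (0 : ℝ) ≤ 12 * B ^ 2 := by positivity
    have l1 := mul_le_mul_of_nonneg_left k2' hb2
    have l2 := mul_le_mul_of_nonneg_left k3' hb2
    linarith
  exact le_of_mul_le_mul_left k5 hδ0

end main
end WE

namespace WE
universe u
set_option linter.unusedSectionVars false

lemma l2_complete {X : Type u} [MeasurableSpace X] (μ : Measure X) [IsProbabilityMeasure μ] (b : ℕ → X → ℝ)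
    (hm : ∀ N, Measurable (b N)) {C : ℝ} (hb : ∀ N x, |b N x| ≤ C)
    (hc : ∀ ε > 0, ∃ N0, ∀ N ≥ N0, ∀ M ≥ N0, ∫ x, (b N x - b M x) ^ 2 ∂μ ≤ ε) :
    ∃ g : X → ℝ, AEStronglyMeasurable g μ ∧ Tendsto (fun N => eLpNorm (fun x => b N x - g x) 2 μ) atTop (nhds 0) := by
  have hmem : ∀ N, MemLp (b N) 2 μ := fun N =>
    MemLp.of_bound (hm N).aestronglyMeasurable C (Eventually.of_forall fun x => hb N x)
  let F : ℕ → Lp ℝ 2 μ := fun N => (hmem N).toLp (b N)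
  have hF : CauchySeq F := by
    rw [Metric.cauchySeq_iff]
    intro ε hε
    obtain ⟨N0, hN0⟩ := hc ((ε / 2) ^ 2) (by positivity)
    refine ⟨N0, fun N hN M hM => ?_⟩
    rw [dist_eq_norm, ← MemLp.toLp_sub (hmem N) (hmem M), Lp.norm_toLp,
      ((hmem N).sub (hmem M)).eLpNorm_eq_integral_rpow_norm (by norm_num) (by norm_num)]
    have h1 := hN0 N hN M hM
    have h2 : (∫ x, ‖(b N - b M) x‖ ^ (2 : ENNReal).toReal ∂μ) ≤ (ε / 2) ^ 2 := by
      refine le_trans (le_of_eq ?_) h1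
      congr 1; funext x
      simp
    have h0 : 0 ≤ ∫ x, ‖(b N - b M) x‖ ^ (2 : ENNReal).toReal ∂μ := integral_nonneg fun x => by positivity
    rw [ENNReal.toReal_ofReal (by positivity)]
    calc _ ≤ ((ε / 2) ^ 2) ^ ((2 : ENNReal).toReal⁻¹) := Real.rpow_le_rpow h0 h2 (by positivity)
      _ = ε / 2 := by
        rw [show (2 : ENNReal).toReal⁻¹ = (1 / 2 : ℝ) by simp, ← Real.sqrt_eq_rpow, Real.sqrt_sq (by positivity)]
      _ < ε := by linarith
  obtain ⟨g, hg⟩ := cauchySeq_tendsto_of_complete hF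
  refine ⟨g, Lp.aestronglyMeasurable g, ?_⟩
  have := (Lp.tendsto_Lp_iff_tendsto_eLpNorm' F g).1 hg
  refine this.congr fun N => eLpNorm_congr_ae ?_
  filter_upwards [(hmem N).coeFn_toLp] with x hx
  simp only [Pi.sub_apply]
  rw [hx]

theorem final {X : Type u} [MeasurableSpace X] (μ : Measure X) [IsProbabilityMeasure μ]
    (T e : X → X) (hT : Measurable T) (he : Measurable e)
    (hTe : ∀ x, e (T x) = x)
    (hpres : MeasurePreserving T μ μ)
    (ℓ k : ℕ)
    (f : ℕ → ℝ) (hf : memF ℓ f)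
    (hf2 : Tendsto (fun n : ℕ => (n : ℝ) * ddIter f (ℓ + 1) n) atTop atTop)
    (h : Fin (k + 1) → X → ℝ)
    (hmeas : ∀ i, Measurable (h i))
    (hbd : ∀ i, ∃ C : ℝ, ∀ x, |h i x| ≤ C) :
    ∃ g : X → ℝ,
      Tendsto (fun N : ℕ => eLpNorm (fun x =>
          (N : ℝ)⁻¹ * ∑ n ∈ Finset.Icc 1 N,
            ∏ i : Fin (k + 1), h i (zpowIter T e ⌊f (n + (i : ℕ))⌋ x) - g x) 2 μ)
        atTop (nhds 0) := by
  obtain ⟨D, hD, hh⟩ : ∃ D : ℝ, 1 ≤ D ∧ ∀ i x, |h i x| ≤ D := by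
    choose C hC using hbd
    refine ⟨1 + ∑ i, |C i|, by have := Finset.sum_nonneg fun i (_ : i ∈ univ) => abs_nonneg (C i); linarith,
      fun i x => ?_⟩
    have h1 := Finset.single_le_sum (f := fun i => |C i|) (fun i _ => abs_nonneg _) (mem_univ i)
    have h2 := (hC i x).trans (le_abs_self _)
    linarith
  obtain ⟨c, lam, m, hlam, v, hv⟩ := exists_curve ℓ f hf hf2
  have ha : (fun n => lam (c.u n)) = fun n => f (n + m) := funext hlam
  obtain ⟨g, hgm, hg⟩ := l2_complete μ (bav T e h (fun n => lam (c.u n))) (bav_meas hT he hmeas _)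
    (bav_bd hh (by linarith) _) (fun ε hε => l2_cauchy μ hT he hTe hpres c lam hv hmeas hD hh hε)
  refine ⟨g, ?_⟩
  rw [ha] at hg
  set B := D ^ (k + 1)
  let p : ℕ → X → ℝ := fun n x => ∏ i : Fin (k + 1), h i (zpowIter T e ⌊f (n + (i : ℕ))⌋ x)
  have hp : ∀ n x, ‖p n x‖ ≤ B := fun n x => bterm_bd hh f n x
  let A : ℕ → X → ℝ := fun N x => (N : ℝ)⁻¹ * ∑ n ∈ Finset.Icc 1 N, p n x
  have hpm : ∀ n, Measurable (p n) := fun n => Finset.measurable_fun_prod _ fun i _ => (hmeas i).comp (zpow_meas hT he _)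
  have hAm : ∀ N, Measurable (A N) := fun N => (Finset.measurable_fun_sum _ fun n _ => hpm n).const_mul _
  have hcmp : ∀ N x, ‖A N x - bav T e h (fun n => f (n + m)) N x‖ ≤ (N : ℝ)⁻¹ * (2 * B + 2 * m * B) := by
    intro N x
    have h1 := shift_avg (fun n => hp n x) 1 N
    have h2 := shift_avg (fun n => hp n x) m N
    have e1 : A N x = (N : ℝ)⁻¹ • ∑ n ∈ range N, p (n + 1) x := by
      simp only [A, smul_eq_mul]
      rw [Finset.range_eq_Ico, Finset.sum_Ico_add' (fun n => p n x) 0 N 1]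
      congr 1
    have e2 : bav T e h (fun n => f (n + m)) N x = (N : ℝ)⁻¹ • ∑ n ∈ range N, p (n + m) x := by
      simp only [bav, p, smul_eq_mul, add_right_comm _ m]
    rw [e1, e2]
    refine (norm_sub_le_norm_sub_add_norm_sub _ ((N : ℝ)⁻¹ • ∑ n ∈ range N, p n x) _).trans ?_
    rw [norm_sub_rev _ ((N : ℝ)⁻¹ • ∑ n ∈ range N, p (n + m) x)]
    refine (add_le_add h1 h2).trans (le_of_eq ?_)
    push_cast; ring
  have h0 : Tendsto (fun N : ℕ => ENNReal.ofReal ((N : ℝ)⁻¹ * (2 * B + 2 * m * B))) atTop (nhds 0) := by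
    have : Tendsto (fun N : ℕ => (N : ℝ)⁻¹ * (2 * B + 2 * m * B)) atTop (nhds 0) := by
      simpa using (tendsto_inv_atTop_nhds_zero_nat (𝕜 := ℝ)).mul_const (2 * B + 2 * m * B)
    simpa using ENNReal.tendsto_ofReal this
  have h3 := h0.add hg
  rw [add_zero] at h3
  refine tendsto_of_tendsto_of_tendsto_of_le_of_le tendsto_const_nhds h3 (fun _ => zero_le) fun N => ?_
  have hbm := bav_meas hT he hmeas (fun n => f (n + m)) N
  have e : (fun x => A N x - g x) = (fun x => A N x - bav T e h (fun n => f (n + m)) N x)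
      + fun x => bav T e h (fun n => f (n + m)) N x - g x := by
    funext x; simp
  show eLpNorm (fun x => A N x - g x) 2 μ ≤ _
  rw [e]
  refine (eLpNorm_add_le ((hAm N).sub hbm).aestronglyMeasurable
    (hbm.aestronglyMeasurable.sub hgm) (by norm_num)).trans ?_
  refine add_le_add ?_ le_rfl
  refine (eLpNorm_le_of_ae_bound (Eventually.of_forall fun x => hcmp N x)).trans ?_
  simp

end WE

/-- L²-convergence of the Cesàro averages of
`T^{⌊f(n)⌋}h₀ · T^{⌊f(n+1)⌋}h₁ ⋯ T^{⌊f(n+k)⌋}h_k`. -/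
theorem stmt12 {X : Type*} [MeasurableSpace X] (μ : Measure X) [IsProbabilityMeasure μ]
    (T e : X → X) (hT : Measurable T) (he : Measurable e)
    (hTe : ∀ x, e (T x) = x) (heT : ∀ x, T (e x) = x)
    (hpres : MeasurePreserving T μ μ)
    (ℓ k : ℕ) (hk : 1 ≤ k)
    (f : ℕ → ℝ) (hf : memF ℓ f)
    (hf2 : Tendsto (fun n : ℕ => (n : ℝ) * ddIter f (ℓ + 1) n) atTop atTop)
    (h : Fin (k + 1) → X → ℝ)
    (hmeas : ∀ i, Measurable (h i))
    (hbd : ∀ i, ∃ C : ℝ, ∀ x, |h i x| ≤ C) :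
    ∃ g : X → ℝ,
      Tendsto (fun N : ℕ => eLpNorm (fun x =>
          (N : ℝ)⁻¹ * ∑ n ∈ Finset.Icc 1 N,
            ∏ i : Fin (k + 1), h i (zpowIter T e ⌊f (n + (i : ℕ))⌋ x) - g x) 2 μ)
        atTop (nhds 0) := by
  exact WE.final μ T e hT he hTe hpres ℓ k f hf hf2 h hmeas hbd
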